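/- Let a be a positive real number such that log_{10} a is irrational, and let p_n denote the n-th prime. Then the sequence {a^{p_n}} is Benford distributed. -/

import Mathlib

open Filter

/-- `x` has leading digit `d` in base 10: `d·10^k ≤ x < (d+1)·10^k` for some integer `k`. -/
def HasLeadingDigit (x : ℝ) (d : ℕ) : Prop :=
  ∃ k : ℤ, (d : ℝ) * 10 ^ k ≤ x ∧ x < ((d : ℝ) + 1) * 10 ^ k

/-- The Benford frequency `P(d) = log₁₀ (1 + 1/d)` of digit `d`. -/
noncomputable def benfordP (d : ℕ) : ℝ := Real.logb 10 (1 + 1 / (d : ℝ))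

/-- A sequence is Benford distributed if for each digit `d ∈ {1,…,9}` the density of
indices `n` with `D(a_n) = d` equals `P(d)`. -/
def BenfordDistributed (a : ℕ → ℝ) : Prop :=
  ∀ d : ℕ, 1 ≤ d → d ≤ 9 →
    Tendsto
      (fun N : ℕ =>
        (Nat.card {n : ℕ | 1 ≤ n ∧ n ≤ N ∧ HasLeadingDigit (a n) d} : ℝ) / N)
      atTop (nhds (benfordP d))

/-- A sequence is locally Benford distributed of order `k` if every `k`-tuple of digits
in `{1,…,9}` occurs among leading digits of `k` consecutive terms with density
`P(d₀)⋯P(d_{k-1})`. -/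
def LocallyBenfordDistributed (a : ℕ → ℝ) (k : ℕ) : Prop :=
  ∀ d : Fin k → ℕ, (∀ i, 1 ≤ d i ∧ d i ≤ 9) →
    Tendsto
      (fun N : ℕ =>
        (Nat.card {n : ℕ | 1 ≤ n ∧ n ≤ N ∧
            ∀ i : Fin k, HasLeadingDigit (a (n + (i : ℕ))) (d i)} : ℝ) / N)
      atTop (nhds (∏ i : Fin k, benfordP (d i)))

/-- `waitingTime a d i` is the waiting time `w_i(d) = n_{i+1}^{(d)} - n_i^{(d)}`, where
`n_1^{(d)} < n_2^{(d)} < ⋯` enumerates `{n ∈ ℕ, n ≥ 1 : D(a_n) = d}`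
(the `j`-th element of this set, 1-indexed, being `Nat.nth · (j-1)`). -/
noncomputable def waitingTime (a : ℕ → ℝ) (d : ℕ) (i : ℕ) : ℕ :=
  Nat.nth (fun n => 1 ≤ n ∧ HasLeadingDigit (a n) d) i -
    Nat.nth (fun n => 1 ≤ n ∧ HasLeadingDigit (a n) d) (i - 1)

/-- A sequence has Benford distributed waiting times if for each digit `d ∈ {1,…,9}`
the waiting times between occurrences of leading digit `d` take value `k` with density
`P(d)(1-P(d))^{k-1}`. -/
def BenfordWaitingTimes (a : ℕ → ℝ) : Prop :=
  ∀ d : ℕ, 1 ≤ d → d ≤ 9 → ∀ k : ℕ, 1 ≤ k →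
    Tendsto
      (fun N : ℕ =>
        (Nat.card {i : ℕ | 1 ≤ i ∧ i ≤ N ∧ waitingTime a d i = k} : ℝ) / N)
      atTop (nhds (benfordP d * (1 - benfordP d) ^ (k - 1)))

/-- A sequence `u` of real numbers is uniformly distributed modulo 1. -/
def UniformlyDistributedMod1 (u : ℕ → ℝ) : Prop :=
  ∀ t : ℝ, 0 ≤ t → t ≤ 1 →
    Tendsto
      (fun N : ℕ =>
        (Nat.card {n : ℕ | 1 ≤ n ∧ n ≤ N ∧ Int.fract (u n) ≤ t} : ℝ) / N)
      atTop (nhds t)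

/-- `nthPrime n` is the `n`-th prime (1-indexed): `nthPrime 1 = 2`, `nthPrime 2 = 3`, … -/
noncomputable def nthPrime (n : ℕ) : ℕ := Nat.nth Nat.Prime (n - 1)

namespace BP
open Finset

/-- admissible moduli -/
noncomputable def adm (A : Finset ℕ) (D : ℕ) : Finset ℕ :=
  (Icc 1 D).filter (fun k => Squarefree k ∧ k.primeFactors ⊆ A)

lemma mem_adm {A : Finset ℕ} {D k : ℕ} :
    k ∈ adm A D ↔ (1 ≤ k ∧ k ≤ D) ∧ Squarefree k ∧ k.primeFactors ⊆ A := by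
  simp [adm, and_assoc]

lemma adm_dvd {A : Finset ℕ} {D k d : ℕ} (hk : k ∈ adm A D) (hd : d ∣ k) : d ∈ adm A D := by
  rw [mem_adm] at *
  obtain ⟨⟨h1, h2⟩, h3, h4⟩ := hk
  refine ⟨⟨Nat.pos_of_dvd_of_pos hd h1, (Nat.le_of_dvd h1 hd).trans h2⟩,
    h3.squarefree_of_dvd hd, (Nat.primeFactors_mono hd (by omega)).trans h4⟩

lemma one_mem_adm {A : Finset ℕ} {D : ℕ} (hD : 1 ≤ D) : 1 ∈ adm A D := by
  rw [mem_adm]; simp [hD]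

noncomputable def GS (A : Finset ℕ) (D : ℕ) : ℝ := ∑ k ∈ adm A D, (1 : ℝ) / (Nat.totient k)

lemma GS_pos {A : Finset ℕ} {D : ℕ} (hD : 1 ≤ D) : 0 < GS A D := by
  unfold GS
  apply sum_pos
  · intro k hk
    have : 0 < Nat.totient k := Nat.totient_pos.2 (mem_adm.1 hk).1.1
    positivity
  · exact ⟨1, one_mem_adm hD⟩

noncomputable def lam (A : Finset ℕ) (D : ℕ) (d : ℕ) : ℝ :=
  (ArithmeticFunction.moebius d : ℝ) * d / GS A D *
    ∑ k ∈ (adm A D).filter (fun k => d ∣ k), (1 : ℝ) / (Nat.totient k)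

lemma lam_one {A : Finset ℕ} {D : ℕ} (hD : 1 ≤ D) : lam A D 1 = 1 := by
  have := GS_pos (A := A) hD
  simp only [lam, one_dvd, filter_true]
  change _ * GS A D = 1
  simp
  field_simp

lemma lam_abs_le {A : Finset ℕ} {D d : ℕ} (hD : 1 ≤ D) (hd : d ∈ adm A D) : |lam A D d| ≤ D := by
  have hG := GS_pos (A := A) hD
  have h1 : |(ArithmeticFunction.moebius d : ℝ)| ≤ 1 := by
    exact_mod_cast ArithmeticFunction.abs_moebius_le_one (n := d)
  have h2 : (d : ℝ) ≤ D := by exact_mod_cast (mem_adm.1 hd).1.2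
  have h3 : ∑ k ∈ (adm A D).filter (fun k => d ∣ k), (1 : ℝ) / (Nat.totient k) ≤ GS A D := by
    apply sum_le_sum_of_subset_of_nonneg (filter_subset _ _)
    intros; positivity
  have h4 : 0 ≤ ∑ k ∈ (adm A D).filter (fun k => d ∣ k), (1 : ℝ) / (Nat.totient k) := by positivity
  unfold lam
  rw [abs_mul, abs_div, abs_mul, abs_of_pos hG, abs_of_nonneg h4, Nat.abs_cast]
  calc _ ≤ 1 * (D:ℝ) / GS A D * GS A D := by gcongr
    _ = D := by field_simp

/-- y_k -/
lemma sum_lam_div {A : Finset ℕ} {D k : ℕ} (hk : k ∈ adm A D) :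
    ∑ d ∈ (adm A D).filter (fun d => k ∣ d), lam A D d / d
      = (ArithmeticFunction.moebius k : ℝ) / (GS A D * Nat.totient k) := by
  have hkp : 0 < k := (mem_adm.1 hk).1.1
  have e1 : ∀ d ∈ (adm A D).filter (fun d => k ∣ d), lam A D d / d =
      ∑ j ∈ adm A D, if k ∣ d ∧ d ∣ j then
        (ArithmeticFunction.moebius d : ℝ) / GS A D * (1 / (Nat.totient j)) else 0 := by
    intro d hd
    rw [mem_filter] at hd
    have hdp : (d:ℝ) ≠ 0 := by have := (mem_adm.1 hd.1).1.1; positivity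
    simp only [hd.2, true_and]
    rw [← sum_filter, ← mul_sum, lam]
    field_simp
  rw [sum_congr rfl e1, sum_comm]
  have e2 : ∀ j ∈ adm A D, (∑ d ∈ (adm A D).filter (fun d => k ∣ d), if k ∣ d ∧ d ∣ j then
        (ArithmeticFunction.moebius d : ℝ) / GS A D * (1 / (Nat.totient j)) else 0)
      = if j = k then (ArithmeticFunction.moebius k : ℝ) / (GS A D * Nat.totient k) else 0 := by
    intro j hj
    have hjp : 0 < j := (mem_adm.1 hj).1.1
    have hjs : Squarefree j := (mem_adm.1 hj).2.1
    rw [← sum_filter, filter_filter]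
    by_cases hkj : k ∣ j
    · obtain ⟨t, rfl⟩ := hkj
      have ht : 0 < t := Nat.pos_of_mul_pos_left hjp |> fun h => by
        rcases Nat.eq_zero_or_pos t with h | h
        · simp [h] at hjp
        · exact h
      have hset : (adm A D).filter (fun d => k ∣ d ∧ k ∣ d ∧ d ∣ k * t) =
          (t.divisors).image (fun s => k * s) := by
        ext d
        simp only [mem_filter, mem_image, Nat.mem_divisors]
        constructor
        · rintro ⟨_, ⟨s, rfl⟩, _, h⟩
          exact ⟨s, ⟨Nat.dvd_of_mul_dvd_mul_left hkp h, ht.ne'⟩, rfl⟩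
        · rintro ⟨s, ⟨h, _⟩, rfl⟩
          exact ⟨adm_dvd hj (Nat.mul_dvd_mul_left k h), ⟨s, rfl⟩, ⟨s, rfl⟩, Nat.mul_dvd_mul_left k h⟩
      rw [hset, sum_image (by intro a _ b _ h; exact Nat.eq_of_mul_eq_mul_left hkp h)]
      have hcop : ∀ s ∈ t.divisors, (ArithmeticFunction.moebius (k * s) : ℝ) =
          ArithmeticFunction.moebius k * ArithmeticFunction.moebius s := by
        intro s hs
        have hc : Nat.Coprime k s := by
          have := Nat.coprime_of_squarefree_mul hjs
          exact this.coprime_dvd_right (Nat.dvd_of_mem_divisors hs)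
        rw [ArithmeticFunction.isMultiplicative_moebius.map_mul_of_coprime hc]
        push_cast; ring
      rw [← sum_mul, ← sum_div, sum_congr rfl hcop, ← mul_sum]
      have hmu : (∑ s ∈ t.divisors, (ArithmeticFunction.moebius s : ℝ)) = if t = 1 then 1 else 0 := by
        have h := congrArg (fun f => f t) (ArithmeticFunction.coe_moebius_mul_coe_zeta (R := ℝ))
        simp only [ArithmeticFunction.coe_mul_zeta_apply, ArithmeticFunction.one_apply] at h
        simpa using h
      rw [hmu]
      by_cases h1 : t = 1
      · subst h1; simp; ring
      · have : k * t ≠ k := by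
          intro h; apply h1
          exact Nat.eq_of_mul_eq_mul_left hkp (by simpa using h)
        simp [h1, this]
    · have : j ≠ k := by rintro rfl; exact hkj dvd_rfl
      rw [if_neg this]
      apply sum_eq_zero
      intro d hd
      rw [mem_filter] at hd
      exact absurd (hd.2.1.trans hd.2.2.2) hkj
  rw [sum_congr rfl e2, sum_ite_eq' ]
  simp [hk]

/-- main quadratic form -/
lemma quad_form {A : Finset ℕ} {D : ℕ} (hD : 1 ≤ D) :
    ∑ d ∈ adm A D, ∑ e ∈ adm A D, lam A D d * lam A D e / (Nat.lcm d e) = 1 / GS A D := by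
  have hG := GS_pos (A := A) hD
  have e1 : ∀ d ∈ adm A D, ∀ e ∈ adm A D, lam A D d * lam A D e / (Nat.lcm d e) =
      ∑ k ∈ adm A D, (Nat.totient k : ℝ) * ((if k ∣ d then lam A D d / d else 0) *
        (if k ∣ e then lam A D e / e else 0)) := by
    intro d hd e he
    have hdp : 0 < d := (mem_adm.1 hd).1.1
    have hep : 0 < e := (mem_adm.1 he).1.1
    have h1 : ((Nat.gcd d e : ℕ) : ℝ) = ∑ k ∈ adm A D, if k ∣ d ∧ k ∣ e then (Nat.totient k : ℝ) else 0 := by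
      rw [← sum_filter]
      conv_lhs => rw [← Nat.sum_totient (Nat.gcd d e)]
      push_cast
      apply sum_congr _ (fun _ _ => rfl)
      ext k
      simp only [Nat.mem_divisors, mem_filter, Nat.dvd_gcd_iff]
      constructor
      · rintro ⟨⟨h, h'⟩, _⟩
        exact ⟨adm_dvd hd h, h, h'⟩
      · rintro ⟨_, h⟩
        exact ⟨h, (Nat.gcd_pos_of_pos_left _ hdp).ne'⟩
    have h2 : (Nat.gcd d e : ℝ) * Nat.lcm d e = d * e := by
      exact_mod_cast Nat.gcd_mul_lcm d e
    have h3 : (Nat.lcm d e : ℝ) ≠ 0 := by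
      have := Nat.lcm_pos hdp hep; positivity
    have h4 : lam A D d * lam A D e / (Nat.lcm d e) = (Nat.gcd d e : ℝ) * ((lam A D d / d) * (lam A D e / e)) := by
      field_simp
      linear_combination (-(lam A D d * lam A D e)) * h2
    rw [h4, h1, sum_mul]
    apply sum_congr rfl
    intro k _
    by_cases hkd : k ∣ d <;> by_cases hke : k ∣ e <;> simp [hkd, hke]
  rw [sum_congr rfl (fun d hd => sum_congr rfl (e1 d hd))]
  have e2 : ∀ d ∈ adm A D, (∑ e ∈ adm A D, ∑ k ∈ adm A D, (Nat.totient k : ℝ) * ((if k ∣ d then lam A D d / d else 0) *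
        (if k ∣ e then lam A D e / e else 0))) = ∑ k ∈ adm A D, ∑ e ∈ adm A D, (Nat.totient k : ℝ) * ((if k ∣ d then lam A D d / d else 0) *
        (if k ∣ e then lam A D e / e else 0)) := fun d _ => sum_comm
  rw [sum_congr rfl e2, sum_comm]
  have e3 : ∀ k ∈ adm A D, (∑ d ∈ adm A D, ∑ e ∈ adm A D, (Nat.totient k : ℝ) * ((if k ∣ d then lam A D d / d else 0) *
        (if k ∣ e then lam A D e / e else 0))) = 1 / (GS A D)^2 * (1 / (Nat.totient k)) := by
    intro k hk
    have hkp : (0:ℝ) < Nat.totient k := by exact_mod_cast Nat.totient_pos.2 (mem_adm.1 hk).1.1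
    simp_rw [← mul_sum, ← sum_mul]
    rw [← sum_filter, sum_lam_div hk]
    have : ((ArithmeticFunction.moebius k : ℝ))^2 = 1 := by
      exact_mod_cast ArithmeticFunction.moebius_sq_eq_one_of_squarefree (mem_adm.1 hk).2.1
    field_simp
    exact this
  rw [sum_congr rfl e3, ← mul_sum]
  change _ * GS A D = _
  field_simp

noncomputable def WS (A : Finset ℕ) (D : ℕ) (n : ℕ) : ℝ :=
  (∑ d ∈ (adm A D).filter (fun d => d ∣ n), lam A D d)^2

lemma WS_nonneg (A : Finset ℕ) (D n : ℕ) : 0 ≤ WS A D n := sq_nonneg _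

lemma WS_eq_one {A : Finset ℕ} {D n : ℕ} (hD : 1 ≤ D) (hA : ∀ p ∈ A, ¬ p ∣ n) : WS A D n = 1 := by
  have : (adm A D).filter (fun d => d ∣ n) = {1} := by
    ext d
    simp only [mem_filter, mem_singleton]
    constructor
    · rintro ⟨h1, h2⟩
      by_contra hne
      obtain ⟨p, hp, hpd⟩ := Nat.exists_prime_and_dvd hne
      have : p ∈ d.primeFactors := Nat.mem_primeFactors.2 ⟨hp, hpd, by have := (mem_adm.1 h1).1.1; omega⟩
      exact hA p ((mem_adm.1 h1).2.2 this) (hpd.trans h2)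
    · rintro rfl; exact ⟨one_mem_adm hD, one_dvd _⟩
  rw [WS, this, sum_singleton, lam_one hD, one_pow]

lemma sum_WS_mul {A : Finset ℕ} {D : ℕ} (I : Finset ℕ) (f : ℕ → ℂ) :
    ∑ n ∈ I, (WS A D n : ℂ) * f n = ∑ d ∈ adm A D, ∑ e ∈ adm A D, ((lam A D d * lam A D e : ℝ) : ℂ) *
      ∑ n ∈ I.filter (fun n => Nat.lcm d e ∣ n), f n := by
  have e1 : ∀ n ∈ I, (WS A D n : ℂ) * f n = ∑ d ∈ adm A D, ∑ e ∈ adm A D, ((lam A D d * lam A D e : ℝ) : ℂ) *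
      (if Nat.lcm d e ∣ n then f n else 0) := by
    intro n _
    rw [WS, sq, sum_mul_sum, sum_filter]
    push_cast
    rw [sum_mul]
    apply sum_congr rfl
    intro d _
    by_cases hd : d ∣ n
    · simp only [hd, if_true]
      rw [sum_filter]
      push_cast
      rw [sum_mul]
      apply sum_congr rfl
      intro e _
      by_cases he : e ∣ n
      · simp [he, Nat.lcm_dvd hd he]
      · have : ¬ Nat.lcm d e ∣ n := fun h => he ((Nat.dvd_lcm_right d e).trans h)
        simp [he, this]
    · simp only [hd, if_false, Complex.ofReal_zero, zero_mul]
      symm; apply sum_eq_zero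
      intro e _
      have : ¬ Nat.lcm d e ∣ n := fun h => hd ((Nat.dvd_lcm_left d e).trans h)
      simp [this]
  rw [sum_congr rfl e1, sum_comm]
  apply sum_congr rfl
  intro d _
  rw [sum_comm]
  apply sum_congr rfl
  intro e _
  rw [← mul_sum, sum_filter]

lemma lcm_props {A : Finset ℕ} {D d e : ℕ} (hd : d ∈ adm A D) (he : e ∈ adm A D) :
    0 < Nat.lcm d e ∧ Nat.lcm d e ≤ D^2 ∧ Squarefree (Nat.lcm d e) ∧ (Nat.lcm d e).primeFactors ⊆ A := by
  rw [mem_adm] at hd he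
  refine ⟨Nat.lcm_pos hd.1.1 he.1.1, ?_, ?_, ?_⟩
  · calc Nat.lcm d e ≤ d * e := Nat.le_of_dvd (Nat.mul_pos hd.1.1 he.1.1) (Nat.lcm_dvd_mul d e)
      _ ≤ D * D := Nat.mul_le_mul hd.1.2 he.1.2
      _ = D^2 := by ring
  · have hd0 : d ≠ 0 := by omega
    have he0 : e ≠ 0 := by omega
    rw [Nat.squarefree_iff_factorization_le_one (Nat.lcm_ne_zero hd0 he0)]
    intro p
    rw [Nat.factorization_lcm hd0 he0]
    exact sup_le ((Nat.squarefree_iff_factorization_le_one hd0).1 hd.2.1 p)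
      ((Nat.squarefree_iff_factorization_le_one he0).1 he.2.1 p)
  · intro p hp
    rw [Nat.mem_primeFactors] at hp
    rcases (hp.1.dvd_mul).1 (hp.2.1.trans (Nat.lcm_dvd_mul d e)) with h | h
    · exact hd.2.2 (Nat.mem_primeFactors.2 ⟨hp.1, h, by omega⟩)
    · exact he.2.2 (Nat.mem_primeFactors.2 ⟨hp.1, h, by omega⟩)

lemma card_adm_le (A : Finset ℕ) (D : ℕ) : (adm A D).card ≤ D := by
  calc _ ≤ (Icc 1 D).card := card_filter_le _ _
    _ = D := by simp

lemma sum_lam_abs_le {A : Finset ℕ} {D : ℕ} (hD : 1 ≤ D) :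
    ∑ d ∈ adm A D, ∑ e ∈ adm A D, |lam A D d * lam A D e| ≤ (D:ℝ)^4 := by
  have h : ∑ d ∈ adm A D, |lam A D d| ≤ (D:ℝ)^2 := by
    calc _ ≤ ∑ d ∈ adm A D, (D:ℝ) := sum_le_sum fun d hd => lam_abs_le hD hd
      _ = (adm A D).card * (D:ℝ) := by simp
      _ ≤ D * D := by gcongr; exact_mod_cast card_adm_le A D
      _ = _ := by ring
  simp_rw [abs_mul]
  rw [← sum_mul_sum]
  calc _ ≤ (D:ℝ)^2 * (D:ℝ)^2 := by gcongr
    _ = _ := by ring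

lemma sum_WS_le {A : Finset ℕ} {D : ℕ} (hD : 1 ≤ D) (I : Finset ℕ) (X : ℝ)
    (h : ∀ d, 0 < d → d.primeFactors ⊆ A →
      |((I.filter (fun n => d ∣ n)).card : ℝ) - X / d| ≤ 1) :
    ∑ n ∈ I, WS A D n ≤ X / GS A D + (D:ℝ)^4 := by
  have h1 := sum_WS_mul (A := A) (D := D) I (fun _ => 1)
  have h2 : ∑ n ∈ I, WS A D n = ∑ d ∈ adm A D, ∑ e ∈ adm A D, (lam A D d * lam A D e) *
      ((I.filter (fun n => Nat.lcm d e ∣ n)).card : ℝ) := by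
    have : ((∑ n ∈ I, WS A D n : ℝ) : ℂ) = ((∑ d ∈ adm A D, ∑ e ∈ adm A D, (lam A D d * lam A D e) *
      ((I.filter (fun n => Nat.lcm d e ∣ n)).card : ℝ) : ℝ) : ℂ) := by
      push_cast
      simpa using h1
    exact_mod_cast this
  have h3 : X / GS A D = ∑ d ∈ adm A D, ∑ e ∈ adm A D, (lam A D d * lam A D e) * (X / Nat.lcm d e) := by
    rw [← mul_one_div, ← quad_form hD, mul_sum]
    refine sum_congr rfl fun d _ => ?_
    rw [mul_sum]
    refine sum_congr rfl fun e _ => ?_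
    ring
  rw [h2, h3, ← sub_le_iff_le_add', ← sum_sub_distrib]
  refine le_trans (sum_le_sum fun d hd => ?_) (sum_lam_abs_le (A := A) hD)
  rw [← sum_sub_distrib]
  refine sum_le_sum fun e he => ?_
  obtain ⟨p1, p2, p3, p4⟩ := lcm_props hd he
  rw [← mul_sub]
  refine (le_abs_self _).trans ?_
  rw [abs_mul]
  calc _ ≤ |lam A D d * lam A D e| * 1 := by gcongr; exact h _ p1 p4
    _ = _ := by ring

lemma card_le_sum_WS {A : Finset ℕ} {D : ℕ} (hD : 1 ≤ D) (I J : Finset ℕ) (hJ : J ⊆ I)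
    (hA : ∀ n ∈ J, ∀ p ∈ A, ¬ p ∣ n) : (J.card : ℝ) ≤ ∑ n ∈ I, WS A D n := by
  calc (J.card : ℝ) = ∑ n ∈ J, WS A D n := by
        rw [sum_congr rfl (fun n hn => WS_eq_one hD (hA n hn))]; simp
    _ ≤ _ := sum_le_sum_of_subset_of_nonneg hJ (fun n _ _ => WS_nonneg _ _ _)

end BP

namespace BP
open Finset

noncomputable def vp (A : Finset ℕ) : ℝ := ∏ p ∈ A, (1 - (p:ℝ)⁻¹)

lemma one_sub_inv_pos {p : ℕ} (hp : p.Prime) : (0:ℝ) < 1 - (p:ℝ)⁻¹ := by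
  have : (1:ℝ) < p := by exact_mod_cast hp.one_lt
  have := inv_lt_one_of_one_lt₀ this
  linarith

lemma vp_pos {A : Finset ℕ} (hA : ∀ p ∈ A, p.Prime) : 0 < vp A :=
  prod_pos fun p hp => one_sub_inv_pos (hA p hp)

lemma vp_le_one {A : Finset ℕ} (hA : ∀ p ∈ A, p.Prime) : vp A ≤ 1 := by
  refine prod_le_one (fun p hp => (one_sub_inv_pos (hA p hp)).le) (fun p _ => ?_)
  have : (0:ℝ) ≤ (p:ℝ)⁻¹ := by positivity
  linarith

lemma totient_eq (q : ℕ) : (Nat.totient q : ℝ) = q * vp q.primeFactors := by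
  have := Nat.totient_eq_mul_prod_factors q
  have h2 : ((Nat.totient q : ℚ) : ℝ) = ((q * ∏ p ∈ q.primeFactors, (1 - (p:ℚ)⁻¹) : ℚ) : ℝ) := by rw [this]
  push_cast at h2
  exact h2

lemma smooth_sum_le (T : Finset ℕ) (hT : ∀ p ∈ T, p.Prime) (I : Finset ℕ)
    (hI : ∀ n ∈ I, n ≠ 0 ∧ n.primeFactors ⊆ T) : ∑ n ∈ I, (1:ℝ) / n ≤ (vp T)⁻¹ := by
  let f : ℕ →* ℝ :=
    { toFun := fun n => (n:ℝ)⁻¹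
      map_one' := by simp
      map_mul' := by intro a b; push_cast; rw [mul_inv] }
  have h := (EulerProduct.summable_and_hasSum_factoredNumbers_prod_filter_prime_geometric (f := f)
    (by intro p hp
        change ‖(p:ℝ)⁻¹‖ < 1
        rw [Real.norm_of_nonneg (by positivity)]
        linarith [one_sub_inv_pos hp]) T).2
  have hTT : T.filter (fun p => p.Prime) = T := filter_true_of_mem hT
  rw [hTT] at h
  have hv : (vp T)⁻¹ = ∏ p ∈ T, (1 - f p)⁻¹ := by rw [vp, ← prod_inv_distrib]; rfl
  rw [hv]
  let J : Finset (Nat.factoredNumbers T) := I.subtype (fun n => n ∈ Nat.factoredNumbers T)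
  have h2 := sum_le_hasSum J (fun i _ => by change (0:ℝ) ≤ ((i:ℕ):ℝ)⁻¹; positivity) h
  refine le_trans (le_of_eq ?_) h2
  have h3 : I.filter (fun n => n ∈ Nat.factoredNumbers T) = I := filter_true_of_mem
    (fun n hn => Nat.mem_factoredNumbers_iff_primeFactors_subset.2 (hI n hn))
  rw [sum_subtype_eq_sum_filter (f := fun n => f n), h3]
  refine sum_congr rfl fun n _ => ?_
  change _ = (n:ℝ)⁻¹
  simp

lemma log_le_sum_inv (D : ℕ) : Real.log D ≤ ∑ n ∈ Icc 1 D, (1:ℝ) / n := by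
  rcases Nat.eq_zero_or_pos D with h | h
  · subst h; simp
  have := log_add_one_le_harmonic D
  rw [harmonic_eq_sum_Icc] at this
  push_cast at this
  simp only [one_div]
  refine le_trans ?_ this
  apply Real.log_le_log (by positivity); push_cast; linarith

lemma vp_le_inv_log (z : ℕ) (hz : 2 ≤ z) : vp (Nat.primesBelow z) ≤ 2 / Real.log z := by
  have hp : ∀ p ∈ Nat.primesBelow z, p.Prime := fun p hp => Nat.prime_of_mem_primesBelow hp
  have h1 := smooth_sum_le (Nat.primesBelow z) hp (Icc 1 (z-1)) (by
    intro n hn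
    rw [mem_Icc] at hn
    refine ⟨by omega, fun p hp => ?_⟩
    rw [Nat.mem_primesBelow]
    have := Nat.le_of_mem_primeFactors hp
    exact ⟨by omega, Nat.prime_of_mem_primeFactors hp⟩)
  have h2 : Real.log z / 2 ≤ ∑ n ∈ Icc 1 (z-1), (1:ℝ) / n := by
    obtain ⟨w, rfl⟩ : ∃ w, z = w + 1 := ⟨z-1, by omega⟩
    have := log_add_one_le_harmonic w
    rw [harmonic_eq_sum_Icc] at this
    push_cast at this
    have h0 : 0 ≤ Real.log ((w+1:ℕ):ℝ) := Real.log_natCast_nonneg _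
    push_cast at h0 ⊢
    simp only [one_div, Nat.add_sub_cancel]
    linarith
  have hl : 0 < Real.log z := Real.log_pos (by exact_mod_cast hz)
  have hv := vp_pos hp
  have h3 := h2.trans h1
  rw [le_inv_comm₀ (by positivity) hv] at h3
  simpa using h3

/-- primes up to D not dividing q -/
def prq (q D : ℕ) : Finset ℕ := (Nat.primesBelow (D+1)).filter (fun p => ¬ p ∣ q)

lemma prq_prime {q D p : ℕ} (h : p ∈ prq q D) : p.Prime :=
  Nat.prime_of_mem_primesBelow (mem_filter.1 h).1

lemma GS_prq_ge (q D : ℕ) (hq : 0 < q) :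
    (Nat.totient q : ℝ) / q * Real.log D ≤ GS (prq q D) D := by
  have hφ : (0:ℝ) < Nat.totient q := by exact_mod_cast Nat.totient_pos.2 hq
  have hqr : (0:ℝ) < q := by exact_mod_cast hq
  have hφv := totient_eq q
  have hvq : 0 < vp q.primeFactors := vp_pos fun p hp => Nat.prime_of_mem_primeFactors hp
  suffices h : ∑ n ∈ Icc 1 D, (1:ℝ) / n ≤ (vp q.primeFactors)⁻¹ * GS (prq q D) D by
    have h2 := (log_le_sum_inv D).trans h
    rw [hφv]
    calc (q:ℝ) * vp q.primeFactors / q * Real.log D = vp q.primeFactors * Real.log D := by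
          field_simp
      _ ≤ vp q.primeFactors * ((vp q.primeFactors)⁻¹ * GS (prq q D) D) :=
          mul_le_mul_of_nonneg_left h2 hvq.le
      _ = _ := by rw [← mul_assoc, mul_inv_cancel₀ hvq.ne', one_mul]
  let g : ℕ → ℕ := fun n => ∏ p ∈ n.primeFactors \ q.primeFactors, p
  have hgpf : ∀ n, n ≠ 0 → (g n).primeFactors = n.primeFactors \ q.primeFactors := by
    intro n hn
    apply Nat.primeFactors_prod
    intro p hp
    exact Nat.prime_of_mem_primeFactors (Finset.mem_sdiff.1 hp).1
  have hgd : ∀ n, g n ∣ n := fun n =>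
    (prod_dvd_prod_of_subset _ _ _ sdiff_subset).trans (Nat.prod_primeFactors_dvd n)
  have hmaps : ∀ n ∈ Icc 1 D, g n ∈ adm (prq q D) D := by
    intro n hn
    rw [mem_Icc] at hn
    have hn0 : n ≠ 0 := by omega
    rw [mem_adm]
    refine ⟨⟨Nat.pos_of_dvd_of_pos (hgd n) hn.1, (Nat.le_of_dvd hn.1 (hgd n)).trans hn.2⟩, ?_, ?_⟩
    · apply Squarefree.squarefree_of_dvd (prod_dvd_prod_of_subset _ _ _ sdiff_subset) (y := ∏ p ∈ n.primeFactors, p)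
      rw [← Nat.radical_eq_prod_primeFactors]
      exact UniqueFactorizationMonoid.squarefree_radical
    · rw [hgpf n hn0]
      intro p hp
      rw [Finset.mem_sdiff] at hp
      have h1 := Nat.le_of_mem_primeFactors hp.1
      have h2 := Nat.prime_of_mem_primeFactors hp.1
      rw [prq, mem_filter, Nat.mem_primesBelow]
      refine ⟨⟨by omega, h2⟩, fun h => hp.2 (Nat.mem_primeFactors.2 ⟨h2, h, hq.ne'⟩)⟩
  rw [← sum_fiberwise_of_maps_to hmaps, GS, mul_sum]
  refine sum_le_sum fun k hk => ?_
  have hka := mem_adm.1 hk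
  have hkp : 0 < k := hka.1.1
  have hkr : (0:ℝ) < k := by exact_mod_cast hkp
  have hT : ∀ p ∈ k.primeFactors ∪ q.primeFactors, p.Prime := by
    intro p hp
    rcases mem_union.1 hp with h | h <;> exact Nat.prime_of_mem_primeFactors h
  have h1 := smooth_sum_le (k.primeFactors ∪ q.primeFactors) hT
    (((Icc 1 D).filter (fun n => g n = k)).image (fun n => n / k)) (by
      intro m hm
      rw [mem_image] at hm
      obtain ⟨n, hn, rfl⟩ := hm
      rw [mem_filter, mem_Icc] at hn
      have hn0 : n ≠ 0 := by omega
      have hkn : k ∣ n := hn.2 ▸ hgd n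
      refine ⟨(Nat.div_pos (Nat.le_of_dvd (by omega) hkn) hkp).ne', ?_⟩
      refine (Nat.primeFactors_mono (Nat.div_dvd_of_dvd hkn) hn0).trans ?_
      rw [← hn.2, hgpf n hn0]
      intro p hp
      simp [hp])
  have hinj : Set.InjOn (fun n => n / k) (((Icc 1 D).filter (fun n => g n = k) : Finset ℕ) : Set ℕ) := by
    intro a ha b hb hab
    simp only [coe_filter, Set.mem_setOf_eq] at ha hb
    have hka : k ∣ a := ha.2 ▸ hgd a
    have hkb : k ∣ b := hb.2 ▸ hgd b
    simp only at hab
    rw [← Nat.div_mul_cancel hka, ← Nat.div_mul_cancel hkb, hab]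
  rw [sum_image hinj] at h1
  have hdisj : Disjoint k.primeFactors q.primeFactors := by
    rw [disjoint_left]
    intro p hp hpq
    have := mem_filter.1 (hka.2.2 hp)
    exact this.2 (Nat.dvd_of_mem_primeFactors hpq)
  have hvk : 0 < vp k.primeFactors := vp_pos fun p hp => Nat.prime_of_mem_primeFactors hp
  have hvu : vp (k.primeFactors ∪ q.primeFactors) = vp k.primeFactors * vp q.primeFactors := by
    rw [vp, prod_union hdisj]; rfl
  rw [totient_eq k]
  calc ∑ n ∈ (Icc 1 D).filter (fun n => g n = k), (1:ℝ) / n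
      = ∑ n ∈ (Icc 1 D).filter (fun n => g n = k), (1/(k:ℝ)) * ((1:ℝ) / ((n / k : ℕ):ℝ)) := by
        refine sum_congr rfl fun n hn => ?_
        rw [mem_filter] at hn
        have hkn : k ∣ n := hn.2 ▸ hgd n
        rw [Nat.cast_div hkn hkr.ne']
        field_simp
    _ ≤ (1/(k:ℝ)) * (vp (k.primeFactors ∪ q.primeFactors))⁻¹ := by
        rw [← mul_sum]; gcongr
    _ = _ := by rw [hvu]; field_simp

lemma mertens_le (n : ℕ) (hn : 1 ≤ n) :
    ∑ p ∈ Nat.primesBelow (n+1), Real.log p / p ≤ Real.log n + Real.log 4 := by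
  have hnr : (0:ℝ) < n := by exact_mod_cast hn
  have h1 : ∑ m ∈ Icc 1 n, ∑ p ∈ Nat.primesBelow (n+1), (if p ∣ m then Real.log p else 0) ≤ n * Real.log n := by
    calc _ ≤ ∑ m ∈ Icc 1 n, Real.log n := by
          refine sum_le_sum fun m hm => ?_
          rw [mem_Icc] at hm
          have hm0 : m ≠ 0 := by omega
          rw [← sum_filter]
          have : (Nat.primesBelow (n+1)).filter (fun p => p ∣ m) = m.primeFactors := by
            ext p
            rw [mem_filter, Nat.mem_primesBelow, Nat.mem_primeFactors]
            constructor
            · rintro ⟨⟨_, a⟩, b⟩; exact ⟨a, b, hm0⟩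
            · rintro ⟨a, b, _⟩; exact ⟨⟨by have := Nat.le_of_dvd (by omega) b; omega, a⟩, b⟩
          rw [this, ← Real.log_prod (fun p hp => by
            have := (Nat.prime_of_mem_primeFactors hp).pos; positivity)]
          rw [← Nat.cast_prod]
          apply Real.log_le_log
          · exact_mod_cast prod_pos fun p hp => (Nat.prime_of_mem_primeFactors hp).pos
          · exact_mod_cast (Nat.le_of_dvd (by omega) (Nat.prod_primeFactors_dvd m)).trans hm.2
      _ = _ := by simp
  rw [sum_comm] at h1
  have h2 : ∑ p ∈ Nat.primesBelow (n+1), (Real.log p * (n / p) - Real.log p) ≤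
      ∑ p ∈ Nat.primesBelow (n+1), ∑ m ∈ Icc 1 n, (if p ∣ m then Real.log p else 0) := by
    refine sum_le_sum fun p hp => ?_
    have hpp := Nat.prime_of_mem_primesBelow hp
    have hl : 0 ≤ Real.log p := Real.log_natCast_nonneg _
    rw [← sum_filter, sum_const, nsmul_eq_mul]
    have hc : ((Icc 1 n).filter (fun m => p ∣ m)).card = n / p := by
      have := Nat.Ioc_filter_dvd_card_eq_div n p
      rw [← this]; rfl
    rw [hc]
    have : (n:ℝ)/p - 1 ≤ ((n/p:ℕ):ℝ) := by
      have := Nat.lt_floor_add_one ((n:ℝ)/p)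
      rw [Nat.floor_div_natCast, Nat.floor_natCast] at this
      linarith
    nlinarith
  have h3 : ∑ p ∈ Nat.primesBelow (n+1), Real.log p ≤ Real.log 4 * n := by
    have := Chebyshev.theta_le_log4_mul_x (x := (n:ℝ)) hnr.le
    rw [Chebyshev.theta_eq_sum_primesLE_log] at this
    exact this
  rw [sum_sub_distrib] at h2
  have h4 : ∑ p ∈ Nat.primesBelow (n+1), (Real.log p * (n / p)) = n * ∑ p ∈ Nat.primesBelow (n+1), Real.log p / p := by
    rw [mul_sum]; refine sum_congr rfl fun p _ => by ring
  rw [h4] at h2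
  have h5 : n * ∑ p ∈ Nat.primesBelow (n+1), Real.log p / p ≤ n * (Real.log n + Real.log 4) := by linarith
  exact le_of_mul_le_mul_left h5 hnr

lemma exp_neg_le {v : ℝ} (hv : 0 < v) : Real.exp (-v) ≤ 2 / v^2 := by
  have := Real.quadratic_le_exp_of_nonneg hv.le
  rw [Real.exp_neg, inv_le_comm₀ (Real.exp_pos _) (by positivity)]
  rw [inv_div]
  nlinarith

/-- Rankin -/
lemma GS_ge (A : Finset ℕ) (z D : ℕ) (hz : 2 ≤ z) (hD : 2 ≤ D) (hA : ∀ p ∈ A, p.Prime ∧ p < z) :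
    (vp A)⁻¹ * (1 - 2 * Real.exp 6 * (Real.log z / Real.log D)^2) ≤ GS A D := by
  have hpr : ∀ p ∈ A, p.Prime := fun p hp => (hA p hp).1
  have hv := vp_pos hpr
  have hlz : 0 < Real.log z := Real.log_pos (by exact_mod_cast hz)
  have hlD : 0 < Real.log D := Real.log_pos (by exact_mod_cast hD)
  have hDr : (0:ℝ) < D := by positivity
  set t : ℝ := 1 / Real.log z with ht
  have htp : 0 < t := by positivity
  have hfac : ∀ p ∈ A, (1:ℝ) < p := fun p hp => by exact_mod_cast (hpr p hp).one_lt
  have hvinv : (vp A)⁻¹ = ∑ s ∈ A.powerset, ∏ p ∈ s, (1:ℝ)/(p-1) := by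
    rw [← prod_one_add, vp, ← prod_inv_distrib]
    refine prod_congr rfl fun p hp => ?_
    have := hfac p hp
    have h2 : (p:ℝ) - 1 ≠ 0 := by linarith
    field_simp
    ring
  have hsplit : (vp A)⁻¹ ≤ GS A D + Real.exp (-(Real.log D/Real.log z)) * ∏ p ∈ A, (1 + (p:ℝ)^t/(p-1)) := by
    rw [hvinv, ← sum_filter_add_sum_filter_not A.powerset (fun s => ∏ p ∈ s, p ≤ D)]
    apply add_le_add
    · have hinj : Set.InjOn (fun s : Finset ℕ => ∏ p ∈ s, p)
          ((A.powerset.filter (fun s => ∏ p ∈ s, p ≤ D) : Finset (Finset ℕ)) : Set (Finset ℕ)) := by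
        intro s hs u hu hsu
        simp only [coe_filter, mem_powerset, Set.mem_setOf_eq] at hs hu hsu
        rw [← Nat.primeFactors_prod (fun p hp => hpr p (hs.1 hp)),
          ← Nat.primeFactors_prod (fun p hp => hpr p (hu.1 hp))]
        rw [hsu]
      calc _ = ∑ s ∈ A.powerset.filter (fun s => ∏ p ∈ s, p ≤ D), (1:ℝ) / (Nat.totient (∏ p ∈ s, p)) := by
            refine sum_congr rfl fun s hs => ?_
            rw [mem_filter, mem_powerset] at hs
            have hsp : ∀ p ∈ s, p.Prime := fun p hp => hpr p (hs.1 hp)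
            rw [totient_eq, Nat.primeFactors_prod hsp, vp]
            push_cast
            rw [← prod_mul_distrib, one_div, ← prod_inv_distrib]
            refine prod_congr rfl fun p hp => ?_
            have := hfac p (hs.1 hp)
            have h2 : (p:ℝ) - 1 ≠ 0 := by linarith
            rw [mul_sub, mul_inv_cancel₀ (by linarith)]
            simp
        _ = ∑ k ∈ (A.powerset.filter (fun s => ∏ p ∈ s, p ≤ D)).image (fun s : Finset ℕ => ∏ p ∈ s, p),
              (1:ℝ) / (Nat.totient k) := by rw [sum_image hinj]
        _ ≤ _ := by
            apply sum_le_sum_of_subset_of_nonneg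
            · intro k hk
              rw [mem_image] at hk
              obtain ⟨s, hs, rfl⟩ := hk
              rw [mem_filter, mem_powerset] at hs
              have hsp : ∀ p ∈ s, p.Prime := fun p hp => hpr p (hs.1 hp)
              rw [mem_adm]
              refine ⟨⟨prod_pos fun p hp => (hsp p hp).pos, hs.2⟩, ?_, ?_⟩
              · have := Nat.primeFactors_prod hsp
                have h3 : (∏ p ∈ s, p) = UniqueFactorizationMonoid.radical (∏ p ∈ s, p) := by
                  rw [Nat.radical_eq_prod_primeFactors, this]
                rw [h3]
                exact UniqueFactorizationMonoid.squarefree_radical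
              · rw [Nat.primeFactors_prod hsp]; exact hs.1
            · intros; positivity
    · rw [prod_one_add, mul_sum]
      refine le_trans (sum_le_sum (g := fun s : Finset ℕ => Real.exp (-(Real.log D/Real.log z)) * ∏ p ∈ s, (p:ℝ)^t/(p-1)) ?_) (sum_le_sum_of_subset_of_nonneg (filter_subset _ _) ?_ )
      rotate_left
      · intro s hs _
        rw [mem_powerset] at hs
        apply mul_nonneg (Real.exp_pos _).le
        apply prod_nonneg
        intro p hp
        have := hfac p (hs hp)
        have : 0 < (p:ℝ) - 1 := by linarith
        positivity
      · intro s hs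
        rw [mem_filter, mem_powerset, not_le] at hs
        have e1 : ∏ p ∈ s, (p:ℝ)^t/(p-1) = ((∏ p ∈ s, p : ℕ):ℝ)^t * ∏ p ∈ s, (1:ℝ)/(p-1) := by
          push_cast
          rw [← Real.finsetProd_rpow _ _ (fun p _ => by positivity), ← prod_mul_distrib]
          refine prod_congr rfl fun p _ => by ring
        rw [e1, ← mul_assoc]
        have e2 : 0 ≤ ∏ p ∈ s, (1:ℝ)/(p-1) := by
          apply prod_nonneg
          intro p hp
          have := hfac p (hs.1 hp)
          have : 0 < (p:ℝ) - 1 := by linarith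
          positivity
        have e3 : 1 ≤ Real.exp (-(Real.log D/Real.log z)) * ((∏ p ∈ s, p : ℕ):ℝ)^t := by
          have : Real.exp (Real.log D/Real.log z) = (D:ℝ)^t := by
            rw [Real.rpow_def_of_pos hDr, ht]; congr 1; ring
          rw [Real.exp_neg, this, inv_mul_eq_div, one_le_div (by positivity)]
          apply Real.rpow_le_rpow hDr.le _ htp.le
          exact_mod_cast hs.2.le
        exact le_mul_of_one_le_left e2 e3
  have hprod : ∏ p ∈ A, (1 + (p:ℝ)^t/(p-1)) ≤ (vp A)⁻¹ * Real.exp 6 := by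
    have e1 : ∏ p ∈ A, (1 + (p:ℝ)^t/(p-1)) = (vp A)⁻¹ * ∏ p ∈ A, (1 + ((p:ℝ)^t - 1)/p) := by
      rw [vp, ← prod_inv_distrib, ← prod_mul_distrib]
      refine prod_congr rfl fun p hp => ?_
      have := hfac p hp
      have h2 : (p:ℝ) - 1 ≠ 0 := by linarith
      field_simp
      ring
    rw [e1]
    gcongr
    have e2 : ∀ p ∈ A, 1 + ((p:ℝ)^t - 1)/p ≤ Real.exp (2 * t * (Real.log p / p)) := by
      intro p hp
      have h1 := hfac p hp
      have hlp : 0 < Real.log p := Real.log_pos h1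
      have hlt : Real.log p * t ≤ 1 := by
        rw [ht, mul_one_div, div_le_one hlz]
        exact Real.log_le_log (by linarith) (by exact_mod_cast (hA p hp).2.le)
      have h3 : (p:ℝ)^t - 1 ≤ 2 * (t * Real.log p) := by
        rw [Real.rpow_def_of_pos (by linarith)]
        have := Real.abs_exp_sub_one_le (x := Real.log p * t) (by rw [abs_of_pos (by positivity)]; exact hlt)
        rw [abs_of_pos (a := Real.log p * t) (by positivity)] at this
        have := (le_abs_self _).trans this
        linarith
      have h4 : ((p:ℝ)^t - 1)/p ≤ 2 * t * (Real.log p / p) := by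
        calc _ ≤ 2 * (t * Real.log p) / p := by gcongr
          _ = _ := by ring
      have := Real.add_one_le_exp (2 * t * (Real.log p / p))
      linarith
    have e3 : ∀ p ∈ A, 0 ≤ 1 + ((p:ℝ)^t - 1)/p := by
      intro p hp
      have h1 := hfac p hp
      have : 1 ≤ (p:ℝ)^t := Real.one_le_rpow h1.le htp.le
      have : 0 ≤ ((p:ℝ)^t - 1)/p := by apply div_nonneg <;> linarith
      linarith
    refine (prod_le_prod e3 e2).trans ?_
    rw [← Real.exp_sum, ← mul_sum]
    apply Real.exp_le_exp.2
    have e4 : ∑ p ∈ A, Real.log p / p ≤ Real.log z + Real.log 4 := by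
      refine le_trans ?_ (mertens_le z (by omega))
      apply sum_le_sum_of_subset_of_nonneg
      · intro p hp
        rw [Nat.mem_primesBelow]
        have := hA p hp
        exact ⟨by omega, this.1⟩
      · intro p _ _
        have := Real.log_natCast_nonneg p
        positivity
    have e5 : Real.log 4 ≤ 2 * Real.log z := by
      have : Real.log 4 = 2 * Real.log 2 := by
        rw [show (4:ℝ) = 2^2 by norm_num, Real.log_pow]; norm_num
      rw [this]
      have : Real.log 2 ≤ Real.log z := Real.log_le_log (by norm_num) (by exact_mod_cast hz)
      linarith
    calc 2 * t * ∑ p ∈ A, Real.log p / p ≤ 2 * t * (3 * Real.log z) := by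
          gcongr; linarith
      _ = 6 := by rw [ht]; field_simp; norm_num
  have hexp := exp_neg_le (v := Real.log D / Real.log z) (by positivity)
  have h2 : Real.exp (-(Real.log D/Real.log z)) * ∏ p ∈ A, (1 + (p:ℝ)^t/(p-1)) ≤
      2 / (Real.log D / Real.log z)^2 * ((vp A)⁻¹ * Real.exp 6) := by
    gcongr
    apply prod_nonneg
    intro p hp
    have := hfac p hp
    have : 0 < (p:ℝ) - 1 := by linarith
    positivity
  have h3 : 2 / (Real.log D / Real.log z)^2 * ((vp A)⁻¹ * Real.exp 6) =
    (vp A)⁻¹ * (2 * Real.exp 6 * (Real.log z / Real.log D)^2) := by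
    field_simp
  rw [mul_sub, mul_one, ← h3]
  linarith

end BP

namespace BP
open Finset

lemma ap_count (a b q c d : ℕ) (hab : a ≤ b) (hq : 0 < q) (hd : 0 < d) (hc : Nat.Coprime d q) :
    |(((((Ioc a b).filter (fun n => n ≡ c [MOD q])).filter (fun n => d ∣ n)).card : ℕ) : ℝ)
      - ((b:ℝ) - a) / q / d| ≤ 1 := by
  obtain ⟨v, hv1, hv2⟩ := Nat.chineseRemainder hc 0 c
  have e : ((Ioc a b).filter (fun n => n ≡ c [MOD q])).filter (fun n => d ∣ n)
      = (Ioc a b).filter (fun n => n ≡ v [MOD (d*q)]) := by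
    ext n
    simp only [mem_filter]
    rw [← Nat.modEq_and_modEq_iff_modEq_mul hc, ← Nat.modEq_zero_iff_dvd]
    constructor
    · rintro ⟨⟨h1, h2⟩, h3⟩
      exact ⟨h1, h3.trans hv1.symm, h2.trans hv2.symm⟩
    · rintro ⟨h1, h2, h3⟩
      exact ⟨⟨h1, h3.trans hv2⟩, h2.trans hv1⟩
  have hr : 0 < d * q := by positivity
  rw [e]
  have h := Nat.Ioc_filter_modEq_card a b hr v
  have hr' : (0:ℝ) < d * q := by exact_mod_cast hr
  set x : ℚ := ((b:ℚ) - v) / ((d * q : ℕ):ℚ) with hx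
  set y : ℚ := ((a:ℚ) - v) / ((d * q : ℕ):ℚ) with hy
  have hxy : y ≤ x := by
    rw [hx, hy]; gcongr
  have hfl : ⌊y⌋ ≤ ⌊x⌋ := Int.floor_mono hxy
  rw [max_eq_left (by omega)] at h
  have h' : ((((Ioc a b).filter (fun n => n ≡ v [MOD (d*q)])).card : ℕ) : ℚ) = (⌊x⌋:ℚ) - ⌊y⌋ := by
    exact_mod_cast h
  have h2 : |((((Ioc a b).filter (fun n => n ≡ v [MOD (d*q)])).card : ℕ) : ℚ) - (x - y)| ≤ 1 := by
    rw [h', abs_le]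
    have := Int.floor_le x
    have := Int.floor_le y
    have := Int.lt_floor_add_one x
    have := Int.lt_floor_add_one y
    constructor <;> linarith
  have h3 : ((b:ℚ) - a)/q/d = x - y := by
    rw [hx, hy]; push_cast
    have : (q:ℚ) ≠ 0 := by positivity
    have : (d:ℚ) ≠ 0 := by positivity
    field_simp; ring
  rw [← h3] at h2
  have h4 : ((|((((Ioc a b).filter (fun n => n ≡ v [MOD (d*q)])).card : ℕ) : ℚ) - ((b:ℚ) - a)/q/d| : ℚ) : ℝ) ≤ ((1:ℚ):ℝ) :=
    Rat.cast_le.2 h2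
  push_cast at h4
  exact h4

lemma sieve_sum_ap (A : Finset ℕ) (D a b q c : ℕ) (hD : 1 ≤ D) (hab : a ≤ b) (hq : 0 < q)
    (hA : ∀ p ∈ A, ¬ p ∣ q) :
    ∑ n ∈ (Ioc a b).filter (fun n => n ≡ c [MOD q]), WS A D n ≤ ((b:ℝ)-a)/q / GS A D + (D:ℝ)^4 := by
  apply sum_WS_le hD
  intro d hd hdA
  apply ap_count a b q c d hab hq hd
  rw [Nat.coprime_iff_gcd_eq_one]
  by_contra hne
  obtain ⟨p, hp, hpd⟩ := Nat.exists_prime_and_dvd hne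
  have h1 := hpd.trans (Nat.gcd_dvd_left d q)
  have h2 := hpd.trans (Nat.gcd_dvd_right d q)
  exact hA p (hdA (Nat.mem_primeFactors.2 ⟨hp, h1, hd.ne'⟩)) h2

lemma sieve_sum (A : Finset ℕ) (D a b : ℕ) (hD : 1 ≤ D) (hab : a ≤ b) (hA : ∀ p ∈ A, p.Prime) :
    ∑ n ∈ Ioc a b, WS A D n ≤ ((b:ℝ)-a) / GS A D + (D:ℝ)^4 := by
  have := sieve_sum_ap A D a b 1 0 hD hab one_pos (fun p hp h => (hA p hp).one_lt.ne' (Nat.dvd_one.1 h))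
  simpa [Nat.modEq_one] using this

/-- no prime factor below z -/
def rough (z n : ℕ) : Prop := ∀ p ∈ Nat.primesBelow z, ¬ p ∣ n

instance (z n : ℕ) : Decidable (rough z n) := by unfold rough; infer_instance

lemma mem_primesBelow' {z p : ℕ} : p ∈ Nat.primesBelow z ↔ p.Prime ∧ p < z := by
  rw [Nat.mem_primesBelow]; tauto

lemma rough_mono {y z n : ℕ} (h : y ≤ z) (hz : rough z n) : rough y n := fun p hp =>
  hz p (mem_primesBelow'.2 ⟨(mem_primesBelow'.1 hp).1, (mem_primesBelow'.1 hp).2.trans_le h⟩)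

lemma inv_GS_le (A : Finset ℕ) (z D : ℕ) (hz : 2 ≤ z) (hD : 2 ≤ D) (hA : ∀ p ∈ A, p.Prime ∧ p < z)
    (hδ : 2 * Real.exp 6 * (Real.log z / Real.log D)^2 ≤ 1/2) :
    (GS A D)⁻¹ ≤ vp A * (1 + 2 * (2 * Real.exp 6 * (Real.log z / Real.log D)^2)) := by
  have h := GS_ge A z D hz hD hA
  have hv := vp_pos (A := A) fun p hp => (hA p hp).1
  set δ := 2 * Real.exp 6 * (Real.log z / Real.log D)^2 with hδd
  have hδ0 : 0 ≤ δ := by positivity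
  have h1 : 0 < (vp A)⁻¹ * (1 - δ) := by
    have : 0 < 1 - δ := by linarith
    positivity
  calc (GS A D)⁻¹ ≤ ((vp A)⁻¹ * (1 - δ))⁻¹ := inv_anti₀ h1 h
    _ = vp A * (1-δ)⁻¹ := by rw [mul_inv, inv_inv]
    _ ≤ _ := by
      apply mul_le_mul_of_nonneg_left _ hv.le
      rw [inv_le_iff_one_le_mul₀ (by linarith)]
      nlinarith

lemma vp_primesBelow_succ (z : ℕ) : vp (Nat.primesBelow z) - vp (Nat.primesBelow (z+1)) =
    if z.Prime then vp (Nat.primesBelow z) / z else 0 := by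
  rw [Nat.primesBelow_succ]
  split_ifs with h
  · rw [vp, vp, prod_insert (Nat.notMem_primesBelow z)]
    ring
  · simp

lemma vp_telescope (z : ℕ) : ∑ p ∈ Nat.primesBelow z, vp (Nat.primesBelow p) / p = 1 - vp (Nat.primesBelow z) := by
  have : ∑ p ∈ Nat.primesBelow z, vp (Nat.primesBelow p) / p =
      ∑ p ∈ range z, (vp (Nat.primesBelow p) - vp (Nat.primesBelow (p+1))) := by
    simp_rw [vp_primesBelow_succ]
    rw [← sum_filter]; rfl
  rw [this, sum_range_sub']
  simp [vp]

lemma rough_lower (z D N : ℕ) (hz : 2 ≤ z) (hD : 2 ≤ D)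
    (hδ : 2 * Real.exp 6 * (Real.log z / Real.log D)^2 ≤ 1/2) :
    N * vp (Nat.primesBelow z) - 48 * Real.exp 6 * N * Real.log z / (Real.log D)^2 - z * (D:ℝ)^4 ≤
      ((Ioc 0 N).filter (rough z)).card := by
  have hlz : 0 < Real.log z := Real.log_pos (by exact_mod_cast hz)
  have hlD : 0 < Real.log D := Real.log_pos (by exact_mod_cast hD)
  have hcov : Ioc 0 N ⊆ (Ioc 0 N).filter (rough z) ∪
      (Nat.primesBelow z).biUnion (fun p => ((Ioc 0 (N/p)).filter (rough p)).image (fun m => p * m)) := by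
    intro n hn
    rw [mem_union]
    by_cases hr : rough z n
    · left; exact mem_filter.2 ⟨hn, hr⟩
    · right
      rw [mem_Ioc] at hn
      rw [rough] at hr
      push Not at hr
      obtain ⟨p0, hp0, hpn⟩ := hr
      rw [mem_primesBelow'] at hp0
      have hn1 : n ≠ 1 := by
        rintro rfl
        exact hp0.1.one_lt.ne' (Nat.dvd_one.1 hpn)
      have hmp := Nat.minFac_prime hn1
      rw [mem_biUnion]
      refine ⟨n.minFac, mem_primesBelow'.2 ⟨hmp, (Nat.minFac_le_of_dvd hp0.1.two_le hpn).trans_lt hp0.2⟩, ?_⟩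
      rw [mem_image]
      refine ⟨n / n.minFac, ?_, Nat.mul_div_cancel' (Nat.minFac_dvd n)⟩
      rw [mem_filter, mem_Ioc]
      refine ⟨⟨Nat.div_pos (Nat.minFac_le hn.1) hmp.pos, Nat.div_le_div_right hn.2⟩, ?_⟩
      intro p hp hpd
      rw [mem_primesBelow'] at hp
      have := Nat.minFac_le_of_dvd hp.1.two_le (hpd.trans (Nat.div_dvd_of_dvd (Nat.minFac_dvd n)))
      omega
  have h1 := card_le_card hcov
  have h2 : (N:ℝ) ≤ ((Ioc 0 N).filter (rough z)).card +
      ∑ p ∈ Nat.primesBelow z, (((Ioc 0 (N/p)).filter (rough p)).card : ℝ) := by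
    have : N ≤ ((Ioc 0 N).filter (rough z)).card +
      ∑ p ∈ Nat.primesBelow z, ((Ioc 0 (N/p)).filter (rough p)).card := by
      calc N = (Ioc 0 N).card := by simp
        _ ≤ _ := h1
        _ ≤ _ := card_union_le _ _
        _ ≤ _ := by
          gcongr
          refine card_biUnion_le.trans (sum_le_sum fun p hp => card_image_le)
    exact_mod_cast this
  have h3 : ∀ p ∈ Nat.primesBelow z, (((Ioc 0 (N/p)).filter (rough p)).card : ℝ) ≤
      N * (vp (Nat.primesBelow p) / p) + 8 * Real.exp 6 * N / (Real.log D)^2 * (Real.log p / p) + (D:ℝ)^4 := by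
    intro p hp
    rw [mem_primesBelow'] at hp
    have hpp := hp.1
    have hp2 := hpp.two_le
    have hp0 : (0:ℝ) < p := by exact_mod_cast hpp.pos
    have hlp : 0 < Real.log p := Real.log_pos (by exact_mod_cast hpp.one_lt)
    have hlpz : Real.log p ≤ Real.log z := Real.log_le_log hp0 (by exact_mod_cast hp.2.le)
    have hA : ∀ p' ∈ Nat.primesBelow p, p'.Prime ∧ p' < p := fun p' h => mem_primesBelow'.1 h
    have hA1 : ∀ p' ∈ Nat.primesBelow p, p'.Prime := fun p' h => (hA p' h).1
    have hδp : 2 * Real.exp 6 * (Real.log p / Real.log D)^2 ≤ 1/2 := by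
      refine le_trans ?_ hδ
      gcongr
    have e1 := card_le_sum_WS (A := Nat.primesBelow p) (D := D) (by omega) (Ioc 0 (N/p)) ((Ioc 0 (N/p)).filter (rough p))
      (filter_subset _ _) (fun n hn => (mem_filter.1 hn).2)
    have e2 := sieve_sum (Nat.primesBelow p) D 0 (N/p) (by omega) (Nat.zero_le _) hA1
    have e3 := inv_GS_le _ p D hp2 hD hA hδp
    have hV := vp_le_inv_log p hp2
    have hv0 := vp_pos hA1
    have e4 : ((N/p:ℕ):ℝ) ≤ N/p := Nat.cast_div_le
    set V := vp (Nat.primesBelow p)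
    have e5 : (((N/p:ℕ):ℝ) - (0:ℕ)) / GS (Nat.primesBelow p) D ≤ N/p * (V * (1 + 2 * (2 * Real.exp 6 * (Real.log p / Real.log D)^2))) := by
      rw [div_eq_mul_inv]
      have : 0 < GS (Nat.primesBelow p) D := GS_pos (by omega)
      push_cast
      rw [sub_zero]
      gcongr
    have e6 : V * (Real.log p)^2 ≤ 2 * Real.log p := by
      have : V * Real.log p ≤ 2 := by rwa [le_div_iff₀ hlp] at hV
      nlinarith
    calc _ ≤ _ := e1.trans e2
      _ ≤ N/p * (V * (1 + 2 * (2 * Real.exp 6 * (Real.log p / Real.log D)^2))) + (D:ℝ)^4 := by gcongr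
      _ = N * (V/p) + 4 * Real.exp 6 * N / (Real.log D)^2 / p * (V * (Real.log p)^2) + (D:ℝ)^4 := by
        field_simp; ring
      _ ≤ N * (V/p) + 4 * Real.exp 6 * N / (Real.log D)^2 / p * (2 * Real.log p) + (D:ℝ)^4 := by gcongr
      _ = _ := by ring
  have h4 := sum_le_sum h3
  rw [sum_add_distrib, sum_add_distrib, ← mul_sum, ← mul_sum, vp_telescope, sum_const, nsmul_eq_mul] at h4
  have h5 : ∑ p ∈ Nat.primesBelow z, Real.log p / p ≤ 3 * Real.log z := by
    have := mertens_le z (by omega)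
    have h6 : ∑ p ∈ Nat.primesBelow z, Real.log p / p ≤ ∑ p ∈ Nat.primesBelow (z+1), Real.log p / p := by
      apply sum_le_sum_of_subset_of_nonneg
      · intro p hp
        rw [mem_primesBelow'] at *
        exact ⟨hp.1, by omega⟩
      · intro p _ _
        have : 0 ≤ Real.log p := Real.log_natCast_nonneg p
        positivity
    have h7 : Real.log 4 = 2 * Real.log 2 := by
      rw [show (4:ℝ) = 2^2 by norm_num, Real.log_pow]; norm_num
    have h8 : Real.log 2 ≤ Real.log z := Real.log_le_log (by norm_num) (by exact_mod_cast hz)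
    linarith
  have h9 : ((Nat.primesBelow z).card : ℝ) ≤ z := by
    have : (Nat.primesBelow z).card ≤ z := by
      have := card_filter_le (range z) Nat.Prime
      rwa [card_range] at this
    exact_mod_cast this
  have h10 : 8 * Real.exp 6 * N / (Real.log D)^2 * ∑ p ∈ Nat.primesBelow z, Real.log p / p ≤
     8 * Real.exp 6 * N / (Real.log D)^2 * (3 * Real.log z) := by gcongr
  have h11 : ((Nat.primesBelow z).card : ℝ) * (D:ℝ)^4 ≤ z * (D:ℝ)^4 := by gcongr
  have h12 : 8 * Real.exp 6 * N / (Real.log D)^2 * (3 * Real.log z) ≤ 48 * Real.exp 6 * N * Real.log z / (Real.log D)^2 := by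
    have : 0 ≤ Real.exp 6 * N * Real.log z / (Real.log D)^2 := by positivity
    have e : 8 * Real.exp 6 * N / (Real.log D)^2 * (3 * Real.log z) = 24 * (Real.exp 6 * N * Real.log z / (Real.log D)^2) := by ring
    rw [e]
    have e' : 48 * Real.exp 6 * N * Real.log z / (Real.log D)^2 = 48 * (Real.exp 6 * N * Real.log z / (Real.log D)^2) := by ring
    rw [e']; linarith
  linarith

lemma vp_erase_le (A : Finset ℕ) (hA : ∀ p ∈ A, p.Prime) (l : ℕ) (hl : 2 ≤ l) :
    vp (A.erase l) ≤ vp A * (1 + 2 / l) := by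
  have hl0 : (2:ℝ) ≤ l := by exact_mod_cast hl
  have hv := vp_pos hA
  by_cases h : l ∈ A
  · have e : vp A = (1 - (l:ℝ)⁻¹) * vp (A.erase l) := by
      rw [vp, vp, mul_prod_erase A (fun p : ℕ => 1 - (p:ℝ)⁻¹) h]
    have hv' : 0 < vp (A.erase l) := vp_pos fun p hp => hA p (mem_of_mem_erase hp)
    rw [e, mul_right_comm]
    apply le_mul_of_one_le_left hv'.le
    have : (l:ℝ)⁻¹ ≤ 1/2 := by rw [inv_le_comm₀ (by linarith) (by norm_num)]; linarith
    have h0 : 0 < (l:ℝ)⁻¹ := by positivity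
    rw [div_eq_mul_inv]
    nlinarith
  · rw [erase_eq_of_notMem h]
    apply le_mul_of_one_le_right hv.le
    have : 0 ≤ 2/(l:ℝ) := by positivity
    linarith

/-- L1 distance between the Selberg weight (omitting l) and rough indicator. -/
lemma WS_L1 (z D N l : ℕ) (hz : 2 ≤ z) (hD : 2 ≤ D) (hl : 2 ≤ l)
    (hδ : 2 * Real.exp 6 * (Real.log z / Real.log D)^2 ≤ 1/2) :
    ∑ n ∈ Ioc 0 N, |WS ((Nat.primesBelow z).erase l) D n - if rough z n then 1 else 0| ≤
      N * (8 / (l * Real.log z) + 64 * Real.exp 6 * Real.log z / (Real.log D)^2) + 2 * z * (D:ℝ)^4 := by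
  have hlz : 0 < Real.log z := Real.log_pos (by exact_mod_cast hz)
  have hlD : 0 < Real.log D := Real.log_pos (by exact_mod_cast hD)
  have hl0 : (2:ℝ) ≤ l := by exact_mod_cast hl
  have hz0 : (2:ℝ) ≤ z := by exact_mod_cast hz
  set A := (Nat.primesBelow z).erase l with hAd
  have hB : ∀ p ∈ Nat.primesBelow z, p.Prime := fun p hp => (mem_primesBelow'.1 hp).1
  have hA : ∀ p ∈ A, p.Prime ∧ p < z := fun p hp => mem_primesBelow'.1 (mem_of_mem_erase hp)
  have e1 : ∑ n ∈ Ioc 0 N, |WS A D n - if rough z n then 1 else 0| =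
      ∑ n ∈ Ioc 0 N, WS A D n - ((Ioc 0 N).filter (rough z)).card := by
    rw [card_filter]
    push_cast
    rw [← sum_sub_distrib]
    refine sum_congr rfl fun n _ => abs_of_nonneg ?_
    split_ifs with h
    · rw [WS_eq_one (by omega) (fun p hp => h p (mem_of_mem_erase hp))]; simp
    · have := WS_nonneg A D n
      linarith
  rw [e1]
  have e2 := sieve_sum A D 0 N (by omega) (Nat.zero_le _) (fun p hp => (hA p hp).1)
  have e3 := rough_lower z D N hz hD hδ
  have e4 := inv_GS_le A z D hz hD hA hδ
  have e5 := vp_erase_le (Nat.primesBelow z) hB l hl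
  have hV := vp_le_inv_log z hz
  have hv0 := vp_pos hB
  set V := vp (Nat.primesBelow z)
  set δ := 2 * Real.exp 6 * (Real.log z / Real.log D)^2 with hδd
  have hδ0 : 0 ≤ δ := by positivity
  have e6 : (GS A D)⁻¹ ≤ V * (1 + 2 / l) * (1 + 2 * δ) := e4.trans (by gcongr)
  have e7 : V * (1 + 2 / l) * (1 + 2 * δ) ≤ V + V * (4/l + 2 * δ) := by
    have h0 : 0 ≤ 2/(l:ℝ) := by positivity
    have : 4/(l:ℝ) = 2*(2/l) := by ring
    rw [this, mul_assoc, ← mul_one_add]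
    gcongr
    nlinarith
  have e8 : V * (4/l + 2 * δ) ≤ 2/Real.log z * (4/l + 2*δ) := by gcongr
  have e9 : 2/Real.log z * (4/l + 2*δ) = 8 / (l * Real.log z) + 8 * Real.exp 6 * Real.log z / (Real.log D)^2 := by
    rw [hδd]; field_simp; ring
  have e10 : ((N:ℝ) - (0:ℕ)) / GS A D ≤ N * (V + (8 / (l * Real.log z) + 8 * Real.exp 6 * Real.log z / (Real.log D)^2)) := by
    rw [div_eq_mul_inv]; push_cast; rw [sub_zero]
    gcongr
    linarith
  have e11 : (D:ℝ)^4 ≤ z * (D:ℝ)^4 := le_mul_of_one_le_left (by positivity) (by linarith)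
  have e12 : (N:ℝ) * (V + (8 / (l * Real.log z) + 8 * Real.exp 6 * Real.log z / (Real.log D)^2)) =
    N * V + N * (8 / (l * Real.log z)) + 8 * (N * Real.exp 6 * Real.log z / (Real.log D)^2) := by ring
  have e13 : (N:ℝ) * (8 / (l * Real.log z) + 64 * Real.exp 6 * Real.log z / (Real.log D)^2) =
    N * (8 / (l * Real.log z)) + 64 * (N * Real.exp 6 * Real.log z / (Real.log D)^2) := by ring
  have e14 : 48 * Real.exp 6 * N * Real.log z / (Real.log D)^2 = 48 * (N * Real.exp 6 * Real.log z / (Real.log D)^2) := by ring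
  have e15 : 0 ≤ (N * Real.exp 6 * Real.log z / (Real.log D)^2) := by positivity
  rw [e13]
  rw [e12] at e10
  rw [e14] at e3
  linarith

end BP

namespace BP
open Finset

noncomputable def eR (x : ℝ) : ℂ := Complex.exp (Complex.I * ((2 * Real.pi * x : ℝ) : ℂ))

lemma norm_eR (x : ℝ) : ‖eR x‖ = 1 := by
  rw [eR, mul_comm]; exact Complex.norm_exp_ofReal_mul_I _

lemma eR_add (x y : ℝ) : eR (x + y) = eR x * eR y := by
  rw [eR, eR, eR, ← Complex.exp_add]; congr 1; push_cast; ring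

lemma eR_conj (x : ℝ) : (starRingEnd ℂ) (eR x) = eR (-x) := by
  rw [eR, eR, ← Complex.exp_conj]; congr 1
  rw [map_mul, Complex.conj_I, Complex.conj_ofReal]; push_cast; ring

noncomputable def nn (x : ℝ) : ℝ := |x - round x|

lemma nn_nonneg (x : ℝ) : 0 ≤ nn x := abs_nonneg _

lemma nn_le (x : ℝ) (m : ℤ) : nn x ≤ |x - m| := round_le x m

lemma nn_neg (x : ℝ) : nn (-x) = nn x := by
  apply le_antisymm
  · have := nn_le (-x) (-round x)
    refine this.trans (le_of_eq ?_)
    rw [nn, ← abs_neg]; congr 1; push_cast; ring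
  · have := nn_le x (-round (-x))
    refine this.trans (le_of_eq ?_)
    rw [nn, ← abs_neg]; congr 1; push_cast; ring

lemma eR_sub_one_ge (x : ℝ) : 4 * nn x ≤ ‖eR x - 1‖ := by
  rw [eR, Complex.norm_exp_I_mul_ofReal_sub_one]
  rw [show 2 * Real.pi * x / 2 = Real.pi * x by ring, norm_mul, Real.norm_eq_abs, Real.norm_eq_abs]
  have h1 : |Real.sin (Real.pi * x)| = |Real.sin (Real.pi * nn x)| := by
    have e : Real.pi * x = Real.pi * (x - round x) + (round x : ℤ) * Real.pi := by ring
    rw [e, Real.sin_add_int_mul_pi, abs_mul, abs_zpow, abs_neg, abs_one, one_zpow, one_mul, nn]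
    rcases abs_choice (x - round x) with h | h <;> rw [h]
    rw [mul_neg, Real.sin_neg, abs_neg]
  rw [h1]
  have h2 : nn x ≤ 1/2 := abs_sub_round x
  have h3 := nn_nonneg x
  have h4 := Real.mul_le_sin (x := Real.pi * nn x) (by positivity) (by nlinarith [Real.pi_pos])
  have h5 : 2 / Real.pi * (Real.pi * nn x) = 2 * nn x := by
    field_simp
  rw [h5] at h4
  have := le_abs_self (Real.sin (Real.pi * nn x))
  rw [abs_of_pos (by norm_num : (0:ℝ) < 2)]
  linarith

lemma geom_bound (x : ℝ) (a b : ℕ) (hx : 0 < nn x) :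
    ‖∑ m ∈ Ioc a b, eR (x * m)‖ ≤ 1 / (2 * nn x) := by
  rcases le_or_gt a b with hab | hab
  swap
  · rw [Ioc_eq_empty (by omega)]; simp [hx.le]
  have h1 : (eR x - 1) * ∑ m ∈ Ioc a b, eR (x * m) = eR (x * ((b+1:ℕ):ℝ)) - eR (x * ((a+1:ℕ):ℝ)) := by
    have : Ioc a b = Ico (a+1) (b+1) := by ext x; simp only [mem_Ioc, mem_Ico]; omega
    rw [this, mul_sum, ← sum_Ico_sub (fun m : ℕ => eR (x * m)) (by omega)]
    refine sum_congr rfl fun m _ => ?_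
    push_cast
    rw [sub_mul, ← eR_add, one_mul]
    congr 2; ring
  have h2 : ‖eR x - 1‖ * ‖∑ m ∈ Ioc a b, eR (x * m)‖ ≤ 2 := by
    rw [← norm_mul, h1]
    refine (norm_sub_le _ _).trans ?_
    rw [norm_eR, norm_eR]; norm_num
  have h3 := eR_sub_one_ge x
  rw [le_div_iff₀ (by positivity)]
  have h4 := mul_le_mul_of_nonneg_right h3 (norm_nonneg (∑ m ∈ Ioc a b, eR (x * m)))
  nlinarith

def Approx (α : ℝ) (q Q : ℕ) : Prop :=
  0 < q ∧ ∃ a : ℤ, IsCoprime a (q:ℤ) ∧ |q * α - a| ≤ 1 / ((Q:ℝ) + 1)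

lemma exists_approx (α : ℝ) (Q : ℕ) (hQ : 0 < Q) : ∃ q, Approx α q Q ∧ q ≤ Q := by
  obtain ⟨x, h1, h2⟩ := Real.exists_rat_abs_sub_le_and_den_le α hQ
  refine ⟨x.den, ⟨x.den_pos, x.num, ?_, ?_⟩, h2⟩
  · rw [Int.isCoprime_iff_nat_coprime]; simpa using x.reduced
  · have hd : (0:ℝ) < x.den := by exact_mod_cast x.den_pos
    have e : (x.den:ℝ) * α - x.num = x.den * (α - x) := by
      have : (x:ℝ) = x.num / x.den := by exact_mod_cast (Rat.num_div_den x).symm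
      rw [this]; field_simp
    rw [e, abs_mul, abs_of_pos hd]
    calc _ ≤ x.den * (1 / (((Q:ℝ)+1) * x.den)) := by gcongr
      _ = _ := by field_simp

lemma approx_large {α : ℝ} (hα : Irrational α) (B : ℕ) :
    ∃ Q0, ∀ Q ≥ Q0, ∀ q, Approx α q Q → B < q := by
  have hpos : ∀ q ∈ Icc 1 B, 0 < nn (q * α) := by
    intro q hq
    rw [mem_Icc] at hq
    rw [nn, abs_pos]
    intro h
    have : Irrational ((q:ℕ) * α) := hα.natCast_mul (by omega)
    exact this ⟨(round (q*α) : ℤ), by push_cast; linarith⟩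
  obtain ⟨c, hc, hc2⟩ : ∃ c > 0, ∀ q ∈ Icc 1 B, c ≤ nn (q*α) := by
    rcases (Icc 1 B).eq_empty_or_nonempty with h | h
    · exact ⟨1, one_pos, by simp [h]⟩
    · obtain ⟨q0, h0, h1⟩ := exists_min_image (Icc 1 B) (fun q : ℕ => nn (q*α)) h
      exact ⟨_, hpos q0 h0, h1⟩
  obtain ⟨Q0, hQ0⟩ := exists_nat_one_div_lt hc
  refine ⟨Q0, fun Q hQ q ⟨hq, a, _, ha⟩ => ?_⟩
  by_contra hle
  have h1 := hc2 q (mem_Icc.2 ⟨hq, by omega⟩)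
  have h2 := nn_le (q*α) a
  have h3 : 1 / ((Q:ℝ)+1) ≤ 1/((Q0:ℝ)+1) := by
    have : (Q0:ℝ) ≤ Q := by exact_mod_cast hQ
    gcongr
  linarith

/-- core lower bound -/
lemma nn_core {α : ℝ} {q Q : ℕ} {a : ℤ} (hq : 0 < q) (ha : |q * α - a| ≤ 1 / ((Q:ℝ) + 1))
    (k : ℕ) (hk2 : 2 * k ≤ Q + 1) (hb : (k * a) % (q:ℤ) ≠ 0) :
    0 < (((k * a) % (q:ℤ) : ℤ):ℝ) ∧ (((k * a) % (q:ℤ) : ℤ):ℝ) < q ∧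
    (1 / nn (k * α) ≤ 2 * q * (1 / (((k * a) % (q:ℤ) : ℤ):ℝ) + 1 / (q - (((k * a) % (q:ℤ) : ℤ):ℝ)))) ∧
     1 / (2 * q) ≤ nn (k * α) := by
  have hqz : (0:ℤ) < q := by exact_mod_cast hq
  have hqr : (0:ℝ) < q := by exact_mod_cast hq
  set b := (k * a) % (q:ℤ) with hbd
  have hb0 : 0 ≤ b := Int.emod_nonneg _ hqz.ne'
  have hbq : b < q := Int.emod_lt_of_pos _ hqz
  have hb1 : 1 ≤ b := by omega
  obtain ⟨t, ht⟩ : ∃ t : ℤ, k * a = b + q * t := ⟨(k*a)/q, by rw [hbd]; exact (Int.emod_add_mul_ediv _ _).symm⟩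
  set m := round (k * α) with hm
  have hc : min b (q - b) ≤ |k * a - m * q| := by
    rw [ht]
    have e : b + q * t - m * q = b + q * (t - m) := by ring
    rw [e]
    rcases le_or_gt 0 (t - m) with h | h
    · have : 0 ≤ q * (t-m) := by positivity
      rw [abs_of_nonneg (by linarith)]
      exact (min_le_left _ _).trans (by linarith)
    · have : (q:ℤ) * (t-m) ≤ q * (-1) := by
        apply mul_le_mul_of_nonneg_left _ hqz.le; omega
      rw [abs_of_nonpos (by linarith)]
      exact (min_le_right _ _).trans (by linarith)
  set c : ℤ := min b (q - b) with hcd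
  have hc1 : 1 ≤ c := by rw [hcd]; apply le_min <;> omega
  have hcr : (1:ℝ) ≤ c := by exact_mod_cast hc1
  have hc' : (c:ℝ) ≤ |(k:ℝ) * a - m * q| := by exact_mod_cast hc
  have h1 : (k:ℝ) * a - m * q = q * (k * α - m) - k * (q * α - a) := by ring
  have h2 : |(k:ℝ) * a - m * q| ≤ q * nn (k * α) + k * (1 / ((Q:ℝ)+1)) := by
    rw [h1]
    refine (abs_sub _ _).trans ?_
    rw [abs_mul, abs_mul, abs_of_pos hqr, Nat.abs_cast, nn]
    gcongr
  have h3 : (k:ℝ) * (1 / ((Q:ℝ)+1)) ≤ 1/2 := by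
    have : (2:ℝ) * k ≤ Q + 1 := by exact_mod_cast hk2
    rw [mul_one_div, div_le_iff₀ (by positivity)]; linarith
  have h4 : (c:ℝ) / (2 * q) ≤ nn (k * α) := by
    rw [div_le_iff₀ (by positivity)]
    nlinarith
  have hbr : (1:ℝ) ≤ b := by exact_mod_cast hb1
  have hbr2 : (b:ℝ) < q := by exact_mod_cast hbq
  have hqb : 0 < (q:ℝ) - b := by linarith
  refine ⟨by linarith, hbr2, ?_, ?_⟩
  · have h5 : 1 / nn (k*α) ≤ 2 * q * (1 / c) := by
      have : 0 < (c:ℝ) / (2*q) := by positivity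
      calc _ ≤ 1 / ((c:ℝ) / (2*q)) := one_div_le_one_div_of_le this h4
        _ = _ := by field_simp
    refine h5.trans ?_
    apply mul_le_mul_of_nonneg_left _ (by positivity)
    have hb' : 0 < 1/(b:ℝ) := by positivity
    have hqb' : 0 < 1/((q:ℝ)-b) := by positivity
    rcases min_choice b (q-b) with h | h <;> rw [hcd, h]
    · linarith
    · push_cast; linarith
  · refine le_trans ?_ h4
    gcongr

lemma emod_ne {q : ℕ} {a : ℤ} (hco : IsCoprime a (q:ℤ)) (k : ℕ) (hk : ¬ q ∣ k) : (k * a) % (q:ℤ) ≠ 0 := by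
  intro h
  have h1 := Int.dvd_of_emod_eq_zero h
  have h2 := hco.symm.dvd_of_dvd_mul_right h1
  exact hk (by exact_mod_cast h2)

lemma nn_ge {α : ℝ} {q Q : ℕ} (h : Approx α q Q) (k : ℕ) (hk2 : 2 * k ≤ Q + 1) (hk : ¬ q ∣ k) :
    1 / (2 * q) ≤ nn (k * α) := by
  obtain ⟨hq, a, hco, ha⟩ := h
  exact (nn_core hq ha k hk2 (emod_ne hco k hk)).2.2.2

lemma harmonic_bound (q : ℕ) (hq : 1 ≤ q) : ∑ b ∈ Ico 1 q, (1:ℝ) / b ≤ 1 + Real.log q := by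
  have h := harmonic_le_one_add_log q
  have e : ((harmonic q : ℚ) : ℝ) = ∑ b ∈ Icc 1 q, (1:ℝ)/b := by
    rw [harmonic_eq_sum_Icc]; push_cast; simp
  rw [e] at h
  refine le_trans (sum_le_sum_of_subset_of_nonneg ?_ ?_) h
  · intro b hb; simp at *; omega
  · intros; positivity

lemma sum_nn {α : ℝ} {q Q : ℕ} (h : Approx α q Q) (K : ℕ) (hK : 2 * K ≤ Q + 1) :
    ∑ k ∈ (Ioc 0 K).filter (fun k => ¬ q ∣ k), 1 / nn (k * α) ≤ 4 * (K + q) * (1 + Real.log q) := by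
  obtain ⟨hq, a, hco, ha⟩ := h
  have hqr : (0:ℝ) < q := by exact_mod_cast hq
  have hqz : (0:ℤ) < q := by exact_mod_cast hq
  let g : ℕ → ℕ := fun k => ((k * a) % (q:ℤ)).toNat
  have hg : ∀ k, ((g k : ℕ) : ℤ) = (k*a) % (q:ℤ) := fun k => Int.toNat_of_nonneg (Int.emod_nonneg _ hqz.ne')
  have hg' : ∀ k, ((g k : ℕ) : ℝ) = (((k*a) % (q:ℤ) : ℤ):ℝ) := fun k => by rw [← hg]; simp
  let f : ℕ → ℝ := fun b => 2 * q * (1 / (b:ℝ) + 1 / ((q:ℝ) - b))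
  have hmaps : ∀ k ∈ (Ioc 0 K).filter (fun k => ¬ q ∣ k), g k ∈ Ico 1 q := by
    intro k hk
    rw [mem_filter, mem_Ioc] at hk
    obtain ⟨h1, h2, -, -⟩ := nn_core hq ha k (by omega) (emod_ne hco k hk.2)
    rw [← hg'] at h1 h2
    rw [mem_Ico]
    have h1' : 0 < g k := by exact_mod_cast h1
    exact ⟨h1', by exact_mod_cast h2⟩
  calc _ ≤ ∑ k ∈ (Ioc 0 K).filter (fun k => ¬ q ∣ k), f (g k) := by
        refine sum_le_sum fun k hk => ?_
        rw [mem_filter, mem_Ioc] at hk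
        obtain ⟨-, -, h3, -⟩ := nn_core hq ha k (by omega) (emod_ne hco k hk.2)
        simp only [f]
        rw [hg']; exact h3
    _ = ∑ b ∈ Ico 1 q, ∑ k ∈ ((Ioc 0 K).filter (fun k => ¬ q ∣ k)).filter (fun k => g k = b), f (g k) :=
        (sum_fiberwise_of_maps_to hmaps _).symm
    _ ≤ ∑ b ∈ Ico 1 q, ((K:ℝ)/q + 1) * f b := by
        refine sum_le_sum fun b hb => ?_
        rw [mem_Ico] at hb
        have hfb : 0 ≤ f b := by
          have : (b:ℝ) < q := by exact_mod_cast hb.2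
          have : 0 < (q:ℝ) - b := by linarith
          simp only [f]; positivity
        rw [sum_congr rfl (g := fun _ => f b) (fun k hk => by rw [(mem_filter.1 hk).2]), sum_const, nsmul_eq_mul]
        apply mul_le_mul_of_nonneg_right _ hfb
        rcases (((Ioc 0 K).filter (fun k => ¬ q ∣ k)).filter (fun k => g k = b)).eq_empty_or_nonempty with he | ⟨k0, hk0⟩
        · rw [he]; simp; positivity
        · have hsub : ((Ioc 0 K).filter (fun k => ¬ q ∣ k)).filter (fun k => g k = b) ⊆
              ((Ioc 0 K).filter (fun k => k ≡ k0 [MOD q])).filter (fun k => 1 ∣ k) := by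
            intro k hk
            rw [mem_filter, mem_filter] at hk hk0 ⊢
            refine ⟨⟨hk.1.1, ?_⟩, one_dvd _⟩
            have e : (k*a) % (q:ℤ) = (k0*a) % (q:ℤ) := by rw [← hg, ← hg, hk.2, hk0.2]
            have e2 : (k:ℤ) * a ≡ k0 * a [ZMOD q] := e
            have e3 : (k:ℤ) ≡ k0 [ZMOD q] := by
              rw [Int.modEq_iff_dvd] at e2 ⊢
              rw [← sub_mul] at e2
              exact hco.symm.dvd_of_dvd_mul_right e2
            exact (Int.natCast_modEq_iff).1 e3
          have h1 := ap_count 0 K q k0 1 (Nat.zero_le _) hq one_pos (Nat.coprime_one_left q)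
          have h2 := (abs_le.1 h1).2
          have h3 : ((((Ioc 0 K).filter (fun k => ¬ q ∣ k)).filter (fun k => g k = b)).card : ℝ) ≤
            ((((Ioc 0 K).filter (fun k => k ≡ k0 [MOD q])).filter (fun k => 1 ∣ k)).card : ℝ) := by
            exact_mod_cast card_le_card hsub
          push_cast at h2
          rw [div_one, sub_zero] at h2
          linarith
    _ = ((K:ℝ)/q + 1) * (2 * q) * (∑ b ∈ Ico 1 q, (1:ℝ)/b + ∑ b ∈ Ico 1 q, (1:ℝ)/((q:ℝ) - b)) := by
        rw [← mul_sum, ← sum_add_distrib, mul_assoc, mul_sum (a := 2 * (q:ℝ))]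
    _ = ((K:ℝ)/q + 1) * (2 * q) * (∑ b ∈ Ico 1 q, (1:ℝ)/b + ∑ b ∈ Ico 1 q, (1:ℝ)/b) := by
        congr 2
        apply sum_nbij' (fun b => q - b) (fun b => q - b)
        · intro b hb; simp at *; omega
        · intro b hb; simp at *; omega
        · intro b hb; simp at *; omega
        · intro b hb; simp at *; omega
        · intro b hb
          rw [mem_Ico] at hb
          rw [Nat.cast_sub hb.2.le]
    _ ≤ ((K:ℝ)/q + 1) * (2 * q) * ((1 + Real.log q) + (1 + Real.log q)) := by
        have := harmonic_bound q hq
        gcongr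
    _ = _ := by field_simp; ring

end BP

namespace BP
open Finset
open ArithmeticFunction (vonMangoldt)

lemma sum_dvd_Ioc (x : ℝ) (a b L : ℕ) (hL : 0 < L) :
    ∑ m ∈ (Ioc a b).filter (fun m => L ∣ m), eR (x * m) = ∑ m ∈ Ioc (a/L) (b/L), eR (x * L * m) := by
  symm
  apply sum_nbij' (fun m => L * m) (fun m => m / L)
  · intro m hm
    rw [mem_Ioc] at hm
    rw [mem_filter, mem_Ioc]
    refine ⟨⟨?_, ?_⟩, dvd_mul_right _ _⟩
    · have := (Nat.div_lt_iff_lt_mul hL).1 hm.1; linarith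
    · have := (Nat.le_div_iff_mul_le hL).1 hm.2; linarith
  · intro m hm
    rw [mem_filter, mem_Ioc] at hm
    obtain ⟨⟨h1, h2⟩, c, rfl⟩ := hm
    rw [mem_Ioc, Nat.mul_div_cancel_left _ hL]
    constructor
    · rw [Nat.div_lt_iff_lt_mul hL]; linarith
    · rw [Nat.le_div_iff_mul_le hL]; linarith
  · intro m hm; simp [hL.ne', Nat.mul_div_cancel_left _ hL]
  · intro m hm
    exact Nat.mul_div_cancel' (mem_filter.1 hm).2
  · intro m hm; push_cast; rw [mul_assoc]

lemma WS_exp_bound (A : Finset ℕ) (D a b : ℕ) (x : ℝ)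
    (h : ∀ d ∈ adm A D, ∀ e ∈ adm A D, 0 < nn (x * (Nat.lcm d e : ℕ))) :
    ‖∑ m ∈ Ioc a b, (WS A D m : ℂ) * eR (x * m)‖ ≤
      ∑ d ∈ adm A D, ∑ e ∈ adm A D, |lam A D d * lam A D e| * (1 / (2 * nn (x * (Nat.lcm d e : ℕ)))) := by
  rw [sum_WS_mul]
  refine (norm_sum_le _ _).trans (sum_le_sum fun d hd => ?_)
  refine (norm_sum_le _ _).trans (sum_le_sum fun e he => ?_)
  rw [norm_mul, Complex.norm_real, Real.norm_eq_abs]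
  apply mul_le_mul_of_nonneg_left _ (abs_nonneg _)
  rw [sum_dvd_Ioc x a b _ (lcm_props hd he).1]
  exact geom_bound _ _ _ (h d hd e he)

lemma good_sum_half {α : ℝ} {q Q : ℕ} (hA : Approx α q Q) (P L : ℕ) (hL : 0 < L) (hc : Nat.Coprime q L)
    (K : ℕ) (hPL : P * L ≤ K)
    (hK : 2 * K ≤ Q + 1) (s : Finset ℕ) (g : ℕ → ℕ) (hinj : Set.InjOn g s)
    (hs : ∀ x ∈ s, 0 < g x ∧ g x ≤ P ∧ ¬ q ∣ g x) :
    ∑ x ∈ s, 1 / (2 * nn ((g x : ℝ) * α * L)) ≤ 2 * (K + q) * (1 + Real.log q) := by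
  have h1 := sum_nn hA K hK
  have h2 : ∑ x ∈ s, 1 / nn ((g x : ℝ) * α * L) ≤ ∑ k ∈ (Ioc 0 K).filter (fun k => ¬ q ∣ k), 1 / nn (k * α) := by
    have e : ∑ x ∈ s, 1 / nn ((g x : ℝ) * α * L) = ∑ k ∈ s.image (fun x => g x * L), 1 / nn (k * α) := by
      rw [sum_image]
      · refine sum_congr rfl fun x _ => ?_
        push_cast; congr 2; ring
      · intro x hx y hy hxy
        exact hinj hx hy (Nat.eq_of_mul_eq_mul_right hL hxy)
    rw [e]
    apply sum_le_sum_of_subset_of_nonneg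
    · intro k hk
      rw [mem_image] at hk
      obtain ⟨x, hx, rfl⟩ := hk
      obtain ⟨h3, h4, h5⟩ := hs x hx
      rw [mem_filter, mem_Ioc]
      refine ⟨⟨by positivity, le_trans (Nat.mul_le_mul_right _ h4) hPL⟩, ?_⟩
      intro h6
      exact h5 (hc.dvd_of_dvd_mul_right h6)
    · intro k _ _
      have := nn_nonneg (k*α)
      positivity
  have h3 : ∑ x ∈ s, 1 / (2 * nn ((g x : ℝ) * α * L)) = 1/2 * ∑ x ∈ s, 1 / nn ((g x : ℝ) * α * L) := by
    rw [mul_sum]; refine sum_congr rfl fun x _ => ?_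
    rw [one_div_mul_one_div]
  rw [h3]
  linarith

lemma nn_diff_eq {α : ℝ} {d d' L : ℕ} :
    nn (α * ((d:ℝ) - d') * L) = nn (((if d' < d then d - d' else d' - d : ℕ) : ℝ) * α * L) := by
  split_ifs with h
  · rw [Nat.cast_sub h.le]; congr 1; ring
  · rw [Nat.cast_sub (by omega), ← nn_neg]; congr 1; ring

lemma not_dvd_diff {q d d' : ℕ} (h : ¬ d' ≡ d [MOD q]) : ¬ q ∣ (if d' < d then d - d' else d' - d) := by
  split_ifs with h1
  · intro h2; exact h ((Nat.modEq_iff_dvd' h1.le).2 h2)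
  · intro h2; exact h ((Nat.modEq_iff_dvd' (by omega)).2 h2).symm

lemma good_pos {α : ℝ} {q Q : ℕ} (hA : Approx α q Q) {P L d d' K : ℕ} (hc : Nat.Coprime q L)
    (hPL : P * L ≤ K) (hK : 2 * K ≤ Q + 1) (hd : d ≤ P) (hd' : d' ≤ P) (h : ¬ d' ≡ d [MOD q]) :
    0 < nn (α * ((d:ℝ) - d') * L) := by
  rw [nn_diff_eq]
  have h1 := not_dvd_diff h
  set u := (if d' < d then d - d' else d' - d) with hu
  have hu2 : u ≤ P := by rw [hu]; split_ifs <;> omega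
  have h2 : ¬ q ∣ u * L := fun h => h1 (hc.dvd_of_dvd_mul_right h)
  have h3 := nn_ge hA (u * L) (by
    have := Nat.mul_le_mul_right L hu2
    omega) h2
  have hq : (0:ℝ) < q := by exact_mod_cast hA.1
  have h4 : 0 < 1 / (2 * (q:ℝ)) := by positivity
  have e : (u:ℝ) * α * L = ((u * L : ℕ):ℝ) * α := by push_cast; ring
  rw [e]; linarith

lemma good_sum {α : ℝ} {q Q : ℕ} (hA : Approx α q Q) (P L : ℕ) (hL : 0 < L) (hc : Nat.Coprime q L)
    (K : ℕ) (hPL : P * L ≤ K) (hK : 2 * K ≤ Q + 1) (s : Finset ℕ) (d : ℕ) (hd : d ≤ P)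
    (hs : ∀ d' ∈ s, d' ≤ P ∧ ¬ d' ≡ d [MOD q]) :
    ∑ d' ∈ s, 1 / (2 * nn (α * ((d:ℝ) - d') * L)) ≤ 4 * (K + q) * (1 + Real.log q) := by
  simp_rw [nn_diff_eq]
  rw [← sum_filter_add_sum_filter_not s (fun d' => d' < d)]
  have h1 : ∀ p : ℕ → Prop, ∀ _ : DecidablePred p, (∀ x y, p x → p y → ((x < d ∧ y < d) ∨ (d ≤ x ∧ d ≤ y))) →
     ∑ d' ∈ s.filter p, 1 / (2 * nn (((if d' < d then d - d' else d' - d : ℕ) : ℝ) * α * L)) ≤ 2 * (K + q) * (1 + Real.log q) := by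
    intro p _ hp
    apply good_sum_half hA P L hL hc K hPL hK
    · intro x hx y hy hxy
      rw [mem_coe, mem_filter] at hx hy
      have := hp x y hx.2 hy.2
      dsimp only at hxy
      split_ifs at hxy <;> omega
    · intro x hx
      rw [mem_filter] at hx
      have h2 := hs x hx.1
      have h3 := not_dvd_diff h2.2
      refine ⟨Nat.pos_of_ne_zero ?_, ?_, h3⟩
      · intro h; rw [h] at h3; exact h3 (dvd_zero _)
      · have := h2.1; split_ifs <;> omega
  have h2 := h1 (fun d' => d' < d) inferInstance (fun x y hx hy => Or.inl ⟨hx, hy⟩)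
  have h3 := h1 (fun d' => ¬ d' < d) inferInstance (fun x y hx hy => Or.inr ⟨by omega, by omega⟩)
  linarith

/-- expansion of weighted second moment -/
lemma second_moment (α : ℝ) (W : ℕ → ℝ) (c : ℕ → ℝ) (I s : Finset ℕ) (N : ℕ) :
    ((∑ m ∈ I, W m * ‖∑ d ∈ s.filter (fun d => d * m ≤ N), (c d : ℂ) * eR (α * d * m)‖^2 : ℝ) : ℂ) =
     ∑ d ∈ s, ∑ d' ∈ s, ((c d * c d' : ℝ) : ℂ) *
       ∑ m ∈ I.filter (fun m => d * m ≤ N ∧ d' * m ≤ N), (W m : ℂ) * eR (α * ((d:ℝ) - d') * m) := by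
  push_cast
  have : ∀ m ∈ I, (W m : ℂ) * (‖∑ d ∈ s.filter (fun d => d * m ≤ N), (c d : ℂ) * eR (α * d * m)‖ : ℂ)^2 =
      ∑ d ∈ s, ∑ d' ∈ s, if (d * m ≤ N ∧ d' * m ≤ N) then ((c d * c d' : ℝ) : ℂ) * ((W m : ℂ) * eR (α * ((d:ℝ) - d') * m)) else 0 := by
    intro m _
    rw [← Complex.mul_conj', map_sum, sum_mul_sum, sum_filter, mul_sum]
    refine sum_congr rfl fun d _ => ?_
    split_ifs with h1
    · rw [sum_filter, mul_sum]
      refine sum_congr rfl fun d' _ => ?_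
      by_cases h2 : d' * m ≤ N
      · rw [if_pos h2, if_pos ⟨h1, h2⟩, map_mul, eR_conj, Complex.conj_ofReal]
        rw [show α * ((d:ℝ) - d') * m = α * d * m + -(α * d' * m) by ring, eR_add]
        push_cast; ring
      · rw [if_neg h2, if_neg (by tauto)]; simp
    · rw [mul_zero]; symm
      apply sum_eq_zero
      intro d' _
      rw [if_neg (by tauto)]
  rw [sum_congr rfl this, sum_comm]
  refine sum_congr rfl fun d _ => ?_
  rw [sum_comm]
  refine sum_congr rfl fun d' _ => ?_
  rw [mul_sum, sum_filter]
  push_cast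
  rfl

end BP

namespace BP
open Finset
open ArithmeticFunction (vonMangoldt)

lemma filter_Ioc_eq (M M' N d d' : ℕ) (hd : 0 < d) (hd' : 0 < d') :
    (Ioc M M').filter (fun m => d * m ≤ N ∧ d' * m ≤ N) = Ioc M (min M' (min (N/d) (N/d'))) := by
  ext m
  rw [mem_filter, mem_Ioc, mem_Ioc, le_min_iff, le_min_iff, Nat.le_div_iff_mul_le hd,
    Nat.le_div_iff_mul_le hd', mul_comm d, mul_comm d']
  tauto

lemma lcm_coprime {q r d e : ℕ} (hd : d ∈ adm (prq q r) r) (he : e ∈ adm (prq q r) r) :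
    Nat.Coprime q (Nat.lcm d e) := by
  obtain ⟨h0, -, -, h3⟩ := lcm_props hd he
  rw [Nat.coprime_comm, Nat.coprime_iff_gcd_eq_one]
  by_contra hne
  obtain ⟨p, hp, hpd⟩ := Nat.exists_prime_and_dvd hne
  have h1 := hpd.trans (Nat.gcd_dvd_left _ _)
  have h2 := hpd.trans (Nat.gcd_dvd_right _ _)
  exact (mem_filter.1 (h3 (Nat.mem_primeFactors.2 ⟨hp, h1, h0.ne'⟩))).2 h2

lemma block_moment {α : ℝ} {q Q : ℕ} (hA : Approx α q Q) (r M M' N P : ℕ) (hr : 1 ≤ r)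
    (hQ : 2 * (P * r^2) ≤ Q + 1) (s : Finset ℕ) (hs : s ⊆ Ioc 0 P) (c : ℕ → ℝ) (Lg : ℝ)
    (hc0 : ∀ d, 0 ≤ c d) (hcL : ∀ d ∈ s, c d ≤ Lg) (Y : ℝ)
    (hY : ∀ d ∈ s, ((s.filter (fun d' => d' ≡ d [MOD q])).card : ℝ) ≤ Y) :
    ∑ m ∈ Ioc M M', WS (prq q r) r m *
      ‖∑ d ∈ s.filter (fun d => d * m ≤ N), (c d : ℂ) * eR (α * d * m)‖^2 ≤
    Lg^2 * s.card * (Y * ∑ m ∈ Ioc M M', WS (prq q r) r m +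
      (r:ℝ)^4 * (4 * ((P * r^2 : ℕ) + q) * (1 + Real.log q))) := by
  set A := prq q r with hAd
  set Wt := ∑ m ∈ Ioc M M', WS A r m with hWt
  have hWt0 : 0 ≤ Wt := sum_nonneg fun m _ => WS_nonneg _ _ _
  have hq : 0 < q := hA.1
  set G : ℝ := 4 * ((P * r^2 : ℕ) + q) * (1 + Real.log q) with hG
  rcases s.eq_empty_or_nonempty with rfl | ⟨d0, hd0⟩
  · simp
  have hL0 : 0 ≤ Lg := (hc0 d0).trans (hcL d0 hd0)
  set F : ℕ → ℕ → ℝ := fun d d' => ∑ e ∈ adm A r, ∑ f ∈ adm A r, |lam A r e * lam A r f| *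
      (1 / (2 * nn (α * ((d:ℝ) - d') * (Nat.lcm e f : ℕ)))) with hF
  have hF0 : ∀ d d', 0 ≤ F d d' := fun d d' => by
    refine sum_nonneg fun e _ => sum_nonneg fun f _ => ?_
    have := nn_nonneg (α * ((d:ℝ) - d') * (Nat.lcm e f : ℕ))
    positivity
  have hin : ∀ d ∈ s, ∀ d' ∈ s, ‖∑ m ∈ (Ioc M M').filter (fun m => d * m ≤ N ∧ d' * m ≤ N),
      (WS A r m : ℂ) * eR (α * ((d:ℝ) - d') * m)‖ ≤ if d' ≡ d [MOD q] then Wt else F d d' := by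
    intro d hd d' hd'
    have h1 := mem_Ioc.1 (hs hd)
    have h2 := mem_Ioc.1 (hs hd')
    split_ifs with h
    · refine (norm_sum_le _ _).trans ?_
      rw [hWt]
      refine le_trans (sum_le_sum (g := fun m => WS A r m) fun m _ => ?_)
        (sum_le_sum_of_subset_of_nonneg (filter_subset _ _) (fun m _ _ => WS_nonneg _ _ _))
      rw [norm_mul, norm_eR, mul_one, Complex.norm_real, Real.norm_eq_abs, abs_of_nonneg (WS_nonneg _ _ _)]
    · rw [filter_Ioc_eq _ _ _ _ _ h1.1 h2.1]
      apply WS_exp_bound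
      intro e he f hf
      apply good_pos hA (lcm_coprime he hf) (K := P * r^2) (Nat.mul_le_mul_left _ (lcm_props he hf).2.1) hQ h1.2 h2.2 h
  have hrow : ∀ d ∈ s, ∑ d' ∈ s, (if d' ≡ d [MOD q] then Wt else F d d') ≤ Y * Wt + (r:ℝ)^4 * G := by
    intro d hd
    rw [sum_ite, sum_const, nsmul_eq_mul]
    apply add_le_add (mul_le_mul_of_nonneg_right (hY d hd) hWt0)
    simp only [hF]
    rw [sum_comm]
    calc _ ≤ ∑ e ∈ adm A r, ∑ f ∈ adm A r, |lam A r e * lam A r f| * G := by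
          refine sum_le_sum fun e he => ?_
          rw [sum_comm]
          refine sum_le_sum fun f hf => ?_
          rw [← mul_sum]
          apply mul_le_mul_of_nonneg_left _ (abs_nonneg _)
          apply good_sum hA P _ (lcm_props he hf).1 (lcm_coprime he hf) _ (Nat.mul_le_mul_left _ (lcm_props he hf).2.1) hQ _ d (mem_Ioc.1 (hs hd)).2
          intro d' hd'
          rw [mem_filter] at hd'
          exact ⟨(mem_Ioc.1 (hs hd'.1)).2, hd'.2⟩
      _ = (∑ e ∈ adm A r, ∑ f ∈ adm A r, |lam A r e * lam A r f|) * G := by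
          simp_rw [sum_mul]
      _ ≤ _ := by
          have hG0 : 0 ≤ G := by
            have : 0 ≤ Real.log q := Real.log_natCast_nonneg q
            positivity
          exact mul_le_mul_of_nonneg_right (sum_lam_abs_le hr) hG0
  have hm := second_moment α (WS A r) c (Ioc M M') s N
  have hn := congrArg norm hm
  rw [Complex.norm_real, Real.norm_eq_abs] at hn
  refine (le_abs_self _).trans ?_
  rw [hn]
  calc _ ≤ ∑ d ∈ s, ∑ d' ∈ s, Lg^2 * (if d' ≡ d [MOD q] then Wt else F d d') := by
        refine (norm_sum_le _ _).trans (sum_le_sum fun d hd => ?_)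
        refine (norm_sum_le _ _).trans (sum_le_sum fun d' hd' => ?_)
        rw [norm_mul, Complex.norm_real, Real.norm_eq_abs, abs_of_nonneg (mul_nonneg (hc0 d) (hc0 d'))]
        have h1 : c d * c d' ≤ Lg^2 := by
          rw [sq]; exact mul_le_mul (hcL d hd) (hcL d' hd') (hc0 d') hL0
        exact mul_le_mul h1 (hin d hd d' hd') (norm_nonneg _) (by positivity)
    _ ≤ ∑ d ∈ s, Lg^2 * (Y * Wt + (r:ℝ)^4 * G) := by
        refine sum_le_sum fun d hd => ?_
        rw [← mul_sum]
        exact mul_le_mul_of_nonneg_left (hrow d hd) (by positivity)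
    _ = _ := by rw [sum_const, nsmul_eq_mul]; ring

/-- count of rough numbers in AP -/
lemma rough_ap {q r z a b c : ℕ} (hr : 2 ≤ r) (hrz : r < z) (hab : a ≤ b) (hq : 0 < q) (J : Finset ℕ)
    (hJ : J ⊆ Ioc a b) (hJ2 : ∀ n ∈ J, rough z n ∧ n ≡ c [MOD q]) :
    (J.card : ℝ) ≤ ((b:ℝ) - a) / (Nat.totient q * Real.log r) + (r:ℝ)^4 := by
  have h1 := card_le_sum_WS (A := prq q r) (D := r) (by omega) ((Ioc a b).filter (fun n => n ≡ c [MOD q])) J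
    (fun n hn => mem_filter.2 ⟨hJ hn, (hJ2 n hn).2⟩) (fun n hn p hp => (hJ2 n hn).1 p (by
      rw [prq, mem_filter, mem_primesBelow'] at hp
      exact mem_primesBelow'.2 ⟨hp.1.1, by omega⟩))
  have h2 := sieve_sum_ap (prq q r) r a b q c (by omega) hab hq (fun p hp => (mem_filter.1 hp).2)
  have h3 := GS_prq_ge q r hq
  have hφ : (0:ℝ) < Nat.totient q := by exact_mod_cast Nat.totient_pos.2 hq
  have hqr : (0:ℝ) < q := by exact_mod_cast hq
  have hl : 0 < Real.log r := Real.log_pos (by exact_mod_cast hr)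
  have hab' : (0:ℝ) ≤ (b:ℝ) - a := by
    have : (a:ℝ) ≤ b := by exact_mod_cast hab
    linarith
  refine (h1.trans h2).trans (add_le_add ?_ le_rfl)
  calc _ ≤ ((b:ℝ)-a)/q / ((Nat.totient q : ℝ) / q * Real.log r) := by gcongr
    _ = _ := by field_simp

lemma rough_interval {r z a b : ℕ} (hr : 2 ≤ r) (hrz : r < z) (hab : a ≤ b) :
    (((Ioc a b).filter (rough z)).card : ℝ) ≤ ((b:ℝ) - a) / Real.log r + (r:ℝ)^4 := by
  have := rough_ap (q := 1) (c := 0) hr hrz hab one_pos ((Ioc a b).filter (rough z)) (filter_subset _ _)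
    (fun n hn => ⟨(mem_filter.1 hn).2, Nat.modEq_one⟩)
  simpa using this

lemma W_total {q r a b : ℕ} (hr : 2 ≤ r) (hab : a ≤ b) (hq : 0 < q) :
    ∑ n ∈ Ioc a b, WS (prq q r) r n ≤ ((b:ℝ) - a) * q / (Nat.totient q * Real.log r) + (r:ℝ)^4 := by
  have h2 := sieve_sum (prq q r) r a b (by omega) hab (fun p hp => prq_prime hp)
  have h3 := GS_prq_ge q r hq
  have hφ : (0:ℝ) < Nat.totient q := by exact_mod_cast Nat.totient_pos.2 hq
  have hqr : (0:ℝ) < q := by exact_mod_cast hq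
  have hl : 0 < Real.log r := Real.log_pos (by exact_mod_cast hr)
  have hab' : (0:ℝ) ≤ (b:ℝ) - a := by
    have : (a:ℝ) ≤ b := by exact_mod_cast hab
    linarith
  refine h2.trans (add_le_add ?_ le_rfl)
  calc _ ≤ ((b:ℝ)-a) / ((Nat.totient q : ℝ) / q * Real.log r) := by gcongr
    _ = _ := by field_simp

end BP

namespace BP
open Finset
open ArithmeticFunction (vonMangoldt)

lemma vp_ge_card (A : Finset ℕ) (hA : ∀ p ∈ A, 2 ≤ p) : 1 / ((A.card:ℝ) + 1) ≤ vp A := by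
  induction A using Finset.induction_on_max with
  | empty => simp [vp]
  | insert m A hm ih =>
    have hmn : m ∉ A := fun h => lt_irrefl _ (hm m h)
    have ih' := ih (fun p hp => hA p (mem_insert_of_mem hp))
    rw [vp, prod_insert hmn, card_insert_of_notMem hmn]
    rw [vp] at ih'
    have hm2 := hA m (mem_insert_self _ _)
    have hc : A.card + 2 ≤ m := by
      have : A ⊆ Ico 2 m := fun p hp => mem_Ico.2 ⟨hA p (mem_insert_of_mem hp), hm p hp⟩
      have := card_le_card this
      rw [Nat.card_Ico] at this
      omega
    have hc' : ((A.card:ℝ) + 2) ≤ m := by exact_mod_cast hc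
    set c : ℝ := (A.card:ℝ) with hcd
    have hc0 : 0 ≤ c := by positivity
    have h1 : (m:ℝ)⁻¹ ≤ (c+2)⁻¹ := inv_anti₀ (by linarith) hc'
    have h2 : (c+1)/(c+2) ≤ 1 - (m:ℝ)⁻¹ := by
      have : (c+1)/(c+2) = 1 - (c+2)⁻¹ := by field_simp; ring
      linarith
    calc 1/(((A.card+1:ℕ):ℝ)+1) = (c+1)/(c+2) * (1/(c+1)) := by
          push_cast; rw [← hcd]; field_simp; ring
      _ ≤ _ := mul_le_mul h2 ih' (by positivity) (by
          refine le_trans ?_ h2; positivity)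

lemma q_div_totient (q : ℕ) (hq : 0 < q) : (q:ℝ) / Nat.totient q ≤ 1 + 2 * Real.log q := by
  have h := vp_ge_card q.primeFactors (fun p hp => (Nat.prime_of_mem_primeFactors hp).two_le)
  have hqr : (0:ℝ) < q := by exact_mod_cast hq
  have hv : 0 < vp q.primeFactors := vp_pos fun p hp => Nat.prime_of_mem_primeFactors hp
  rw [totient_eq]
  have h1 : (2:ℝ) ^ q.primeFactors.card ≤ q := by
    have : 2 ^ q.primeFactors.card ≤ ∏ p ∈ q.primeFactors, p := by
      apply pow_card_le_prod
      exact fun p hp => (Nat.prime_of_mem_primeFactors hp).two_le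
    have := this.trans (Nat.le_of_dvd hq (Nat.prod_primeFactors_dvd q))
    exact_mod_cast this
  have h2 := Real.log_le_log (by positivity) h1
  rw [Real.log_pow] at h2
  have h3 := Real.log_two_gt_d9
  have h4 : (q.primeFactors.card : ℝ) ≤ 2 * Real.log q := by
    have : (0:ℝ) ≤ q.primeFactors.card := by positivity
    nlinarith
  have h5 : (q:ℝ) / (q * vp q.primeFactors) = 1 / vp q.primeFactors := by
    field_simp
  rw [h5, div_le_iff₀ hv]
  rw [div_le_iff₀ (by positivity)] at h
  nlinarith

noncomputable def TT (α : ℝ) (z N m : ℕ) : ℂ :=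
  ∑ d ∈ ((Ioc 0 N).filter (rough z)).filter (fun d => d * m ≤ N), (vonMangoldt d : ℂ) * eR (α * d * m)

set_option maxHeartbeats 1000000 in
lemma block_bound {α : ℝ} {q : ℕ} (r M N : ℕ) (hr : 2 ≤ r) (hM : r^16 ≤ 2 * M) (hP : r^16 ≤ N / M)
    (hA : Approx α q (N / r^8)) (hqQ : q ≤ N / r^8) :
    ∑ m ∈ (Ioc M (2*M)).filter (rough (r^16)), ‖TT α (r^16) N m‖ ≤
     N * (4 * Real.log N * (Real.sqrt q / Nat.totient q) / (Real.log r)^2 + 20 * Real.log N * (1 + Real.log N) / (r:ℝ)^2) := by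
  set z := r^16 with hz
  set P := N / M with hPd
  set s := (Ioc 0 P).filter (rough z) with hs
  have hrz : r < z := by
    calc r = r^1 := (pow_one r).symm
      _ < r^16 := Nat.pow_lt_pow_right (by omega) (by norm_num)
  have hM0 : 0 < M := by
    have : 0 < r^16 := by positivity
    omega
  have hq := hA.1
  have hPM : P * M ≤ N := Nat.div_mul_le_self N M
  have hQ8 : N < (N / r^8 + 1) * r^8 := by
    have := Nat.lt_div_mul_add (a := N) (b := r^8) (by positivity)
    linarith
  -- condition
  have hQc : 2 * (P * r^2) ≤ N / r^8 + 1 := by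
    by_contra hcon
    push Not at hcon
    have h1 : (N / r^8 + 1) * r^8 ≤ 2 * (P * r^2) * r^8 := Nat.mul_le_mul_right _ hcon.le
    have h2 : 2 * (P * r^2) * r^8 ≤ P * M := by
      have h64 : 64 ≤ r^6 := by
        calc 64 = 2^6 := by norm_num
          _ ≤ r^6 := Nat.pow_le_pow_left hr 6
      have h3 : 4 * r^10 ≤ r^16 := by
        calc 4 * r^10 ≤ r^6 * r^10 := Nat.mul_le_mul_right _ (by omega)
          _ = r^16 := by ring
      have : 2 * r^10 ≤ M := by omega
      calc 2 * (P * r^2) * r^8 = P * (2 * r^10) := by ring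
        _ ≤ P * M := Nat.mul_le_mul_left _ this
    omega
  -- rewrite TT
  have hT : ∀ m ∈ Ioc M (2*M), TT α z N m = ∑ d ∈ s.filter (fun d => d * m ≤ N), (vonMangoldt d : ℂ) * eR (α * d * m) := by
    intro m hm
    rw [mem_Ioc] at hm
    rw [TT]
    congr 1
    ext d
    simp only [hs, mem_filter, mem_Ioc]
    constructor
    · rintro ⟨⟨⟨h1, h2⟩, h3⟩, h4⟩
      refine ⟨⟨⟨h1, ?_⟩, h3⟩, h4⟩
      rw [hPd, Nat.le_div_iff_mul_le hM0]
      exact le_trans (Nat.mul_le_mul_left _ hm.1.le) h4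
    · rintro ⟨⟨⟨h1, h2⟩, h3⟩, h4⟩
      exact ⟨⟨⟨h1, h2.trans (Nat.div_le_self _ _)⟩, h3⟩, h4⟩
  set Lg := Real.log N with hLg
  have hLg0 : 0 ≤ Lg := Real.log_natCast_nonneg N
  set ρ := Real.log r with hρ
  have hρ1 : 1/2 ≤ ρ := by
    have h3 := Real.log_two_gt_d9
    have : Real.log 2 ≤ ρ := Real.log_le_log (by norm_num) (by exact_mod_cast hr)
    linarith
  have hr2 : (2:ℝ) ≤ r := by exact_mod_cast hr
  have hρr : ρ ≤ r := (Real.log_le_sub_one_of_pos (by linarith)).trans (by linarith)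
  have hφ : (0:ℝ) < Nat.totient q := by exact_mod_cast Nat.totient_pos.2 hq
  have hqr : (1:ℝ) ≤ q := by exact_mod_cast hq
  have hφq : (Nat.totient q:ℝ) ≤ q := by exact_mod_cast Nat.totient_le q
  set φ : ℝ := (Nat.totient q : ℝ) with hφd
  have hMr : (r:ℝ)^16 ≤ 2 * M := by exact_mod_cast hM
  have hPr : (r:ℝ)^16 ≤ P := by exact_mod_cast hP
  have hPMr : (P:ℝ) * M ≤ N := by exact_mod_cast hPM
  have hM0r : (0:ℝ) < M := by exact_mod_cast hM0
  have hP0r : (0:ℝ) < P := lt_of_lt_of_le (by positivity) hPr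
  have hr5 : 2 * (r:ℝ)^5 ≤ r^16 := by
    have : 2 * (r:ℝ)^5 = 2 * r^5 * 1 := by ring
    have h1 : (2:ℝ) ≤ r^11 := by
      calc (2:ℝ) ≤ 2^11 := by norm_num
        _ ≤ r^11 := by gcongr
    calc 2 * (r:ℝ)^5 ≤ r^11 * r^5 := by gcongr
      _ = _ := by ring
  have hcard1 : (((Ioc M (2*M)).filter (rough z)).card : ℝ) ≤ 2 * M / ρ := by
    have := rough_interval (a := M) (b := 2*M) hr hrz (by omega)
    have h2 : (r:ℝ)^4 ≤ M/ρ := by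
      rw [le_div_iff₀ (by linarith)]
      calc (r:ℝ)^4*ρ ≤ r^4 * r := by gcongr
        _ ≤ (M:ℝ) := by linarith [show (r:ℝ)^4*r = r^5 by ring]
    push_cast at this
    calc _ ≤ _ := this
      _ ≤ (2 * M - M)/ρ + M/ρ := by gcongr
      _ = _ := by ring
  have hcard2 : (s.card : ℝ) ≤ 2 * P / ρ := by
    have := rough_interval (a := 0) (b := P) hr hrz (by omega)
    have h2 : (r:ℝ)^4 ≤ P/ρ := by
      rw [le_div_iff₀ (by linarith)]
      calc (r:ℝ)^4*ρ ≤ r^4 * r := by gcongr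
        _ ≤ (P:ℝ) := by linarith [show (r:ℝ)^4*r = r^5 by ring, show (0:ℝ) ≤ r^5 by positivity]
    push_cast at this
    calc _ ≤ _ := this
      _ ≤ (P - 0)/ρ + P/ρ := by gcongr
      _ = _ := by ring
  have hWt := W_total (q := q) (r := r) (a := M) (b := 2*M) hr (by omega) hq
  have hWt2 : ∑ m ∈ Ioc M (2*M), WS (prq q r) r m ≤ 2 * M * q / (φ * ρ) := by
    have h2 : (r:ℝ)^4 ≤ M * q/(φ * ρ) := by
      rw [le_div_iff₀ (by positivity)]
      calc (r:ℝ)^4*(φ * ρ) ≤ r^4 * (q * r) := by gcongr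
        _ = (r:ℝ)^5 * q := by ring
        _ ≤ (M:ℝ) * q := by gcongr; linarith
    push_cast at hWt
    calc _ ≤ _ := hWt
      _ ≤ (2 * M - M) * q / (φ * ρ) + M * q/(φ * ρ) := by gcongr
      _ = _ := by ring
  set Wt := ∑ m ∈ Ioc M (2*M), WS (prq q r) r m with hWtd
  have hWt0 : 0 ≤ Wt := sum_nonneg fun m _ => WS_nonneg _ _ _
  have hlogq : Real.log q ≤ Lg := by
    apply Real.log_le_log (by linarith)
    exact_mod_cast hqQ.trans (Nat.div_le_self _ _)
  have hlogq0 : 0 ≤ Real.log q := Real.log_natCast_nonneg q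
  have hqφ : (q:ℝ)/φ ≤ 2 * (1 + Lg) := (q_div_totient q hq).trans (by linarith)
  -- Y
  obtain ⟨Y, hY0, hY, hYm⟩ : ∃ Y : ℝ, 0 ≤ Y ∧ (∀ d ∈ s, ((s.filter (fun d' => d' ≡ d [MOD q])).card : ℝ) ≤ Y) ∧
      Y * (2 * M * q / (φ * ρ)) ≤ 4 * M * P * (q / (φ^2 * ρ^2)) + 16 * M * P * (1 + Lg) / (r:ℝ)^8 := by
    by_cases hcase : q ≤ r^8
    · refine ⟨2 * P / (φ * ρ), by positivity, ?_, ?_⟩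
      · intro d hd
        have h1 := rough_ap (q := q) (c := d) hr hrz (Nat.zero_le P) hq (s.filter (fun d' => d' ≡ d [MOD q]))
          ((filter_subset _ _).trans (filter_subset _ _)) (fun n hn => by
            rw [mem_filter, hs, mem_filter] at hn
            exact ⟨hn.1.2, hn.2⟩)
        have hq8 : (q:ℝ) ≤ r^8 := by exact_mod_cast hcase
        have h2 : (r:ℝ)^4 ≤ P/(φ * ρ) := by
          rw [le_div_iff₀ (by positivity)]
          calc (r:ℝ)^4*(φ * ρ) ≤ r^4 * (r^8 * r) := by gcongr; linarith
            _ = (r:ℝ)^13 := by ring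
            _ ≤ (r:ℝ)^16 := pow_le_pow_right₀ (by linarith) (by norm_num)
            _ ≤ (P:ℝ) := hPr
        push_cast at h1
        calc _ ≤ _ := h1
          _ ≤ (P - 0)/(φ * ρ) + P/(φ * ρ) := by gcongr
          _ = _ := by ring
      · have e : 2 * P / (φ * ρ) * (2 * M * q / (φ * ρ)) = 4 * M * P * (q / (φ^2 * ρ^2)) := by
          field_simp; ring
        rw [e]
        have : 0 ≤ 16 * M * P * (1 + Lg) / (r:ℝ)^8 := by positivity
        linarith
    · push Not at hcase
      have hq8 : (r:ℝ)^8 ≤ q := by exact_mod_cast hcase.le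
      refine ⟨2 * P / r^8, by positivity, ?_, ?_⟩
      · intro d hd
        have h1 := ap_count 0 P q d 1 (Nat.zero_le _) hq one_pos (Nat.coprime_one_left q)
        have h2 := (abs_le.1 h1).2
        have h3 : ((s.filter (fun d' => d' ≡ d [MOD q])).card : ℝ) ≤
            ((((Ioc 0 P).filter (fun k => k ≡ d [MOD q])).filter (fun k => 1 ∣ k)).card : ℝ) := by
          have : s.filter (fun d' => d' ≡ d [MOD q]) ⊆ ((Ioc 0 P).filter (fun k => k ≡ d [MOD q])).filter (fun k => 1 ∣ k) := by
            intro n hn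
            rw [mem_filter, hs, mem_filter] at hn
            rw [mem_filter, mem_filter]
            exact ⟨⟨hn.1.1, hn.2⟩, one_dvd _⟩
          exact_mod_cast card_le_card this
        push_cast at h2
        rw [div_one, sub_zero] at h2
        have h4 : (P:ℝ)/q ≤ P / r^8 := by gcongr
        have h5 : (1:ℝ) ≤ P/r^8 := by
          rw [le_div_iff₀ (by positivity), one_mul]
          exact (pow_le_pow_right₀ (by linarith) (by norm_num)).trans hPr
        have h6 : 2 * (P:ℝ) / r^8 = P/r^8 + P/r^8 := by ring
        linarith
      · have e : 2 * (P:ℝ) / r^8 * (2 * M * q / (φ * ρ)) = 4 * M * P * ((q/φ) * (1/ρ)) / r^8 := by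
          field_simp; ring
        have h1 : 1/ρ ≤ 2 := by rw [div_le_iff₀ (by linarith)]; linarith
        have h2 : (q/φ) * (1/ρ) ≤ (2 * (1+Lg)) * 2 := by gcongr
        have h3 : 4 * M * P * ((q/φ) * (1/ρ)) / r^8 ≤ 4 * M * P * ((2 * (1+Lg)) * 2) / r^8 := by gcongr
        have h4 : 0 ≤ 4 * M * P * (q / (φ^2 * ρ^2)) := by positivity
        rw [e]
        have h5 : 4 * M * P * ((2 * (1+Lg)) * 2) / (r:ℝ)^8 = 16 * M * P * (1 + Lg) / (r:ℝ)^8 := by ring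
        linarith
  have hcL : ∀ d ∈ s, vonMangoldt d ≤ Lg := by
    intro d hd
    rw [hs, mem_filter, mem_Ioc] at hd
    refine ArithmeticFunction.vonMangoldt_le_log.trans ?_
    apply Real.log_le_log (by exact_mod_cast hd.1.1)
    exact_mod_cast hd.1.2.trans (Nat.div_le_self _ _)
  have hmom := block_moment hA r M (2*M) N P (by omega) hQc s (filter_subset _ _) (fun d => vonMangoldt d) Lg
    (fun d => ArithmeticFunction.vonMangoldt_nonneg) hcL Y hY
  rw [← hWtd] at hmom
  -- Cauchy Schwarz
  set S := (Ioc M (2*M)).filter (rough z) with hS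
  set B := ∑ m ∈ S, ‖TT α z N m‖ with hB
  have hB0 : 0 ≤ B := sum_nonneg fun m _ => norm_nonneg _
  have hCS : B^2 ≤ S.card * ∑ m ∈ S, ‖TT α z N m‖^2 := sq_sum_le_card_mul_sum_sq
  have hle : ∑ m ∈ S, ‖TT α z N m‖^2 ≤ ∑ m ∈ Ioc M (2*M), WS (prq q r) r m *
      ‖∑ d ∈ s.filter (fun d => d * m ≤ N), (vonMangoldt d : ℂ) * eR (α * d * m)‖^2 := by
    refine le_trans (sum_le_sum (g := fun m => WS (prq q r) r m *
      ‖∑ d ∈ s.filter (fun d => d * m ≤ N), (vonMangoldt d : ℂ) * eR (α * d * m)‖^2) fun m hm => ?_)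
      (sum_le_sum_of_subset_of_nonneg (filter_subset _ _) ?_)
    · rw [hS, mem_filter] at hm
      rw [← hT m hm.1, WS_eq_one (by omega), one_mul]
      intro p hp
      apply hm.2
      rw [prq, mem_filter, mem_primesBelow'] at hp
      exact mem_primesBelow'.2 ⟨hp.1.1, by omega⟩
    · intro m _ _
      exact mul_nonneg (WS_nonneg _ _ _) (by positivity)
  have hG : (r:ℝ)^4 * (4 * ((P * r^2 : ℕ) + q) * (1 + Real.log q)) ≤ 8 * N * (1 + Lg) / r^4 := by
    have h1 : (P:ℝ) * r^2 ≤ N / r^8 := by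
      rw [le_div_iff₀ (by positivity)]
      have h64 : (2:ℝ) ≤ r^6 := by
        calc (2:ℝ) ≤ 2^6 := by norm_num
          _ ≤ r^6 := by gcongr
      have : (r:ℝ)^10 ≤ M := by
        have : 2 * (r:ℝ)^10 ≤ r^16 := by
          calc 2 * (r:ℝ)^10 ≤ r^6 * r^10 := by gcongr
            _ = _ := by ring
        linarith
      calc (P:ℝ) * r^2 * r^8 = (P:ℝ) * r^10 := by ring
        _ ≤ (P:ℝ) * M := by gcongr
        _ ≤ (N:ℝ) := hPMr
    have h2 : (q:ℝ) ≤ N / r^8 := by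
      have h3 : ((N / r^8 : ℕ):ℝ) ≤ (N:ℝ) / ((r^8:ℕ):ℝ) := Nat.cast_div_le
      push_cast at h3
      exact le_trans (by exact_mod_cast hqQ) h3
    push_cast
    calc (r:ℝ)^4 * (4 * (P * r^2 + q) * (1 + Real.log q)) ≤ r^4 * (4 * (N/r^8 + N/r^8) * (1 + Lg)) := by gcongr
      _ = _ := by field_simp; ring
  have hYW : Y * Wt ≤ 4 * M * P * (q / (φ^2 * ρ^2)) + 16 * M * P * (1 + Lg) / (r:ℝ)^8 :=
    (mul_le_mul_of_nonneg_left hWt2 hY0).trans hYm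
  have hN0 : (0:ℝ) ≤ N := by positivity
  have hMP : (M:ℝ) * P ≤ N := by linarith [mul_comm (M:ℝ) P]
  have hYW2 : Y * Wt + (r:ℝ)^4 * (4 * ((P * r^2 : ℕ) + q) * (1 + Real.log q)) ≤
      N * (4 * (q / (φ^2 * ρ^2)) + 24 * (1+Lg) / r^4) := by
    have h1 : 4 * M * P * (q / (φ^2 * ρ^2)) ≤ N * (4 * (q / (φ^2 * ρ^2))) := by
      have : 4 * M * P * (q / (φ^2 * ρ^2)) = (M * P) * (4 * (q / (φ^2 * ρ^2))) := by ring
      rw [this]; gcongr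
    have h2 : 16 * M * P * (1 + Lg) / (r:ℝ)^8 ≤ N * (16 * (1+Lg) / r^4) := by
      have : 16 * M * P * (1 + Lg) / (r:ℝ)^8 = (M * P) * (16 * (1+Lg) / r^8) := by ring
      rw [this]; gcongr
      · linarith
      · norm_num
    have h3 : N * (4 * (q / (φ^2 * ρ^2)) + 24 * (1+Lg) / r^4) = N * (4 * (q / (φ^2 * ρ^2))) +  N * (16 * (1+Lg) / r^4)
       + 8 * N * (1 + Lg) / r^4 := by ring
    linarith
  have hfin : B^2 ≤ N^2 * ((4 * Lg * (Real.sqrt q / φ) / ρ^2)^2 + (20 * Lg * (1 + Lg) / (r:ℝ)^2)^2) := by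
    calc B^2 ≤ S.card * (Lg^2 * s.card * (Y * Wt + (r:ℝ)^4 * (4 * ((P * r^2 : ℕ) + q) * (1 + Real.log q)))) := by
          refine hCS.trans ?_
          gcongr
          exact hle.trans hmom
      _ ≤ (2 * M / ρ) * (Lg^2 * (2 * P / ρ) * (N * (4 * (q / (φ^2 * ρ^2)) + 24 * (1+Lg) / r^4))) := by
          have : 0 ≤ Y * Wt + (r:ℝ)^4 * (4 * ((P * r^2 : ℕ) + q) * (1 + Real.log q)) := by positivity
          gcongr
      _ = (M * P) * (4 * Lg^2 / ρ^2 * (N * (4 * (q / (φ^2 * ρ^2)) + 24 * (1+Lg) / r^4))) := by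
          field_simp
          ring
      _ ≤ N * (4 * Lg^2 / ρ^2 * (N * (4 * (q / (φ^2 * ρ^2)) + 24 * (1+Lg) / r^4))) := by gcongr
      _ = N^2 * (16 * Lg^2 * (q / (φ^2 * ρ^4)) + (1/ρ)^2 * (96 * Lg^2 * (1 + Lg) / r^4)) := by
          field_simp
          ring
      _ ≤ N^2 * (16 * Lg^2 * (q / (φ^2 * ρ^4)) + 2^2 * (96 * Lg^2 * (1 + Lg) / r^4)) := by
          have h1 : 1/ρ ≤ 2 := by rw [div_le_iff₀ (by linarith)]; linarith
          gcongr
      _ ≤ _ := by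
          have hsq : (Real.sqrt q)^2 = q := Real.sq_sqrt (by linarith)
          have e1 : (4 * Lg * (Real.sqrt q / φ) / ρ^2)^2 = 16 * Lg^2 * (q / (φ^2 * ρ^4)) := by
            rw [div_pow, mul_pow, mul_pow, div_pow, hsq]; field_simp; ring
          have e2 : (20 * Lg * (1 + Lg) / (r:ℝ)^2)^2 = 400 * Lg^2 * (1+Lg)^2 / r^4 := by
            rw [div_pow]; ring
          rw [e1, e2]
          have e3 : 2^2 * (96 * Lg^2 * (1 + Lg) / (r:ℝ)^4) ≤ 400 * Lg^2 * (1+Lg)^2 / r^4 := by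
            rw [← mul_div_assoc]
            apply div_le_div_of_nonneg_right _ (by positivity)
            have : 1 + Lg ≤ (1+Lg)^2 := by nlinarith
            nlinarith [mul_le_mul_of_nonneg_left this (sq_nonneg Lg), mul_nonneg (sq_nonneg Lg) (sq_nonneg (1+Lg))]
          gcongr
  set X1 := 4 * Lg * (Real.sqrt q / φ) / ρ^2 with hX1
  set X2 := 20 * Lg * (1 + Lg) / (r:ℝ)^2 with hX2
  have hX10 : 0 ≤ X1 := by positivity
  have hX20 : 0 ≤ X2 := by positivity
  apply abs_le_of_sq_le_sq' _ (by positivity) |>.2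
  calc B^2 ≤ _ := hfin
    _ ≤ (N * (X1 + X2))^2 := by
      rw [mul_pow]
      gcongr
      nlinarith

end BP

namespace BP
open Finset
open ArithmeticFunction (vonMangoldt)

lemma rough_ge {z n : ℕ} (h : rough z n) (hn : 1 < n) : z ≤ n := by
  by_contra hlt
  push Not at hlt
  have hp := Nat.minFac_prime hn.ne'
  exact h n.minFac (mem_primesBelow'.2 ⟨hp, (Nat.minFac_le (by omega)).trans_lt hlt⟩) (Nat.minFac_dvd n)

lemma TT_zero {α : ℝ} {z N m : ℕ} (h : N < z * m) : TT α z N m = 0 := by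
  rw [TT]
  apply sum_eq_zero
  intro d hd
  rw [mem_filter, mem_filter, mem_Ioc] at hd
  have hd1 : d = 1 := by
    by_contra hne
    have := rough_ge hd.1.2 (by omega)
    have := Nat.mul_le_mul_right m this
    omega
  rw [hd1]; simp

lemma type2 {α : ℝ} {q : ℕ} (r N : ℕ) (hr : 2 ≤ r) (hN : 1 ≤ N)
    (hA : Approx α q (N / r^8)) (hqQ : q ≤ N / r^8) :
    ∑ m ∈ ((Ioc 0 N).filter (rough (r^16))).filter (fun m => 1 < m), ‖TT α (r^16) N m‖ ≤
     (2 * Real.log N + 1) * (N * (4 * Real.log N * (Real.sqrt q / Nat.totient q) / (Real.log r)^2 + 20 * Real.log N * (1 + Real.log N) / (r:ℝ)^2)) := by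
  set X := N * (4 * Real.log N * (Real.sqrt q / Nat.totient q) / (Real.log r)^2 + 20 * Real.log N * (1 + Real.log N) / (r:ℝ)^2) with hX
  have hLg0 : 0 ≤ Real.log N := Real.log_natCast_nonneg N
  have hX0 : 0 ≤ X := by positivity
  have hblk : ∀ i, ∑ m ∈ (Ioc (2^i) (2 * 2^i)).filter (rough (r^16)), ‖TT α (r^16) N m‖ ≤ X := by
    intro i
    by_cases h1 : r^16 ≤ 2 * 2^i
    · by_cases h2 : r^16 ≤ N / 2^i
      · exact block_bound r (2^i) N hr h1 h2 hA hqQ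
      · rw [sum_eq_zero]
        · exact hX0
        · intro m hm
          rw [mem_filter, mem_Ioc] at hm
          rw [TT_zero, norm_zero]
          rw [Nat.le_div_iff_mul_le (by positivity)] at h2
          push Not at h2
          exact h2.trans_le (Nat.mul_le_mul_left _ hm.1.1.le)
    · rw [sum_eq_zero]
      · exact hX0
      · intro m hm
        rw [mem_filter, mem_Ioc] at hm
        have : 1 ≤ 2^i := Nat.one_le_two_pow
        have := rough_ge hm.2 (by omega)
        omega
  have hsub : ((Ioc 0 N).filter (rough (r^16))).filter (fun m => 1 < m) ⊆
      (range (Nat.log 2 N + 1)).biUnion (fun i => (Ioc (2^i) (2 * 2^i)).filter (rough (r^16))) := by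
    intro m hm
    rw [mem_filter, mem_filter, mem_Ioc] at hm
    rw [mem_biUnion]
    refine ⟨Nat.log 2 (m-1), ?_, ?_⟩
    · rw [mem_range, Nat.lt_succ_iff]
      exact Nat.log_mono_right (by omega)
    · rw [mem_filter, mem_Ioc]
      have h1 := Nat.pow_log_le_self 2 (x := m-1) (by omega)
      have h2 := Nat.lt_pow_succ_log_self (b := 2) (by norm_num) (m-1)
      rw [pow_succ] at h2
      exact ⟨⟨by omega, by omega⟩, hm.1.2⟩
  calc _ ≤ ∑ m ∈ (range (Nat.log 2 N + 1)).biUnion (fun i => (Ioc (2^i) (2 * 2^i)).filter (rough (r^16))), ‖TT α (r^16) N m‖ :=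
        sum_le_sum_of_subset_of_nonneg hsub (fun _ _ _ => norm_nonneg _)
    _ ≤ ∑ i ∈ range (Nat.log 2 N + 1), ∑ m ∈ (Ioc (2^i) (2 * 2^i)).filter (rough (r^16)), ‖TT α (r^16) N m‖ := by
        rw [sum_biUnion]
        intro i _ j _ hij
        rw [Function.onFun, disjoint_left]
        intro m hm hm'
        rw [mem_filter, mem_Ioc] at hm hm'
        rcases lt_or_gt_of_ne hij with h | h
        · have : 2 * 2^i ≤ 2^j := by
            rw [← pow_succ']; exact Nat.pow_le_pow_right (by norm_num) h
          omega
        · have : 2 * 2^j ≤ 2^i := by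
            rw [← pow_succ']; exact Nat.pow_le_pow_right (by norm_num) h
          omega
    _ ≤ ∑ i ∈ range (Nat.log 2 N + 1), X := sum_le_sum fun i _ => hblk i
    _ = ((Nat.log 2 N : ℝ) + 1) * X := by rw [sum_const, card_range, nsmul_eq_mul]; push_cast; ring
    _ ≤ _ := by
        gcongr
        have h1 : ((2:ℝ)^(Nat.log 2 N)) ≤ N := by exact_mod_cast Nat.pow_log_le_self 2 (by omega)
        have h2 := Real.log_le_log (by positivity) h1
        rw [Real.log_pow] at h2
        have h3 := Real.log_two_gt_d9
        have : (0:ℝ) ≤ Nat.log 2 N := by positivity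
        nlinarith

lemma exists_ell (K q : ℕ) (hq : K.factorial < q) :
    ∃ l, l.Prime ∧ K < l ∧ ∀ d, Squarefree d → ¬ l ∣ d → ¬ q ∣ d := by
  by_cases h : ∃ l, l.Prime ∧ K < l ∧ l ∣ q
  · obtain ⟨l, h1, h2, h3⟩ := h
    exact ⟨l, h1, h2, fun d _ hl hqd => hl (h3.trans hqd)⟩
  · push Not at h
    obtain ⟨l, h1, h2⟩ := Nat.exists_infinite_primes (K+1)
    refine ⟨l, h2, by omega, fun d hd _ hqd => ?_⟩
    have hsq := hd.squarefree_of_dvd hqd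
    have hfac : ∀ k : ℕ, ∏ x ∈ Icc 1 k, x = k.factorial := by
      intro k
      induction k with
      | zero => rfl
      | succ n ih => rw [prod_Icc_succ_top (by omega), ih, Nat.factorial_succ, mul_comm]
    have h3 : q ∣ K.factorial := by
      rw [← Nat.prod_primeFactors_of_squarefree hsq, ← hfac]
      apply prod_dvd_prod_of_subset
      intro p hp
      have hpp := Nat.prime_of_mem_primeFactors hp
      rw [mem_Icc]
      refine ⟨hpp.pos, ?_⟩
      by_contra hlt
      exact h p hpp (by omega) (Nat.dvd_of_mem_primeFactors hp)
    have := Nat.le_of_dvd (Nat.factorial_pos K) h3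
    omega

lemma type1 {α : ℝ} {q K : ℕ} (z D N : ℕ) (hz : 2 ≤ z) (hD : 2 ≤ D) (hN : 2 * D^8 ≤ N) (hK : 1 ≤ K)
    (hδ : 2 * Real.exp 6 * (Real.log z / Real.log D)^2 ≤ 1/2)
    (hA : Approx α q (N / D^6)) (hqQ : q ≤ N / D^6) (hqK : K.factorial < q) :
    ‖∑ n ∈ (Ioc 0 N).filter (rough z), eR (α * n)‖ ≤
      N / (D:ℝ)^2 + N * (8 / (K * Real.log z) + 64 * Real.exp 6 * Real.log z / (Real.log D)^2) + 2 * z * (D:ℝ)^4 := by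
  obtain ⟨l, hl, hKl, hdiv⟩ := exists_ell K q hqK
  have hlz : 0 < Real.log z := Real.log_pos (by exact_mod_cast hz)
  set A := (Nat.primesBelow z).erase l with hAd
  have h1 := WS_L1 z D N l hz hD hl.two_le hδ
  rw [← hAd] at h1
  have hD0 : (0:ℝ) < D := by positivity
  have hq : 0 < q := hA.1
  have hqr : (0:ℝ) < q := by exact_mod_cast hq
  have hnn : ∀ d ∈ adm A D, ∀ e ∈ adm A D, 1 / (2 * (q:ℝ)) ≤ nn (α * (Nat.lcm d e : ℕ)) := by
    intro d hd e he
    obtain ⟨p1, p2, p3, p4⟩ := lcm_props hd he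
    rw [mul_comm α]
    apply nn_ge hA
    · have : 2 * D^2 ≤ N / D^6 := by
        rw [Nat.le_div_iff_mul_le (by positivity)]
        calc 2 * D^2 * D^6 = 2 * D^8 := by ring
          _ ≤ N := hN
      omega
    · apply hdiv _ p3
      intro hld
      have := p4 (Nat.mem_primeFactors.2 ⟨hl, hld, p1.ne'⟩)
      exact (mem_erase.1 this).1 rfl
  have hpos : 0 < 1 / (2 * (q:ℝ)) := by positivity
  have h2 := WS_exp_bound A D 0 N α (fun d hd e he => hpos.trans_le (hnn d hd e he))
  have h3 : ∑ d ∈ adm A D, ∑ e ∈ adm A D, |lam A D d * lam A D e| * (1 / (2 * nn (α * (Nat.lcm d e : ℕ)))) ≤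
      N / (D:ℝ)^2 := by
    calc _ ≤ ∑ d ∈ adm A D, ∑ e ∈ adm A D, |lam A D d * lam A D e| * (q:ℝ) := by
          refine sum_le_sum fun d hd => sum_le_sum fun e he => ?_
          apply mul_le_mul_of_nonneg_left _ (abs_nonneg _)
          have := hnn d hd e he
          rw [div_le_iff₀ (by linarith)]
          rw [div_le_iff₀ (by positivity)] at this
          linarith
      _ = (∑ d ∈ adm A D, ∑ e ∈ adm A D, |lam A D d * lam A D e|) * q := by simp_rw [sum_mul]
      _ ≤ (D:ℝ)^4 * (N / D^6) := by
          have h4 : ((N / D^6 : ℕ):ℝ) ≤ (N:ℝ) / ((D^6:ℕ):ℝ) := Nat.cast_div_le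
          push_cast at h4
          have h5 : (q:ℝ) ≤ N / D^6 := le_trans (by exact_mod_cast hqQ) h4
          exact mul_le_mul (sum_lam_abs_le (by omega)) h5 hqr.le (by positivity)
      _ = _ := by field_simp
  have h4 : ∑ n ∈ (Ioc 0 N).filter (rough z), eR (α * n) = ∑ m ∈ Ioc 0 N, (WS A D m : ℂ) * eR (α * m) -
      ∑ m ∈ Ioc 0 N, ((WS A D m - (if rough z m then 1 else 0) : ℝ) : ℂ) * eR (α * m) := by
    rw [sum_filter, ← sum_sub_distrib]
    refine sum_congr rfl fun n _ => ?_
    split_ifs <;> push_cast <;> ring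
  have h5 : ‖∑ m ∈ Ioc 0 N, ((WS A D m - (if rough z m then 1 else 0) : ℝ) : ℂ) * eR (α * m)‖ ≤
      ∑ n ∈ Ioc 0 N, |WS A D n - if rough z n then 1 else 0| := by
    refine (norm_sum_le _ _).trans (sum_le_sum fun n _ => ?_)
    rw [norm_mul, norm_eR, mul_one, Complex.norm_real, Real.norm_eq_abs]
  have h6 : 8 / (l * Real.log z) ≤ 8 / (K * Real.log z) := by
    have : (K:ℝ) ≤ l := by exact_mod_cast hKl.le
    have : (0:ℝ) < K := by exact_mod_cast hK
    gcongr
  have h7 : N * (8 / (l * Real.log z) + 64 * Real.exp 6 * Real.log z / (Real.log D)^2) ≤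
    N * (8 / (K * Real.log z) + 64 * Real.exp 6 * Real.log z / (Real.log D)^2) := by gcongr
  rw [h4]
  refine (norm_sub_le _ _).trans ?_
  linarith

lemma log_defect (N : ℕ) (S : Finset ℕ) (hS : S ⊆ Ioc 0 N) (H : ℝ) (hH : 1 ≤ H) :
    ∑ n ∈ S, (Real.log N - Real.log n) ≤ N / H * Real.log N + S.card * Real.log H := by
  have hLg0 : 0 ≤ Real.log N := Real.log_natCast_nonneg N
  have hlH : 0 ≤ Real.log H := Real.log_nonneg hH
  have h1 : ∀ n ∈ S, Real.log N - Real.log n ≤ (if n ∈ Ioc 0 ⌊(N:ℝ)/H⌋₊ then Real.log N else 0) + Real.log H := by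
    intro n hn
    have hn' := mem_Ioc.1 (hS hn)
    have hn0 : (0:ℝ) < n := by exact_mod_cast hn'.1
    have hN0 : (0:ℝ) < N := by exact_mod_cast hn'.1.trans_le hn'.2
    split_ifs with h
    · have : 0 ≤ Real.log n := Real.log_natCast_nonneg n
      linarith
    · rw [zero_add, ← Real.log_div hN0.ne' hn0.ne']
      apply Real.log_le_log (by positivity)
      rw [mem_Ioc, not_and, not_le] at h
      have h2 := Nat.lt_of_floor_lt (h hn'.1)
      rw [div_lt_iff₀ (by linarith)] at h2
      rw [div_le_iff₀ hn0]
      linarith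
  refine (sum_le_sum h1).trans ?_
  rw [sum_add_distrib, sum_const, nsmul_eq_mul]
  gcongr
  rw [← sum_filter, sum_const, nsmul_eq_mul]
  gcongr
  have h2 : (S.filter (fun n => n ∈ Ioc 0 ⌊(N:ℝ)/H⌋₊)).card ≤ ⌊(N:ℝ)/H⌋₊ := by
    calc _ ≤ (Ioc 0 ⌊(N:ℝ)/H⌋₊).card := card_le_card (fun n hn => (mem_filter.1 hn).2)
      _ = _ := by simp
  calc ((S.filter (fun n => n ∈ Ioc 0 ⌊(N:ℝ)/H⌋₊)).card : ℝ) ≤ ⌊(N:ℝ)/H⌋₊ := by exact_mod_cast h2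
    _ ≤ _ := Nat.floor_le (by positivity)

/-- The identity log = Λ * 1 on rough numbers. -/
lemma identity (α : ℝ) (z N : ℕ) :
    ∑ n ∈ (Ioc 0 N).filter (rough z), (Real.log n : ℂ) * eR (α * n) =
      ∑ m ∈ (Ioc 0 N).filter (rough z), TT α z N m := by
  have h1 : ∀ n ∈ (Ioc 0 N).filter (rough z), (Real.log n : ℂ) * eR (α * n) =
      ∑ x ∈ n.divisorsAntidiagonal, (vonMangoldt x.1 : ℂ) * eR (α * x.1 * x.2) := by
    intro n hn
    have hh : ∑ i ∈ n.divisors, vonMangoldt i = ∑ x ∈ n.divisorsAntidiagonal, vonMangoldt x.1 :=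
      (Nat.sum_divisorsAntidiagonal (fun i _ => vonMangoldt i)).symm
    rw [← ArithmeticFunction.vonMangoldt_sum, hh]
    push_cast
    rw [sum_mul]
    refine sum_congr rfl fun x hx => ?_
    rw [Nat.mem_divisorsAntidiagonal] at hx
    rw [← hx.1]; push_cast; rw [mul_assoc]
  rw [sum_congr rfl h1]
  simp only [TT]
  rw [sum_sigma', sum_sigma']
  apply sum_nbij' (i := fun y => (⟨y.2.2, y.2.1⟩ : (_ : ℕ) × ℕ)) (j := fun y => (⟨y.2 * y.1, (y.2, y.1)⟩ : (_ : ℕ) × (ℕ × ℕ)))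
  · rintro ⟨n, d, m⟩ hy
    simp only [mem_sigma, mem_filter, mem_Ioc, Nat.mem_divisorsAntidiagonal] at hy ⊢
    obtain ⟨⟨⟨h1, h2⟩, h3⟩, h4, h5⟩ := hy
    have hdn : d ∣ n := ⟨m, h4.symm⟩
    have hmn : m ∣ n := ⟨d, by rw [mul_comm]; exact h4.symm⟩
    refine ⟨⟨⟨Nat.pos_of_dvd_of_pos hmn h1, (Nat.le_of_dvd h1 hmn).trans h2⟩, fun p hp h => h3 p hp (h.trans hmn)⟩,
      ⟨⟨Nat.pos_of_dvd_of_pos hdn h1, (Nat.le_of_dvd h1 hdn).trans h2⟩, fun p hp h => h3 p hp (h.trans hdn)⟩, h4 ▸ h2⟩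
  · rintro ⟨m, d⟩ hy
    simp only [mem_sigma, mem_filter, mem_Ioc, Nat.mem_divisorsAntidiagonal] at hy ⊢
    obtain ⟨⟨⟨h1, h2⟩, h3⟩, ⟨⟨h4, h5⟩, h6⟩, h7⟩ := hy
    refine ⟨⟨⟨by positivity, h7⟩, ?_⟩, trivial, by positivity⟩
    intro p hp h
    rcases ((mem_primesBelow'.1 hp).1.dvd_mul).1 h with h | h
    · exact h6 p hp h
    · exact h3 p hp h
  · rintro ⟨n, d, m⟩ hy
    simp only [mem_sigma, mem_filter, mem_Ioc, Nat.mem_divisorsAntidiagonal] at hy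
    obtain ⟨-, rfl, -⟩ := hy
    rfl
  · rintro ⟨m, d⟩ hy; rfl
  · rintro ⟨n, d, m⟩ hy; rfl

end BP

namespace BP
open Finset
open ArithmeticFunction (vonMangoldt)

lemma lam_bound (α : ℝ) (z N : ℕ) (hN : 1 ≤ N) :
    ‖∑ d ∈ (Ioc 0 N).filter (rough z), (vonMangoldt d : ℂ) * eR (α * d)‖ ≤
      Real.log N * ‖∑ n ∈ (Ioc 0 N).filter (rough z), eR (α * n)‖
      + ∑ n ∈ (Ioc 0 N).filter (rough z), (Real.log N - Real.log n)
      + ∑ m ∈ ((Ioc 0 N).filter (rough z)).filter (fun m => 1 < m), ‖TT α z N m‖ := by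
  have h1 := identity α z N
  set S := (Ioc 0 N).filter (rough z) with hS
  rw [← sum_filter_add_sum_filter_not S (fun m => 1 < m) (fun m => TT α z N m)] at h1
  have hr1 : S.filter (fun m => ¬ 1 < m) = {1} := by
    ext m
    simp only [hS, mem_filter, mem_Ioc, mem_singleton]
    constructor
    · rintro ⟨⟨⟨h1, h2⟩, h3⟩, h4⟩; omega
    · rintro rfl
      refine ⟨⟨⟨by omega, hN⟩, fun p hp h => ?_⟩, by omega⟩
      have := (mem_primesBelow'.1 hp).1
      exact this.one_lt.ne' (Nat.dvd_one.1 h)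
  rw [hr1, sum_singleton] at h1
  have h2 : TT α z N 1 = ∑ d ∈ S, (vonMangoldt d : ℂ) * eR (α * d) := by
    rw [TT, ← hS]
    rw [filter_true_of_mem]
    · simp
    · intro d hd
      rw [mul_one]; exact (mem_Ioc.1 (mem_filter.1 hd).1).2
  rw [← h2]
  have h3 : TT α z N 1 = (Real.log N : ℂ) * ∑ n ∈ S, eR (α * n)
      - ∑ n ∈ S, ((Real.log N - Real.log n : ℝ) : ℂ) * eR (α * n)
      - ∑ m ∈ S.filter (fun m => 1 < m), TT α z N m := by
    rw [eq_sub_iff_add_eq, add_comm, ← h1, mul_sum, ← sum_sub_distrib]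
    refine sum_congr rfl fun n _ => ?_
    push_cast; ring
  rw [h3]
  refine (norm_sub_le _ _).trans (add_le_add ((norm_sub_le _ _).trans (add_le_add ?_ ?_)) (norm_sum_le _ _))
  · rw [norm_mul, Complex.norm_real, Real.norm_of_nonneg (Real.log_natCast_nonneg N)]
  · refine (norm_sum_le _ _).trans (sum_le_sum fun n hn => ?_)
    rw [norm_mul, norm_eR, mul_one, Complex.norm_real, Real.norm_of_nonneg]
    have hn' := mem_Ioc.1 (mem_filter.1 hn).1
    have : Real.log n ≤ Real.log N := Real.log_le_log (by exact_mod_cast hn'.1) (by exact_mod_cast hn'.2)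
    linarith

lemma prime_bound (α : ℝ) (z N : ℕ) (hN : 1 ≤ N) :
    ‖∑ p ∈ (Ioc 0 N).filter Nat.Prime, (Real.log p : ℂ) * eR (α * p)‖ ≤
      ‖∑ d ∈ (Ioc 0 N).filter (rough z), (vonMangoldt d : ℂ) * eR (α * d)‖
      + 2 * Real.sqrt N * Real.log N + z * Real.log N := by
  set S := (Ioc 0 N).filter (rough z) with hS
  have hLg0 : 0 ≤ Real.log N := Real.log_natCast_nonneg N
  have e1 : ∑ p ∈ (Ioc 0 N).filter Nat.Prime, (Real.log p : ℂ) * eR (α * p)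
     = ∑ p ∈ (Ioc 0 N).filter Nat.Prime, (vonMangoldt p : ℂ) * eR (α * p) :=
    sum_congr rfl fun p hp => by rw [ArithmeticFunction.vonMangoldt_apply_prime (mem_filter.1 hp).2]
  rw [e1, ← sum_filter_add_sum_filter_not ((Ioc 0 N).filter Nat.Prime) (rough z)]
  have e2 := sum_filter_add_sum_filter_not S Nat.Prime (fun d => (vonMangoldt d : ℂ) * eR (α * d))
  have e3 : ((Ioc 0 N).filter Nat.Prime).filter (rough z) = S.filter Nat.Prime := by
    rw [hS, filter_filter, filter_filter]
    congr 1; ext x; tauto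
  rw [e3, eq_sub_of_add_eq e2]
  have b1 : ‖∑ d ∈ S.filter (fun d => ¬ d.Prime), (vonMangoldt d : ℂ) * eR (α * d)‖ ≤ 2 * Real.sqrt N * Real.log N := by
    have := Chebyshev.abs_psi_sub_theta_le_sqrt_mul_log (x := (N:ℝ)) (by exact_mod_cast hN)
    refine le_trans ?_ ((le_abs_self _).trans this)
    have h : Chebyshev.psi N - Chebyshev.theta N = ∑ d ∈ (Ioc 0 N).filter (fun d => ¬ d.Prime), vonMangoldt d := by
      rw [Chebyshev.psi, Chebyshev.theta, Nat.floor_natCast, ← sum_filter_add_sum_filter_not (Ioc 0 N) Nat.Prime]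
      have : ∑ p ∈ (Ioc 0 N).filter Nat.Prime, vonMangoldt p = ∑ p ∈ (Ioc 0 N).filter Nat.Prime, Real.log p :=
        sum_congr rfl fun p hp => by rw [ArithmeticFunction.vonMangoldt_apply_prime (mem_filter.1 hp).2]
      rw [this]; ring
    rw [h]
    refine (norm_sum_le _ _).trans ?_
    have : ∀ d, ‖(vonMangoldt d : ℂ) * eR (α * d)‖ = vonMangoldt d := fun d => by
      rw [norm_mul, norm_eR, mul_one, Complex.norm_real, Real.norm_of_nonneg ArithmeticFunction.vonMangoldt_nonneg]
    simp only [this]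
    apply sum_le_sum_of_subset_of_nonneg
    · exact filter_subset_filter _ (filter_subset _ _)
    · intros; exact ArithmeticFunction.vonMangoldt_nonneg
  have b2 : ‖∑ d ∈ ((Ioc 0 N).filter Nat.Prime).filter (fun d => ¬ rough z d), (vonMangoldt d : ℂ) * eR (α * d)‖ ≤ z * Real.log N := by
    have hc : (((Ioc 0 N).filter Nat.Prime).filter (fun d => ¬ rough z d)).card ≤ z := by
      calc _ ≤ (range z).card := card_le_card ?_
        _ = z := card_range z
      intro p hp
      rw [mem_filter, mem_filter] at hp
      rw [mem_range]
      by_contra hz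
      apply hp.2
      intro l hl hlp
      have hl' := mem_primesBelow'.1 hl
      have := (Nat.prime_dvd_prime_iff_eq hl'.1 hp.1.2).1 hlp
      omega
    refine (norm_sum_le _ _).trans ?_
    calc _ ≤ ∑ d ∈ ((Ioc 0 N).filter Nat.Prime).filter (fun d => ¬ rough z d), Real.log N := by
          refine sum_le_sum fun d hd => ?_
          rw [norm_mul, norm_eR, mul_one, Complex.norm_real, Real.norm_of_nonneg ArithmeticFunction.vonMangoldt_nonneg]
          have hn' := mem_Ioc.1 (mem_filter.1 (mem_filter.1 hd).1).1
          exact ArithmeticFunction.vonMangoldt_le_log.trans (Real.log_le_log (by exact_mod_cast hn'.1) (by exact_mod_cast hn'.2))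
      _ ≤ _ := by
          rw [sum_const, nsmul_eq_mul]
          gcongr
  refine (norm_add_le _ _).trans (add_le_add ((norm_sub_le _ _).trans (add_le_add le_rfl b1)) b2)

/-- error function -/
noncomputable def err (κ r : ℝ) : ℝ :=
  6 * κ * Real.log r / r + 1 / (κ * Real.log r) + (1 / Real.log r + 1 / r) * (2 * Real.log (κ * Real.log r))
    + 120 * κ^3 * (Real.log r)^3 / r^2

set_option maxHeartbeats 1000000 in
lemma main_bound {α : ℝ} {q₁ q₂ K E r N : ℕ} (hE : 2 ≤ E) (hr : 2 ≤ r)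
    (hδ : 2 * Real.exp 6 * (16 / (E:ℝ))^2 ≤ 1/2) (hN1 : r^(20*E) ≤ N) (hN2 : N < (r+1)^(20*E)) (hK : 1 ≤ K)
    (hA1 : Approx α q₁ (N / (r^E)^6)) (hq1 : q₁ ≤ N / (r^E)^6) (hqK : K.factorial < q₁)
    (hA2 : Approx α q₂ (N / r^8)) (hq2 : q₂ ≤ N / r^8) :
    ‖∑ p ∈ (Ioc 0 N).filter Nat.Prime, (Real.log p : ℂ) * eR (α * p)‖ ≤
      N * (err (40 * E) r + 20 * E / K + 40960 * Real.exp 6 / E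
        + 12 * (40 * E)^2 * (Real.sqrt q₂ / Nat.totient q₂)) := by
  have hN : 1 ≤ N := le_trans (Nat.one_le_pow _ _ (by omega)) hN1
  set L := Real.log r with hL
  set κ : ℝ := 40 * E with hκ
  have hrR : (2:ℝ) ≤ r := by exact_mod_cast hr
  have hER : (2:ℝ) ≤ E := by exact_mod_cast hE
  have hNR : (1:ℝ) ≤ N := by exact_mod_cast hN
  have hL2 : 1/2 ≤ L := by
    have := Real.log_two_gt_d9
    have := Real.log_le_log (by norm_num) hrR
    linarith
  have hκL : 1 ≤ κ * L := by rw [hκ]; nlinarith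
  have hκ0 : 0 < κ := by positivity
  have hL0 : 0 < L := by linarith
  have hlogN : Real.log N ≤ κ * L := by
    have h1 : Real.log N ≤ Real.log (((r:ℝ)+1)^(20*E)) :=
      Real.log_le_log (by linarith) (by exact_mod_cast hN2.le)
    rw [Real.log_pow] at h1
    have h2 : Real.log ((r:ℝ)+1) ≤ 2 * L := by
      rw [hL, show (2:ℝ) * Real.log r = Real.log ((r:ℝ)^2) by rw [Real.log_pow]; norm_num]
      exact Real.log_le_log (by linarith) (by nlinarith)
    push_cast at h1
    calc Real.log N ≤ _ := h1
      _ ≤ 20 * E * (2 * L) := by gcongr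
      _ = κ * L := by rw [hκ]; ring
  have hLg0 : 0 ≤ Real.log N := Real.log_natCast_nonneg N
  have hr1 : 1 ≤ r := by omega
  have hr0 : (0:ℝ) < r := by linarith
  have hr1R : (1:ℝ) ≤ r := by linarith
  have hNR1 : (r:ℝ)^(20*E) ≤ N := by exact_mod_cast hN1
  -- power bounds
  have pw : ∀ a : ℕ, a + 1 ≤ 20 * E → (r:ℝ)^a ≤ N / r := by
    intro a ha
    rw [le_div_iff₀ hr0, ← pow_succ]
    exact (pow_le_pow_right₀ hr1R ha).trans hNR1
  have t1 := type1 (r^16) (r^E) N (le_trans hr (Nat.le_self_pow (by norm_num) r)) (le_trans hr (Nat.le_self_pow (by omega) r))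
    (by
      calc 2 * (r^E)^8 ≤ r * (r^E)^8 := by gcongr
        _ = r^(8*E+1) := by ring
        _ ≤ r^(20*E) := Nat.pow_le_pow_right hr1 (by omega)
        _ ≤ N := hN1) hK
    (by
      push_cast
      rw [Real.log_pow, Real.log_pow]
      have : (16:ℕ) * L / (E * L) = 16 / (E:ℝ) := by push_cast; field_simp
      rw [this]; exact hδ) hA1 hq1 hqK
  have t2 := type2 r N hr hN hA2 hq2
  have t3 := log_defect N ((Ioc 0 N).filter (rough (r^16))) (filter_subset _ _) ((κ*L)^2) (by nlinarith)
  have t4 := rough_interval (a := 0) (b := N) hr (show r < r^16 by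
    calc r = r^1 := (pow_one r).symm
      _ < r^16 := Nat.pow_lt_pow_right (by omega) (by norm_num)) (by omega)
  have t5 := lam_bound α (r^16) N hN
  have t6 := prime_bound α (r^16) N hN
  set Y := ‖∑ n ∈ (Ioc 0 N).filter (rough (r^16)), eR (α * n)‖
  set Q := Real.sqrt q₂ / Nat.totient q₂ with hQ
  have hQ0 : 0 ≤ Q := by positivity
  have hKR : (1:ℝ) ≤ K := by exact_mod_cast hK
  -- type 1
  have B1 : Real.log N * Y ≤ N * (3 * κ * L / r + 20 * E / K + 40960 * Real.exp 6 / E) := by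
    have : Y ≤ N * (3 / r + 1 / (2 * K * L) + 1024 * Real.exp 6 / (E^2 * L)) := by
      refine t1.trans ?_
      push_cast
      rw [Real.log_pow, Real.log_pow]
      have a1 : (N:ℝ) / ((r:ℝ)^E)^2 ≤ N / r := by
        gcongr
        rw [← pow_mul]
        exact le_self_pow₀ hr1R (by omega)
      have a2 : 2 * (r:ℝ)^16 * ((r:ℝ)^E)^4 ≤ 2 * (N / r) := by
        have := pw (16+E*4) (by omega)
        rw [pow_add, pow_mul] at this
        linarith
      have a3 : (8 / (K * ((16:ℕ) * L)) + 64 * Real.exp 6 * ((16:ℕ) * L) / (E * L)^2) = 1 / (2 * K * L) + 1024 * Real.exp 6 / (E^2 * L) := by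
        push_cast; field_simp; ring
      rw [← hL, a3]
      calc _ ≤ N / r + N * (1 / (2 * K * L) + 1024 * Real.exp 6 / (E^2 * L)) + 2 * (N / r) := by gcongr
        _ = _ := by ring
    calc Real.log N * Y ≤ (κ*L) * (N * (3 / r + 1 / (2 * K * L) + 1024 * Real.exp 6 / (E^2 * L))) := by gcongr
      _ = _ := by rw [hκ]; field_simp; ring
  have B3 : ∑ n ∈ (Ioc 0 N).filter (rough (r^16)), (Real.log N - Real.log n) ≤
      N * (1 / (κ*L) + (1/L + 1/r) * (2 * Real.log (κ*L))) := by
    refine t3.trans ?_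
    rw [Real.log_pow]
    have hlk : 0 ≤ Real.log (κ*L) := Real.log_nonneg hκL
    have a1 : ((#((Ioc 0 N).filter (rough (r^16))) : ℕ) : ℝ) ≤ N * (1/L + 1/r) := by
      refine t4.trans ?_
      have := pw 4 (by omega)
      push_cast
      calc ((N:ℝ) - 0)/L + (r:ℝ)^4 ≤ (N - 0)/L + N / r := by gcongr
        _ = _ := by ring
    calc _ ≤ (N:ℝ) / (κ*L)^2 * (κ*L) + N * (1/L + 1/r) * ((2:ℕ) * Real.log (κ*L)) := by gcongr
      _ = _ := by push_cast; field_simp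
  have B2 : (2 * Real.log N + 1) * (N * (4 * Real.log N * Q / L^2 + 20 * Real.log N * (1 + Real.log N) / (r:ℝ)^2))
      ≤ N * (12 * κ^2 * Q + 120 * κ^3 * L^3 / r^2) := by
    calc _ ≤ (3 * (κ * L)) * (N * (4 * (κ*L) * Q / L^2 + 20 * (κ*L) * (2 * (κ*L)) / (r:ℝ)^2)) := by
          gcongr <;> linarith
      _ = _ := by field_simp; ring
  have B4 : 2 * Real.sqrt N * Real.log N + (r^16:ℕ) * Real.log N ≤ N * (3 * κ * L / r) := by
    have a1 : Real.sqrt N ≤ N / r := by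
      rw [le_div_iff₀ hr0]
      have : (r:ℝ) ≤ Real.sqrt N := by
        apply Real.le_sqrt_of_sq_le
        exact (pow_le_pow_right₀ hr1R (by omega)).trans hNR1
      calc Real.sqrt N * r ≤ Real.sqrt N * Real.sqrt N := by gcongr
        _ = N := Real.mul_self_sqrt (by linarith)
    have a2 := pw 16 (by omega)
    push_cast
    calc _ ≤ 2 * (N / r) * (κ * L) + (N/r) * (κ*L) := by gcongr
      _ = _ := by ring
  rw [err, ← hL]
  calc _ ≤ _ := t6
    _ ≤ N * (3 * κ * L / r + 20 * E / K + 40960 * Real.exp 6 / E) + N * (1 / (κ*L) + (1/L + 1/r) * (2 * Real.log (κ*L)))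
       + N * (12 * κ^2 * Q + 120 * κ^3 * L^3 / r^2) + N * (3 * κ * L / r) := by linarith
    _ = _ := by ring

end BP

namespace BP
open Finset
open ArithmeticFunction (vonMangoldt)

lemma tendsto_log_div : Filter.Tendsto (fun x : ℝ => Real.log x / x) Filter.atTop (nhds 0) :=
  Real.isLittleO_log_id_atTop.tendsto_div_nhds_zero

lemma err_tendsto (κ : ℝ) (hκ : 0 < κ) : Filter.Tendsto (err κ) Filter.atTop (nhds 0) := by
  have hf := tendsto_log_div
  have hu : Filter.Tendsto (fun r : ℝ => κ * Real.log r) Filter.atTop Filter.atTop :=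
    Real.tendsto_log_atTop.const_mul_atTop hκ
  have hfu := hf.comp hu
  have h3 : Filter.Tendsto (fun x : ℝ => Real.log x ^ 3 / x) Filter.atTop (nhds 0) :=
    (Real.isLittleO_pow_log_id_atTop (n := 3)).tendsto_div_nhds_zero
  have hi : Filter.Tendsto (fun x : ℝ => x⁻¹) Filter.atTop (nhds 0) := tendsto_inv_atTop_zero
  have hiu := hi.comp hu
  have key := ((((hf.const_mul (6*κ)).add hiu).add (hfu.const_mul (2*κ))).add ((hf.mul hfu).const_mul (2*κ))).add
    ((h3.mul hi).const_mul (120 * κ^3))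
  simp only [mul_zero, add_zero] at key
  refine key.congr' ?_
  filter_upwards [Filter.eventually_gt_atTop 1] with r hr
  have hL := Real.log_pos hr
  have hr0 : 0 < r := by linarith
  simp only [Function.comp, err]
  field_simp
  ring

lemma Q_tendsto : Filter.Tendsto (fun q : ℕ => Real.sqrt q / Nat.totient q) Filter.atTop (nhds 0) := by
  have h1 : Filter.Tendsto (fun q : ℕ => (1 + 2 * Real.log q) / Real.sqrt q) Filter.atTop (nhds 0) := by
    have hs : Filter.Tendsto (fun q : ℕ => Real.sqrt q) Filter.atTop Filter.atTop :=
      Real.tendsto_sqrt_atTop.comp tendsto_natCast_atTop_atTop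
    have h2 := ((tendsto_inv_atTop_zero.comp hs).add ((tendsto_log_div.comp hs).const_mul 4))
    simp only [mul_zero, add_zero] at h2
    refine h2.congr' ?_
    filter_upwards with q
    simp only [Function.comp]
    rw [Real.log_sqrt (by positivity)]
    ring
  refine tendsto_of_tendsto_of_tendsto_of_le_of_le' tendsto_const_nhds h1 ?_ ?_
  · filter_upwards with q; positivity
  · filter_upwards [Filter.eventually_gt_atTop 0] with q hq
    have h := q_div_totient q hq
    have hs : 0 < Real.sqrt q := Real.sqrt_pos.2 (by exact_mod_cast hq)
    rw [le_div_iff₀ hs]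
    calc Real.sqrt q / Nat.totient q * Real.sqrt q = (Real.sqrt q * Real.sqrt q) / Nat.totient q := by ring
      _ = q / Nat.totient q := by rw [Real.mul_self_sqrt (by positivity)]
      _ ≤ _ := h

lemma exists_root (U N R : ℕ) (hU : 1 ≤ U) (hN : (R+1)^U ≤ N) :
    ∃ r, R ≤ r ∧ r^U ≤ N ∧ N < (r+1)^U := by
  have hb : ∀ r, r^U ≤ N → r ≤ N := fun r h => le_trans (Nat.le_self_pow (by omega) r) h
  refine ⟨Nat.findGreatest (fun r => r^U ≤ N) N, ?_, ?_, ?_⟩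
  · have := Nat.le_findGreatest (P := fun r => r^U ≤ N) (hb _ hN) hN
    omega
  · exact Nat.findGreatest_spec (P := fun r => r^U ≤ N) (hb _ hN) hN
  · by_contra h
    push Not at h
    have := Nat.le_findGreatest (P := fun r => r^U ≤ N) (hb _ h) h
    omega

theorem vinogradov {α : ℝ} (hα : Irrational α) (ε : ℝ) (hε : 0 < ε) :
    ∀ᶠ N : ℕ in Filter.atTop,
      ‖∑ p ∈ (Ioc 0 N).filter Nat.Prime, (Real.log p : ℂ) * eR (α * p)‖ ≤ ε * N := by
  obtain ⟨E, hE⟩ := exists_nat_ge (1024 * Real.exp 6 + 2 + 40960 * Real.exp 6 / (ε/4))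
  have he6 := Real.exp_pos 6
  have he61 : 1 ≤ Real.exp 6 := Real.one_le_exp (by norm_num)
  have hpos : 0 ≤ 40960 * Real.exp 6 / (ε/4) := by positivity
  have hE2 : 2 ≤ E := by
    have : (2:ℝ) ≤ E := by linarith
    exact_mod_cast this
  have hE0 : (0:ℝ) < E := by linarith
  have hEa : 40960 * Real.exp 6 / E ≤ ε / 4 := by
    rw [div_le_iff₀ hE0]
    have : 40960 * Real.exp 6 / (ε/4) ≤ E := by linarith
    rw [div_le_iff₀ (by positivity)] at this
    linarith
  have hδ : 2 * Real.exp 6 * (16 / (E:ℝ))^2 ≤ 1/2 := by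
    rw [div_pow, mul_div_assoc', div_le_iff₀ (by positivity)]
    nlinarith
  obtain ⟨K, hK⟩ := exists_nat_ge (20 * (E:ℝ) / (ε/4) + 1)
  have hKp : 0 ≤ 20 * (E:ℝ) / (ε/4) := by positivity
  have hK1 : 1 ≤ K := by
    have : (1:ℝ) ≤ K := by linarith
    exact_mod_cast this
  have hKR : (1:ℝ) ≤ K := by linarith
  have hKa : 20 * (E:ℝ) / K ≤ ε / 4 := by
    rw [div_le_iff₀ (by linarith)]
    have : 20 * (E:ℝ) / (ε/4) ≤ K := by linarith
    rw [div_le_iff₀ (by positivity)] at this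
    linarith
  have h1 : ∀ᶠ r : ℕ in Filter.atTop, err (40 * E) r ≤ ε / 4 :=
    (((err_tendsto (40*E) (by positivity)).comp tendsto_natCast_atTop_atTop).eventually_lt_const
      (show 0 < ε/4 by positivity)).mono fun r h => h.le
  have h2 : ∀ᶠ q : ℕ in Filter.atTop, 12 * (40 * (E:ℝ))^2 * (Real.sqrt q / Nat.totient q) ≤ ε / 4 := by
    have := Q_tendsto.const_mul (12 * (40 * (E:ℝ))^2)
    rw [mul_zero] at this
    exact (this.eventually_lt_const (show 0 < ε/4 by positivity)).mono fun r h => h.le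
  obtain ⟨R0, hR0⟩ := Filter.eventually_atTop.1 h1
  obtain ⟨q0, hq0⟩ := Filter.eventually_atTop.1 h2
  obtain ⟨Q0, hQ0⟩ := approx_large hα K.factorial
  obtain ⟨Q1, hQ1⟩ := approx_large hα q0
  set R := R0 + Q0 + Q1 + 2 with hR
  filter_upwards [Filter.eventually_ge_atTop ((R+1)^(20*E))] with N hN
  obtain ⟨r, hr1, hr2, hr3⟩ := exists_root (20*E) N R (by omega) hN
  have hrp : 1 ≤ r := by omega
  have d1 : r ≤ N / (r^E)^6 := by
    rw [Nat.le_div_iff_mul_le (by positivity)]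
    calc r * (r^E)^6 = r^(E*6+1) := by ring
      _ ≤ r^(20*E) := Nat.pow_le_pow_right hrp (by omega)
      _ ≤ N := hr2
  have d2 : r ≤ N / r^8 := by
    rw [Nat.le_div_iff_mul_le (by positivity)]
    calc r * r^8 = r^9 := by ring
      _ ≤ r^(20*E) := Nat.pow_le_pow_right hrp (by omega)
      _ ≤ N := hr2
  obtain ⟨q₁, hA1, hq1⟩ := exists_approx α (N / (r^E)^6) (by omega)
  obtain ⟨q₂, hA2, hq2⟩ := exists_approx α (N / r^8) (by omega)
  have hq1' := hQ0 _ (by omega) q₁ hA1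
  have hq2' := hQ1 _ (by omega) q₂ hA2
  have hm := main_bound hE2 (by omega) hδ hr2 hr3 hK1 hA1 hq1 (by exact_mod_cast hq1') hA2 hq2
  refine hm.trans ?_
  have c1 := hR0 r (by omega)
  have c2 := hq0 q₂ (by exact_mod_cast hq2'.le)
  rw [mul_comm]
  gcongr
  linarith

end BP

namespace BP
open Finset

lemma pi_lower : ∀ᶠ N : ℕ in Filter.atTop, (N:ℝ) / (4 * Real.log N) ≤ (#((Ioc 0 N).filter Nat.Prime) : ℕ) := by
  have h : ∀ᶠ N : ℕ in Filter.atTop, Real.log ((N:ℝ)+1) / ((N:ℝ)+1) < 1/8 :=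
    ((tendsto_log_div.comp (Filter.tendsto_atTop_add_const_right _ 1 tendsto_natCast_atTop_atTop)).eventually_lt_const
      (show (0:ℝ) < 1/8 by norm_num))
  filter_upwards [h, Filter.eventually_ge_atTop 2] with N hN hN2
  rw [← Nat.primesLE_eq_filter_Ioc_zero, Nat.primesLE_card_eq_primeCounting]
  refine le_trans ?_ (Chebyshev.pi_ge N)
  have hNR : (2:ℝ) ≤ N := by exact_mod_cast hN2
  have hL : 0 < Real.log N := Real.log_pos (by linarith)
  rw [div_lt_iff₀ (by linarith)] at hN
  have := Real.log_two_gt_d9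
  rw [show (N:ℝ) / (4 * Real.log N) = (N/4) / Real.log N by field_simp]
  gcongr
  nlinarith

lemma prime_exp_sum {α : ℝ} (hα : Irrational α) (ε : ℝ) (hε : 0 < ε) :
    ∀ᶠ N : ℕ in Filter.atTop,
      ‖∑ p ∈ (Ioc 0 N).filter Nat.Prime, eR (α * p)‖ ≤ ε * (#((Ioc 0 N).filter Nat.Prime) : ℕ) := by
  have hlog : Filter.Tendsto (fun N : ℕ => Real.log N) Filter.atTop Filter.atTop :=
    Real.tendsto_log_atTop.comp tendsto_natCast_atTop_atTop
  have h1 := (tendsto_log_div.comp hlog).eventually_lt_const (show 0 < ε/6 by positivity)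
  have h2 := (tendsto_inv_atTop_zero.comp hlog).eventually_lt_const (show 0 < ε/12 by positivity)
  filter_upwards [vinogradov hα (ε/12) (by positivity), pi_lower, h1, h2, hlog.eventually_ge_atTop 1] with N hv hp h1 h2 h3
  simp only [Function.comp] at h1 h2
  set S := (Ioc 0 N).filter Nat.Prime
  set L := Real.log N with hL
  have hL0 : 0 < L := by linarith
  have hdef := log_defect N S (filter_subset _ _) (L^2) (by nlinarith)
  rw [Real.log_pow, ← hL] at hdef
  have e1 : (L:ℂ) * ∑ p ∈ S, eR (α * p) = ∑ p ∈ S, (Real.log p : ℂ) * eR (α * p) +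
      ∑ p ∈ S, ((L - Real.log p : ℝ) : ℂ) * eR (α * p) := by
    rw [mul_sum, ← sum_add_distrib]
    refine sum_congr rfl fun n _ => ?_
    push_cast; ring
  have e2 : L * ‖∑ p ∈ S, eR (α * p)‖ ≤ ε/12 * N + ∑ p ∈ S, (L - Real.log p) := by
    calc L * ‖∑ p ∈ S, eR (α * p)‖ = ‖(L:ℂ) * ∑ p ∈ S, eR (α * p)‖ := by
          rw [norm_mul, Complex.norm_real, Real.norm_of_nonneg hL0.le]
      _ ≤ _ := by
          rw [e1]
          refine (norm_add_le _ _).trans (add_le_add hv ?_)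
          refine (norm_sum_le _ _).trans (sum_le_sum fun n hn => ?_)
          rw [norm_mul, norm_eR, mul_one, Complex.norm_real, Real.norm_of_nonneg]
          have hn' := mem_Ioc.1 (mem_filter.1 hn).1
          have : Real.log n ≤ Real.log N := Real.log_le_log (by exact_mod_cast hn'.1) (by exact_mod_cast hn'.2)
          linarith
  rw [div_le_iff₀ (by positivity)] at hp
  rw [div_lt_iff₀ hL0] at h1
  have hc : (0:ℝ) ≤ (#S : ℕ) := by positivity
  have e3 : N / L^2 * L ≤ ε/12 * (N:ℝ) := by
    calc N / L^2 * L = L⁻¹ * (N:ℝ) := by field_simp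
      _ ≤ _ := by gcongr
  have e4 : (#S : ℕ) * ((2:ℕ) * Real.log L) ≤ (#S : ℕ) * ((2:ℕ) * (ε/6*L)) := by gcongr
  push_cast at e4 hdef
  have : L * ‖∑ p ∈ S, eR (α * p)‖ ≤ L * (ε * (#S : ℕ)) := by nlinarith
  exact le_of_mul_le_mul_left this hL0

lemma primes_image (N : ℕ) : (Ioc 0 (Nat.nth Nat.Prime N - 1)).filter Nat.Prime = (range N).image (Nat.nth Nat.Prime) := by
  ext p
  simp only [mem_filter, mem_Ioc, mem_image, mem_range]
  have hm : StrictMono (Nat.nth Nat.Prime) := Nat.nth_strictMono Nat.infinite_setOf_prime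
  constructor
  · rintro ⟨⟨h1, h2⟩, h3⟩
    refine ⟨Nat.count Nat.Prime p, ?_, Nat.nth_count h3⟩
    rw [← hm.lt_iff_lt, Nat.nth_count h3]
    omega
  · rintro ⟨i, hi, rfl⟩
    have := hm hi
    have hp := Nat.prime_nth_prime i
    exact ⟨⟨hp.pos, by omega⟩, hp⟩

lemma weyl_sum {α : ℝ} (hα : Irrational α) :
    Filter.Tendsto (fun N : ℕ => (∑ i ∈ range N, eR (α * (Nat.nth Nat.Prime i : ℕ))) / (N:ℂ)) Filter.atTop (nhds 0) := by
  rw [Metric.tendsto_nhds]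
  intro ε hε
  have hm : StrictMono (Nat.nth Nat.Prime) := Nat.nth_strictMono Nat.infinite_setOf_prime
  have ht : Filter.Tendsto (fun N : ℕ => Nat.nth Nat.Prime N - 1) Filter.atTop Filter.atTop :=
    (Filter.tendsto_sub_atTop_nat 1).comp hm.tendsto_atTop
  filter_upwards [ht.eventually (prime_exp_sum hα (ε/2) (by positivity)), Filter.eventually_gt_atTop 0] with N hN h0
  rw [primes_image, sum_image hm.injective.injOn, card_image_of_injective _ hm.injective, card_range] at hN
  have h0' : (0:ℝ) < N := by exact_mod_cast h0
  rw [dist_zero_right, norm_div, Complex.norm_natCast, div_lt_iff₀ h0']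
  nlinarith

end BP

namespace BP
open Finset MeasureTheory

lemma integral_fourier' (n : ℤ) (hn : n ≠ 0) : ∫ x : UnitAddCircle, fourier n x = 0 := by
  have h := fourier_add_half_inv_index (T := 1) hn one_pos
  exact integral_eq_zero_of_add_right_eq_neg (μ := volume) h

instance : IsProbabilityMeasure (volume : Measure UnitAddCircle) := ⟨UnitAddCircle.measure_univ⟩

lemma avg_cont (x : ℕ → UnitAddCircle)
    (hx : ∀ n : ℤ, n ≠ 0 → Filter.Tendsto (fun N : ℕ => (∑ i ∈ range N, fourier n (x i)) / (N:ℂ)) Filter.atTop (nhds 0))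
    (f : C(UnitAddCircle, ℂ)) :
    Filter.Tendsto (fun N : ℕ => (∑ i ∈ range N, f (x i)) / (N:ℂ)) Filter.atTop (nhds (∫ y, f y)) := by
  have hint : ∀ g : C(UnitAddCircle, ℂ), Integrable g volume := fun g =>
    g.continuous.integrable_of_hasCompactSupport (HasCompactSupport.of_compactSpace g)
  have hspan : ∀ g ∈ Submodule.span ℂ (Set.range (@fourier (1:ℝ))),
      Filter.Tendsto (fun N : ℕ => (∑ i ∈ range N, g (x i)) / (N:ℂ)) Filter.atTop (nhds (∫ y : UnitAddCircle, g y)) := by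
    intro g hg
    induction hg using Submodule.span_induction with
    | mem g hg =>
      obtain ⟨n, rfl⟩ := hg
      by_cases hn : n = 0
      · subst hn
        have : ∫ y : UnitAddCircle, fourier 0 y = 1 := by simp
        rw [this]
        refine tendsto_const_nhds.congr' ?_
        filter_upwards [Filter.eventually_gt_atTop 0] with N hN
        have : (N:ℂ) ≠ 0 := by exact_mod_cast hN.ne'
        simp [this]
      · rw [integral_fourier' n hn]; exact hx n hn
    | zero => simp
    | add f g _ _ hf hg =>
      have := hf.add hg
      rw [← integral_add (hint f) (hint g)] at this
      refine this.congr fun N => ?_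
      simp only [ContinuousMap.add_apply, sum_add_distrib]; ring
    | smul c f _ hf =>
      have := hf.const_mul c
      simp only [ContinuousMap.smul_apply, smul_eq_mul, integral_const_mul]
      refine this.congr fun N => ?_
      rw [← mul_sum]; ring
  have hcl : f ∈ (Submodule.span ℂ (Set.range (@fourier (1:ℝ)))).topologicalClosure := by
    rw [span_fourier_closure_eq_top]; trivial
  rw [Metric.tendsto_nhds]
  intro ε hε
  rw [← SetLike.mem_coe, Submodule.topologicalClosure_coe, Metric.mem_closure_iff] at hcl
  obtain ⟨g, hg, hfg⟩ := hcl (ε/3) (by positivity)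
  have hb : ∀ y, ‖f y - g y‖ ≤ ε/3 := fun y => by
    rw [← dist_eq_norm]
    exact (ContinuousMap.dist_apply_le_dist y).trans hfg.le
  filter_upwards [Metric.tendsto_nhds.1 (hspan g hg) (ε/3) (by positivity), Filter.eventually_gt_atTop 0] with N hN h0
  have h0' : (0:ℝ) < N := by exact_mod_cast h0
  have b1 : ‖(∑ i ∈ range N, f (x i)) / (N:ℂ) - (∑ i ∈ range N, g (x i)) / (N:ℂ)‖ ≤ ε/3 := by
    rw [← sub_div, norm_div, Complex.norm_natCast, div_le_iff₀ h0', ← sum_sub_distrib]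
    calc _ ≤ ∑ i ∈ range N, ‖f (x i) - g (x i)‖ := norm_sum_le _ _
      _ ≤ ∑ i ∈ range N, ε/3 := sum_le_sum fun i _ => hb _
      _ = _ := by rw [sum_const, card_range, nsmul_eq_mul, mul_comm]
  have b2 : ‖∫ y : UnitAddCircle, g y - f y‖ ≤ ε/3 := by
    have := norm_integral_le_of_norm_le_const (μ := (volume : Measure UnitAddCircle)) (f := fun y => g y - f y) (C := ε/3)
      (Filter.Eventually.of_forall fun y => by rw [norm_sub_rev]; exact hb y)
    simpa using this
  rw [integral_sub (hint g) (hint f)] at b2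
  rw [dist_eq_norm] at hN ⊢
  calc _ = ‖((∑ i ∈ range N, f (x i)) / (N:ℂ) - (∑ i ∈ range N, g (x i)) / (N:ℂ)) + ((∑ i ∈ range N, g (x i)) / (N:ℂ) - ∫ y, g y)
      + ((∫ y, g y) - ∫ y, f y)‖ := by congr 1; ring
    _ ≤ _ := norm_add₃_le
    _ < ε := by linarith

noncomputable def emp (x : ℕ → UnitAddCircle) (N : ℕ) : Measure UnitAddCircle :=
  ((N + 1 : ℕ) : ENNReal)⁻¹ • ∑ i ∈ range (N+1), Measure.dirac (x i)

instance (x : ℕ → UnitAddCircle) (N : ℕ) : IsProbabilityMeasure (emp x N) := ⟨by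
  rw [emp, Measure.smul_apply, Measure.finset_sum_apply]
  simp only [measure_univ, sum_const, card_range, nsmul_eq_mul, mul_one, smul_eq_mul]
  exact ENNReal.inv_mul_cancel (by positivity) (ENNReal.natCast_ne_top _)⟩

lemma emp_integral (x : ℕ → UnitAddCircle) (N : ℕ) (f : UnitAddCircle → ℝ) :
    ∫ y, f y ∂(emp x N) = (∑ i ∈ range (N+1), f (x i)) / ((N+1:ℕ):ℝ) := by
  rw [emp, integral_smul_measure, integral_finset_sum_measure]
  · simp only [integral_dirac]
    rw [ENNReal.toReal_inv, ENNReal.toReal_natCast, smul_eq_mul]; ring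
  · intro i _; exact integrable_dirac (by simp)

open Classical in
lemma emp_apply (x : ℕ → UnitAddCircle) (N : ℕ) (A : Set UnitAddCircle) :
    (emp x N A).toReal = (#((range (N+1)).filter (fun i => x i ∈ A)) : ℝ) / ((N+1:ℕ):ℝ) := by
  rw [emp, Measure.smul_apply, Measure.finset_sum_apply]
  simp only [Measure.dirac_apply, Set.indicator_apply, Pi.one_apply]
  rw [← sum_filter, sum_const, nsmul_eq_mul, mul_one, smul_eq_mul, ENNReal.toReal_mul, ENNReal.toReal_inv,
    ENNReal.toReal_natCast, ENNReal.toReal_natCast, mul_comm, div_eq_mul_inv]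

lemma arc_frontier (s t : ℝ) :
    (volume : Measure UnitAddCircle) (frontier ((fun y : ℝ => (y : UnitAddCircle)) '' Set.Ico s t)) = 0 := by
  set m : ℝ → UnitAddCircle := fun y => (y : UnitAddCircle) with hm
  have hmc : Continuous m := AddCircle.continuous_mk' 1
  have hmo : IsOpenMap m := QuotientAddGroup.isOpenMap_coe
  have h1 : closure (m '' Set.Ico s t) ⊆ m '' Set.Icc s t :=
    closure_minimal (Set.image_mono Set.Ico_subset_Icc_self) (isCompact_Icc.image hmc).isClosed
  have h2 : m '' Set.Ioo s t ⊆ interior (m '' Set.Ico s t) :=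
    interior_maximal (Set.image_mono Set.Ioo_subset_Ico_self) (hmo _ isOpen_Ioo)
  have h3 : frontier (m '' Set.Ico s t) ⊆ {m s, m t} := by
    rintro y ⟨hy1, hy2⟩
    obtain ⟨u, hu, rfl⟩ := h1 hy1
    by_contra hne
    simp only [Set.mem_insert_iff, Set.mem_singleton_iff, not_or] at hne
    apply hy2
    apply h2
    refine ⟨u, ⟨lt_of_le_of_ne hu.1 ?_, lt_of_le_of_ne hu.2 ?_⟩, rfl⟩
    · rintro rfl; exact hne.1 rfl
    · rintro rfl; exact hne.2 rfl
  have hpt : ∀ y : UnitAddCircle, (volume : Measure UnitAddCircle) {y} = 0 := by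
    intro y
    have := AddCircle.volume_closedBall (T := 1) (x := y) 0
    rw [Metric.closedBall_zero] at this
    rw [this]; simp
  refine measure_mono_null h3 ?_
  rw [Set.insert_eq]
  exact measure_union_null (hpt _) (hpt _)

lemma arc_volume (s t : ℝ) (hst : s ≤ t) (ht : t ≤ s + 1) :
    (volume : Measure UnitAddCircle) ((fun y : ℝ => (y : UnitAddCircle)) '' Set.Ico s t) = ENNReal.ofReal (t - s) := by
  set m : ℝ → UnitAddCircle := fun y => (y : UnitAddCircle) with hm
  have hmp := UnitAddCircle.measurePreserving_mk s
  have hms : MeasurableSet (m '' Set.Ico s t) := by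
    have : m '' Set.Ico s t = (m '' Set.Icc s t \ {m t}) ∪ (m '' Set.Ico s t ∩ {m t}) := by
      ext y
      constructor
      · intro hy
        by_cases h : y = m t
        · right; exact ⟨hy, h⟩
        · left; exact ⟨Set.image_mono Set.Ico_subset_Icc_self hy, h⟩
      · rintro (⟨⟨u, hu, rfl⟩, h2⟩ | h)
        · refine ⟨u, ⟨hu.1, lt_of_le_of_ne hu.2 ?_⟩, rfl⟩
          rintro rfl; exact h2 rfl
        · exact h.1
    rw [this]
    refine MeasurableSet.union (MeasurableSet.diff ?_ (measurableSet_singleton _)) ?_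
    · exact (isCompact_Icc.image (AddCircle.continuous_mk' 1)).isClosed.measurableSet
    · exact ((Set.finite_singleton (m t)).subset Set.inter_subset_right).measurableSet
  rw [← hmp.measure_preimage hms.nullMeasurableSet, Measure.restrict_apply (hmp.measurable hms)]
  apply le_antisymm
  · have : (fun y : ℝ => (y : UnitAddCircle)) ⁻¹' (m '' Set.Ico s t) ∩ Set.Ioc s (s+1) ⊆ Set.Ioo s t ∪ {s+1} := by
      rintro y ⟨⟨u, hu, huy⟩, hy⟩
      by_cases h : y = s + 1
      · right; exact h
      · left
        have hy' : y ∈ Set.Ico s (s+1) := ⟨hy.1.le, lt_of_le_of_ne hy.2 h⟩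
        have hu' : u ∈ Set.Ico s (s+1) := ⟨hu.1, hu.2.trans_le ht⟩
        have : u = y := (AddCircle.coe_eq_coe_iff_of_mem_Ico hu' hy').1 huy
        exact ⟨hy.1, this ▸ hu.2⟩
    refine (measure_mono this).trans ((measure_union_le _ _).trans ?_)
    simp
  · have : Set.Ioo s t ⊆ (fun y : ℝ => (y : UnitAddCircle)) ⁻¹' (m '' Set.Ico s t) ∩ Set.Ioc s (s+1) := by
      intro y hy
      exact ⟨⟨y, ⟨hy.1.le, hy.2⟩, rfl⟩, hy.1, hy.2.le.trans ht⟩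
    refine le_trans ?_ (measure_mono this)
    simp

noncomputable def empP (x : ℕ → UnitAddCircle) (N : ℕ) : ProbabilityMeasure UnitAddCircle := ⟨emp x N, inferInstance⟩

noncomputable def volP : ProbabilityMeasure UnitAddCircle := ⟨volume, inferInstance⟩

open Classical in
lemma weyl (x : ℕ → UnitAddCircle)
    (hx : ∀ n : ℤ, n ≠ 0 → Filter.Tendsto (fun N : ℕ => (∑ i ∈ range N, fourier n (x i)) / (N:ℂ)) Filter.atTop (nhds 0))
    (s t : ℝ) (hst : s ≤ t) (ht : t ≤ s + 1) :
    Filter.Tendsto (fun N : ℕ => (#((range N).filter (fun i => x i ∈ (fun y : ℝ => (y : UnitAddCircle)) '' Set.Ico s t)) : ℝ) / (N:ℝ))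
      Filter.atTop (nhds (t - s)) := by
  have hw : Filter.Tendsto (empP x) Filter.atTop
      (nhds volP) := by
    rw [ProbabilityMeasure.tendsto_iff_forall_integral_tendsto]
    intro f
    simp only [empP, volP, ProbabilityMeasure.coe_mk, emp_integral]
    have h := avg_cont x hx ⟨fun y => (f y : ℂ), by fun_prop⟩
    have h2 := (Complex.continuous_re.tendsto _).comp (h.comp (Filter.tendsto_add_atTop_nat 1))
    simp only [ContinuousMap.coe_mk, integral_complex_ofReal, Complex.ofReal_re] at h2
    refine h2.congr fun N => ?_
    simp only [Function.comp, ContinuousMap.coe_mk]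
    rw [← Complex.ofReal_sum, ← Complex.ofReal_natCast, ← Complex.ofReal_div, Complex.ofReal_re]
  have h := ProbabilityMeasure.tendsto_measure_of_null_frontier_of_tendsto' hw (E := (fun y : ℝ => (y : UnitAddCircle)) '' Set.Ico s t) (arc_frontier s t)
  simp only [empP, volP, ProbabilityMeasure.coe_mk, arc_volume s t hst ht] at h
  have h2 := (ENNReal.tendsto_toReal ENNReal.ofReal_ne_top).comp h
  rw [ENNReal.toReal_ofReal (by linarith)] at h2
  rw [← Filter.tendsto_add_atTop_iff_nat 1]
  refine h2.congr fun N => ?_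
  simp only [Function.comp]
  exact emp_apply x N _

end BP

namespace BP
open Finset

lemma digit_iff {a : ℝ} (ha : 0 < a) (d : ℕ) (hd : 1 ≤ d) (p : ℕ) :
    HasLeadingDigit (a ^ p) d ↔ ((Real.logb 10 a * p : ℝ) : UnitAddCircle) ∈
      (fun y : ℝ => (y : UnitAddCircle)) '' Set.Ico (Real.logb 10 d) (Real.logb 10 ((d:ℝ)+1)) := by
  have hd0 : (0:ℝ) < d := by exact_mod_cast hd
  have key : ∀ k : ℤ, ((d : ℝ) * 10 ^ k ≤ a^p ∧ a^p < ((d : ℝ) + 1) * 10 ^ k) ↔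
      (Real.logb 10 d + k ≤ Real.logb 10 a * p ∧ Real.logb 10 a * p < Real.logb 10 ((d:ℝ)+1) + k) := by
    intro k
    have h10 : (0:ℝ) < 10 ^ k := by positivity
    have hz : Real.logb 10 ((10:ℝ)^k) = k := by
      rw [← Real.rpow_intCast, Real.logb_rpow (by norm_num) (by norm_num)]
    have e1 : Real.logb 10 ((d:ℝ) * 10^k) = Real.logb 10 d + k := by
      rw [Real.logb_mul hd0.ne' h10.ne', hz]
    have e2 : Real.logb 10 (((d:ℝ)+1) * 10^k) = Real.logb 10 ((d:ℝ)+1) + k := by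
      rw [Real.logb_mul (by positivity) h10.ne', hz]
    have e3 : Real.logb 10 (a^p) = Real.logb 10 a * p := by rw [Real.logb_pow, mul_comm]
    rw [← e1, ← e2, ← e3, Real.logb_le_logb (by norm_num) (by positivity) (by positivity),
      Real.logb_lt_logb_iff (by norm_num) (by positivity) (by positivity)]
  rw [HasLeadingDigit]
  simp only [key]
  constructor
  · rintro ⟨k, h1, h2⟩
    refine ⟨Real.logb 10 a * p - k, ⟨by linarith, by linarith⟩, ?_⟩
    have hk : ((k:ℝ) : UnitAddCircle) = 0 := by
      rw [AddCircle.coe_eq_zero_iff]; exact ⟨k, by simp⟩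
    simp only [AddCircle.coe_sub, hk, sub_zero]
  · rintro ⟨y, ⟨h1, h2⟩, h3⟩
    simp only at h3
    rw [← sub_eq_zero, ← AddCircle.coe_sub, AddCircle.coe_eq_zero_iff] at h3
    obtain ⟨k, hk⟩ := h3
    simp only [zsmul_eq_mul, mul_one] at hk
    exact ⟨-k, by push_cast; linarith, by push_cast; linarith⟩

theorem benford_main (a : ℝ) (ha : 0 < a)
    (hirr : Irrational (Real.logb 10 a)) :
    BenfordDistributed (fun n : ℕ => a ^ nthPrime n) := by
  classical
  intro d hd1 hd9
  have hd0 : (0:ℝ) < d := by exact_mod_cast hd1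
  set θ := Real.logb 10 a with hθ
  set x : ℕ → UnitAddCircle := fun i => ((θ * (Nat.nth Nat.Prime i : ℕ) : ℝ) : UnitAddCircle) with hxd
  have hx : ∀ n : ℤ, n ≠ 0 → Filter.Tendsto (fun N : ℕ => (∑ i ∈ range N, fourier n (x i)) / (N:ℂ)) Filter.atTop (nhds 0) := by
    intro n hn
    have hi : Irrational ((n:ℝ) * θ) := hirr.intCast_mul hn
    refine (weyl_sum hi).congr fun N => ?_
    congr 1
    refine sum_congr rfl fun i _ => ?_
    rw [hxd, fourier_coe_apply, eR]
    congr 1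
    push_cast; ring
  have hmon : Real.logb 10 d ≤ Real.logb 10 ((d:ℝ)+1) :=
    Real.logb_le_logb_of_le (by norm_num) hd0 (by linarith)
  have hd9' : (d:ℝ) ≤ 9 := by exact_mod_cast hd9
  have hup : Real.logb 10 ((d:ℝ)+1) ≤ Real.logb 10 d + 1 := by
    have h1 : Real.logb 10 ((d:ℝ)+1) ≤ 1 := by
      refine le_of_le_of_eq ?_ (Real.logb_self_eq_one (b := 10) (by norm_num))
      exact Real.logb_le_logb_of_le (by norm_num) (by positivity) (by linarith)
    have h2 : 0 ≤ Real.logb 10 d := Real.logb_nonneg (by norm_num) (by exact_mod_cast hd1)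
    linarith
  have h := weyl x hx (Real.logb 10 d) (Real.logb 10 ((d:ℝ)+1)) hmon hup
  have e : Real.logb 10 ((d:ℝ)+1) - Real.logb 10 d = benfordP d := by
    rw [benfordP, ← Real.logb_div (by positivity) hd0.ne']
    congr 1; field_simp
  rw [e] at h
  refine h.congr fun N => ?_
  congr 2
  rw [← Set.ncard_coe_finset]
  rw [Nat.card_coe_set_eq]
  rw [← Set.ncard_image_of_injective _ Nat.succ_injective]
  congr 1
  ext n
  simp only [Set.mem_image, Set.mem_setOf_eq, coe_filter, mem_range]
  constructor
  · rintro ⟨i, ⟨h1, h2⟩, rfl⟩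
    refine ⟨by omega, by omega, ?_⟩
    rw [digit_iff ha d hd1]
    exact h2
  · rintro ⟨h1, h2, h3⟩
    refine ⟨n - 1, ⟨by omega, ?_⟩, by omega⟩
    rw [digit_iff ha d hd1] at h3
    exact h3

end BP

/-- If `log₁₀ a` is irrational, then the sequence `{a^{p_n}}` is Benford distributed. -/
theorem benford_pow_nthPrime (a : ℝ) (ha : 0 < a)
    (hirr : Irrational (Real.logb 10 a)) :
    BenfordDistributed (fun n : ℕ => a ^ nthPrime n) := by
  exact BP.benford_main a ha hirr
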